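/- arXiv:1407.2529 — 6 statements merged into one kernel-verified Lean document; each statement's English description precedes it below -/
import Mathlib

section
/- Let F be a perfect field of characteristic p > 0 and let k be a finitely generated field extension of F of transcendence degree d. Let A be a finite-type k-algebra that is an integral domain such that the localization A_q is a regular local ring for every prime q of A (the coordinate ring of an affine chart of a regular k-variety). Fix a prime m of A, set R := A_m, let k̄ be an algebraic closure of k, and let q be a prime ideal of R ⊗_k k̄ lying over the maximal ideal of R. Then edim((R ⊗_k k̄)_q) ≤ edim(R) + d. -/
open TensorProduct IsLocalRing

/-- The embedding dimension of a local ring: the dimension of the Zariski cotangent space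
`m/m²` over the residue field. -/
noncomputable def edim (R : Type) [CommRing R] [IsLocalRing R] : ℕ :=
  Module.finrank (ResidueField R) (CotangentSpace R)

/-- A Noetherian local ring is regular if its Krull dimension equals its embedding dimension. -/
def IsRegularLocalRing' (R : Type) [CommRing R] [IsLocalRing R] : Prop :=
  IsNoetherianRing R ∧ ringKrullDim R = (edim R : WithBot ℕ∞)


open IntermediateField.algebraAdjoinAdjoin in
theorem aux_rank_kaehler (K L : Type) [Field K] [PerfectField K] [Field L] [Algebra K L]
    [Algebra.EssFiniteType K L] :
    Module.rank L (Ω[L⁄K]) = Algebra.trdeg K L := by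
  obtain ⟨s, hs, H⟩ := exists_isTranscendenceBasis_and_isSeparable_of_perfectField K L
  have H' : Algebra.IsSeparable (↥(IntermediateField.adjoin K (Set.range ((↑) : s → L)))) L := by
    convert! H <;> simp
  let v : s → L := (↑)
  have hv : AlgebraicIndependent K v := hs.1
  rw [← hs.cardinalMk_eq_trdeg]
  let P : Subalgebra K L := Algebra.adjoin K (Set.range v)
  let : Algebra P (IntermediateField.adjoin K (Set.range v)) := inferInstanceAs (Algebra (Algebra.adjoin K (Set.range v)) _)
  have : IsScalarTower P (IntermediateField.adjoin K (Set.range v)) L := inferInstanceAs (IsScalarTower (Algebra.adjoin K (Set.range v)) _ _)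
  have : IsFractionRing P (IntermediateField.adjoin K (Set.range v)) := inferInstanceAs (IsFractionRing (Algebra.adjoin K (Set.range v)) _)
  have : Algebra.FormallyEtale P (IntermediateField.adjoin K (Set.range v)) :=
    .of_isLocalization (nonZeroDivisors _)
  have : Algebra.FormallyEtale (IntermediateField.adjoin K (Set.range v)) L :=
    Algebra.FormallyEtale.of_isSeparable _ L
  have : Algebra.FormallyEtale P L :=  .comp _ (IntermediateField.adjoin K (Set.range v)) _
  let e : MvPolynomial s K ≃ₐ[K] P := hv.aevalEquiv
  let : Algebra (MvPolynomial s K) P := e.toAlgHom.toRingHom.toAlgebra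
  let : Algebra (MvPolynomial s K) L := ((algebraMap P L).comp e.toAlgHom.toRingHom).toAlgebra
  have : IsScalarTower (MvPolynomial s K) P L := .of_algebraMap_eq' rfl
  have : IsScalarTower K (MvPolynomial s K) P := .of_algebraMap_eq' e.toAlgHom.comp_algebraMap.symm
  have : IsScalarTower K (MvPolynomial s K) L := .to₁₂₄ _ _ P _
  have : Algebra.FormallyEtale (MvPolynomial s K) P := 
    .of_equiv (AlgEquiv.ofBijective (Algebra.ofId (MvPolynomial s K) P) e.bijective)
  have : Algebra.FormallyEtale (MvPolynomial s K) L := .comp _ P _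
  let b := ((KaehlerDifferential.mvPolynomialBasis K s).baseChange L).map
    (KaehlerDifferential.tensorKaehlerEquivOfFormallyEtale K (MvPolynomial s K) L)
  exact b.mk_eq_rank''.symm

theorem auxι_exists (K S L : Type) [Field K] [CommRing S] [Field L] [Algebra K S] [Algebra K L]
    [Algebra S L] [IsScalarTower K S L] (hs : Function.Surjective (algebraMap S L))
    (I : Ideal S) (hI : RingHom.ker (algebraMap S L) = I) :
    ∃ f : I.Cotangent →ₗ[S] L ⊗[S] Ω[S⁄K],
      Function.Exact f (KaehlerDifferential.mapBaseChange K S L) ∧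
      (Algebra.FormallySmooth K L → Function.Injective f) := by
  subst hI
  refine ⟨KaehlerDifferential.kerCotangentToTensor K S L,
    KaehlerDifferential.exact_kerCotangentToTensor_mapBaseChange K S L hs, fun h => ?_⟩
  have hsurj : Function.Surjective (IsScalarTower.toAlgHom K S L).kerSquareLift := by
    intro x
    obtain ⟨y, rfl⟩ := hs x
    exact ⟨Ideal.Quotient.mk _ y, rfl⟩
  have hnil : IsNilpotent (RingHom.ker (IsScalarTower.toAlgHom K S L).kerSquareLift.toRingHom) := by
    refine ⟨2, ?_⟩
    rw [AlgHom.ker_kerSquareLift]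
    exact Ideal.cotangentIdeal_square _
  let g := Algebra.FormallySmooth.liftOfSurjective (AlgHom.id K L)
    (IsScalarTower.toAlgHom K S L).kerSquareLift hsurj hnil
  have hg : (IsScalarTower.toAlgHom K S L).kerSquareLift.comp g = AlgHom.id K L :=
    Algebra.FormallySmooth.comp_liftOfSurjective _ _ _ _
  obtain ⟨l, hl⟩ := (retractionKerCotangentToTensorEquivSection hs).symm ⟨g, hg⟩
  exact Function.LeftInverse.injective (g := l) (fun x => LinearMap.congr_fun hl x)

section
variable (K S : Type) [Field K] [CommRing S] [IsLocalRing S] [Algebra K S]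

theorem auxι_exists' : ∃ f : CotangentSpace S →ₗ[ResidueField S] ResidueField S ⊗[S] Ω[S⁄K],
      Function.Exact f (KaehlerDifferential.mapBaseChange K S (ResidueField S)) ∧
      (Algebra.FormallySmooth K (ResidueField S) → Function.Injective f) := by
  obtain ⟨f, h1, h2⟩ := auxι_exists K S (ResidueField S) residue_surjective
    (maximalIdeal S) (by rw [ResidueField.algebraMap_eq, ker_residue])
  exact ⟨LinearMap.extendScalarsOfSurjective (R := S) (S := ResidueField S) residue_surjective f,
    h1, h2⟩

theorem aux_rank_le : Module.rank (ResidueField S) (ResidueField S ⊗[S] Ω[S⁄K]) ≤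
    Module.rank (ResidueField S) (CotangentSpace S) +
      Module.rank (ResidueField S) Ω[ResidueField S⁄K] := by
  obtain ⟨f, h1, -⟩ := auxι_exists' K S
  rw [← (KaehlerDifferential.mapBaseChange K S (ResidueField S)).rank_range_add_rank_ker, add_comm]
  refine add_le_add ?_ (Submodule.rank_le _)
  rw [h1.linearMap_ker_eq]
  exact LinearMap.rank_le_domain f

theorem aux_rank_eq [Algebra.FormallySmooth K (ResidueField S)] :
    Module.rank (ResidueField S) (ResidueField S ⊗[S] Ω[S⁄K]) =
    Module.rank (ResidueField S) (CotangentSpace S) +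
      Module.rank (ResidueField S) Ω[ResidueField S⁄K] := by
  obtain ⟨f, h1, h2⟩ := auxι_exists' K S
  rw [← (KaehlerDifferential.mapBaseChange K S (ResidueField S)).rank_range_add_rank_ker, add_comm]
  rw [h1.linearMap_ker_eq, rank_range_of_injective f (h2 inferInstance)]
  rw [rank_range_of_surjective _ (KaehlerDifferential.mapBaseChange_surjective K S _
    residue_surjective)]

end

theorem aux_surj (F k R K R' S : Type) [Field F] [Field k] [CommRing R] [IsLocalRing R] [Field K]
    [CommRing R'] [CommRing S] [IsLocalRing S] [Algebra F k] [Algebra k R] [Algebra F R]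
    [IsScalarTower F k R]
    [Algebra k K] [Algebra k R'] [Algebra R R'] [Algebra K R'] [IsScalarTower k R R']
    [IsScalarTower k K R'] [Algebra.IsPushout k K R R']
    [Algebra R' S] [Algebra K S] [IsScalarTower K R' S] [Algebra R S] [IsScalarTower R R' S]
    [IsLocalHom (algebraMap R S)] [Algebra.FormallyEtale R' S] :
    Module.rank (ResidueField S) (ResidueField S ⊗[S] Ω[S⁄K]) ≤
      Module.rank (ResidueField R) (ResidueField R ⊗[R] Ω[R⁄F]) := by
  let L := ResidueField S
  have e1 : L ⊗[S] Ω[S⁄K] ≃ₗ[L] L ⊗[R] Ω[R⁄k] :=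
    (TensorProduct.AlgebraTensorModule.congr (LinearEquiv.refl L L)
      (KaehlerDifferential.tensorKaehlerEquivOfFormallyEtale K R' S).symm) ≪≫ₗ
    (TensorProduct.AlgebraTensorModule.cancelBaseChange R' S L L _) ≪≫ₗ
    (TensorProduct.AlgebraTensorModule.congr (LinearEquiv.refl L L)
      (KaehlerDifferential.tensorKaehlerEquiv k K R R').symm) ≪≫ₗ
    (TensorProduct.AlgebraTensorModule.cancelBaseChange R R' L L _)
  have e2 : L ⊗[ResidueField R] (ResidueField R ⊗[R] Ω[R⁄F]) ≃ₗ[L] L ⊗[R] Ω[R⁄F] :=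
    TensorProduct.AlgebraTensorModule.cancelBaseChange R (ResidueField R) L L _
  let g : L ⊗[R] Ω[R⁄F] →ₗ[L] L ⊗[R] Ω[R⁄k] :=
    (KaehlerDifferential.map F k R R).baseChange L
  have hg : Function.Surjective g :=
    LinearMap.lTensor_surjective L 
      (KaehlerDifferential.map_surjective F k R)
  calc _ = Module.rank L (L ⊗[R] Ω[R⁄k]) := e1.rank_eq
    _ ≤ Module.rank L (L ⊗[R] Ω[R⁄F]) := by
        rw [← rank_range_of_surjective g hg]; exact LinearMap.rank_le_domain g
    _ = Module.rank L (L ⊗[ResidueField R] (ResidueField R ⊗[R] Ω[R⁄F])) := e2.rank_eq.symm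
    _ = _ := by rw [Module.rank_baseChange, Cardinal.lift_id]

theorem aux_core (F k R K R' : Type) [Field F] [PerfectField F] [Field k] [CommRing R]
    [IsLocalRing R] [IsNoetherianRing R] [Field K] [PerfectField K]
    [CommRing R'] [Algebra F k] [Algebra k R] [Algebra F R]
    [IsScalarTower F k R] [Algebra.EssFiniteType F k] [Algebra.EssFiniteType k R]
    [Algebra k K] [Algebra.IsAlgebraic k K]
    [Algebra k R'] [Algebra R R'] [Algebra K R'] [IsScalarTower k R R']
    [IsScalarTower k K R'] [Algebra.IsPushout k K R R'] [Algebra.EssFiniteType K R']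
    [Algebra.IsIntegral R R']
    (d : ℕ) (hd : Algebra.trdeg F k = d)
    (q : Ideal R') [q.IsPrime] (hq : q.comap (algebraMap R R') = maximalIdeal R) :
    edim (Localization.AtPrime q) ≤ edim R + d := by
  let S := Localization.AtPrime q
  let κ := ResidueField R
  let L := ResidueField S
  have hloc : IsLocalHom (algebraMap R S) := by
    refine ((local_hom_TFAE (algebraMap R S)).out 0 4 rfl rfl).mpr ?_
    rw [IsScalarTower.algebraMap_eq R R' S, ← Ideal.comap_comap,
      show Ideal.comap (algebraMap R' S) (maximalIdeal S) = q from
        IsLocalization.AtPrime.under_maximalIdeal S q, hq]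
  have : Algebra.FormallyEtale R' S := .of_isLocalization q.primeCompl
  have : Algebra.EssFiniteType F R := .comp F k R
  have : Algebra.EssFiniteType F κ := .comp F R κ
  have : Algebra.EssFiniteType K S := .comp K R' S
  have : Algebra.EssFiniteType K L := .comp K S L
  have hmax : q.IsMaximal := by
    apply Ideal.isMaximal_of_isIntegral_of_isMaximal_comap (R := R)
    rw [hq]; infer_instance
  have hint : Algebra.IsIntegral R L := by
    have h1 : Algebra.IsIntegral R' L :=
      Algebra.isIntegral_of_surjective (q.algebraMap_residueField_surjective)
    exact Algebra.IsIntegral.trans (A := R') 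
  have : Algebra.IsIntegral κ L := .tower_top R
  have hS := aux_rank_eq K S
  have hR := aux_rank_le F R
  have hle := aux_surj F k R K R' S
  rw [hS, aux_rank_kaehler K L] at hle
  rw [aux_rank_kaehler F κ] at hR
  have t1 : Algebra.trdeg F k + Algebra.trdeg k κ = Algebra.trdeg F κ := by
    apply _root_.trdeg_add_eq
  have t2 : Algebra.trdeg k κ + Algebra.trdeg κ L = Algebra.trdeg k L := by
    apply _root_.trdeg_add_eq
  have t3 : Algebra.trdeg k K + Algebra.trdeg K L = Algebra.trdeg k L := by
    apply _root_.trdeg_add_eq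
  rw [_root_.trdeg_eq_zero (R := κ) (A := L), add_zero] at t2
  rw [_root_.trdeg_eq_zero (R := k) (A := K), zero_add] at t3
  have hfin : Algebra.trdeg K L < Cardinal.aleph0 := by
    obtain ⟨s, hs, -⟩ := exists_isTranscendenceBasis_and_isSeparable_of_perfectField K L
    rw [← hs.cardinalMk_eq_trdeg]
    exact Cardinal.mk_lt_aleph0
  obtain ⟨t, ht⟩ := Cardinal.lt_aleph0.mp hfin
  have hRe : Module.rank κ (CotangentSpace R) = (edim R : Cardinal) :=
    (Module.finrank_eq_rank κ (CotangentSpace R)).symm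
  have key := hle.trans hR
  rw [← t1, t2, ← t3, ht, hd, hRe] at key
  have key2 : Module.rank L (CotangentSpace S) + (t : Cardinal) ≤ ((edim R + d : ℕ) : Cardinal) + t := by
    rw [Nat.cast_add, add_assoc]; exact key
  have key3 := (Cardinal.add_le_add_iff_of_lt_aleph0 (Cardinal.natCast_lt_aleph0)).mp key2
  exact Module.finrank_le_of_rank_le key3

/-- **Corollary 6.2.** Let `k` be a finitely generated extension of a perfect
field `F` of characteristic `p`, of transcendence degree `d`, let `R` be the local ring of a
regular `k`-variety at a point, and let `q` be a prime of `R ⊗_k k̄` lying over the maximal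
ideal of `R`. Then `edim ((R ⊗_k k̄)_q) ≤ edim R + d`. -/
theorem edim_localization_tensor_algebraicClosure_le
    (p : ℕ) [Fact p.Prime]
    (F : Type) [Field F] [PerfectField F] [CharP F p]
    (k : Type) [Field k] [Algebra F k] (hfg : (⊤ : IntermediateField F k).FG)
    (d : ℕ) (b : Fin d → k) (hb : IsTranscendenceBasis F b)
    (A : Type) [CommRing A] [IsDomain A] [Algebra k A] (hA : Algebra.FiniteType k A)
    (hreg : ∀ (q : Ideal A) (_ : q.IsPrime), IsRegularLocalRing' (Localization.AtPrime q))
    (m : Ideal A) [m.IsPrime]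
    (q : Ideal ((Localization.AtPrime m) ⊗[k] (AlgebraicClosure k))) [q.IsPrime]
    (hq : q.comap (algebraMap (Localization.AtPrime m)
        ((Localization.AtPrime m) ⊗[k] (AlgebraicClosure k))) =
      maximalIdeal (Localization.AtPrime m)) :
    edim (Localization.AtPrime q) ≤ edim (Localization.AtPrime m) + d := by
  have hN : IsNoetherianRing (Localization.AtPrime m) := (hreg m inferInstance).1
  let K := AlgebraicClosure k
  let R := Localization.AtPrime m
  let : Algebra K (R ⊗[k] K) := Algebra.TensorProduct.rightAlgebra
  let : Algebra F R := ((algebraMap k R).comp (algebraMap F k)).toAlgebra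
  have : IsScalarTower F k R := .of_algebraMap_eq' rfl
  have : Algebra.EssFiniteType F k := IntermediateField.fg_top_iff.mp hfg
  have : Algebra.EssFiniteType k R := .comp k A R
  have : Algebra.IsPushout k K R (R ⊗[k] K) := inferInstance
  have : Algebra.EssFiniteType K (R ⊗[k] K) :=
    .of_surjective (Algebra.IsPushout.equiv k K R (R ⊗[k] K)).toAlgHom
      (Algebra.IsPushout.equiv k K R (R ⊗[k] K)).surjective
  have hd : Algebra.trdeg F k = d := by
    rw [← hb.cardinalMk_eq_trdeg]; simp
  exact aux_core F k R K (R ⊗[k] K) d hd q hq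
end

section
/- Let k be a field of characteristic p > 0 and let A be a finite-type k-algebra that is an integral domain such that the localization A_q is a regular local ring for every prime q of A (the coordinate ring of an affine chart of a regular k-variety). Fix a prime m of A, set R := A_m, and let κ denote the residue field of R. If k'/k is a purely inseparable field extension, then the local ring R ⊗_k k' satisfies edim(R ⊗_k k') + trdeg(κ/k) ≤ edim(R) + pdeg(κ/k). -/
open TensorProduct IsLocalRing

lemma aux_dim_integral {R S : Type} [CommRing R] [CommRing S] [Algebra R S]
    [Algebra.IsIntegral R S] (hinj : Function.Injective (algebraMap R S)) (s : ℕ)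
    (h : (s : WithBot ℕ∞) ≤ ringKrullDim R) : (s : WithBot ℕ∞) ≤ ringKrullDim S := by
  obtain ⟨l, hl⟩ := Order.le_krullDim_iff.mp h
  have : (l.head).asIdeal.IsPrime := l.head.2
  obtain ⟨Q, -, hQ, hQ'⟩ := Ideal.exists_ideal_over_prime_of_isIntegral (S := S) l.head.asIdeal ⊥
    (by rw [← RingHom.ker_eq_comap_bot, (RingHom.injective_iff_ker_eq_bot _).mp hinj]; exact bot_le)
  have : Q.LiesOver (RelSeries.head l).asIdeal := ⟨hQ'.symm⟩
  obtain ⟨L, hL, -⟩ := Ideal.exists_ltSeries_of_hasGoingUp l Q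
  exact Order.le_krullDim_iff.mpr ⟨L, hL.trans hl⟩

lemma aux_height_quot {R : Type} [CommRing R] (q : Ideal R) [hq : q.IsPrime] :
    (q.height : WithBot ℕ∞) + ringKrullDim (R ⧸ q) ≤ ringKrullDim R := by
  have h1 : ringKrullDim (R ⧸ q) = Order.coheight (⟨q, hq⟩ : PrimeSpectrum R) := by
    rw [ringKrullDim_quotient, Order.coheight_eq_krullDim_Ici]
    rfl
  have h2 : q.height = Order.height (⟨q, hq⟩ : PrimeSpectrum R) := by
    exact PrimeSpectrum.height_eq_orderHeight ⟨q, hq⟩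
  have : Nonempty (PrimeSpectrum R) := ⟨⟨q, hq⟩⟩
  rw [h1, h2, ringKrullDim, Order.krullDim_eq_iSup_height_add_coheight_of_nonempty,
    ← WithBot.coe_add, WithBot.coe_le_coe]
  exact le_iSup (fun a : PrimeSpectrum R => Order.height a + Order.coheight a) ⟨q, hq⟩

lemma aux_dim {K E : Type} [Field K] [Field E] {n : ℕ} [Algebra K E]
    [Algebra (MvPolynomial (Fin n) K) E] [IsScalarTower K (MvPolynomial (Fin n) K) E]
    (hE : ∀ e : E, ∃ s a : MvPolynomial (Fin n) K, algebraMap _ E s ≠ 0 ∧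
      algebraMap _ E s * e = algebraMap _ E a)
    (q : Ideal (MvPolynomial (Fin n) K)) [q.IsPrime]
    (hq : q = RingHom.ker (algebraMap (MvPolynomial (Fin n) K) E))
    {ι : Type} (x : ι → E) (hx : AlgebraicIndependent K x) :
    ∃ t : ℕ, Cardinal.mk ι = t ∧ q.height + t ≤ n := by
  let B := MvPolynomial (Fin n) K ⧸ q
  let f : B →ₐ[K] E := Ideal.Quotient.liftₐ q (IsScalarTower.toAlgHom K _ E)
    (fun a ha => by rw [hq] at ha; exact ha)
  let _ : Algebra B E := f.toRingHom.toAlgebra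
  have hfm : ∀ a, algebraMap B E (Ideal.Quotient.mk q a) = algebraMap _ E a := fun a => rfl
  have : IsScalarTower K B E := .of_algebraMap_eq fun r => (f.commutes r).symm
  have hinjB : Function.Injective (algebraMap B E) := by
    rw [injective_iff_map_eq_zero]
    intro a
    obtain ⟨a, rfl⟩ := Ideal.Quotient.mk_surjective a
    intro h
    rw [hfm] at h
    rw [Ideal.Quotient.eq_zero_iff_mem, hq]
    exact h
  have : FaithfulSMul B E := (faithfulSMul_iff_algebraMap_injective _ _).mpr hinjB
  have : Algebra.IsAlgebraic B E := by
    constructor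
    intro e
    obtain ⟨s, a, hs, hsa⟩ := hE e
    refine ⟨Polynomial.C (Ideal.Quotient.mk q s) * Polynomial.X - Polynomial.C (Ideal.Quotient.mk q a), ?_, ?_⟩
    · intro h
      have := congrArg (fun p => Polynomial.coeff p 1) h
      simp at this
      apply hs
      rw [← hfm, this, map_zero]
    · simp [hfm, hsa]
  obtain ⟨s, -, g, hg, hgi⟩ := exists_integral_inj_algHom_of_quotient q Ideal.IsPrime.ne_top'
  let _ : Algebra (MvPolynomial (Fin s) K) B := g.toRingHom.toAlgebra
  have : IsScalarTower K (MvPolynomial (Fin s) K) B := .of_algebraMap_eq fun r => (g.commutes r).symm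
  have : Algebra.IsIntegral (MvPolynomial (Fin s) K) B := ⟨hgi⟩
  have : FaithfulSMul (MvPolynomial (Fin s) K) B :=
    (faithfulSMul_iff_algebraMap_injective _ _).mpr hg
  have t1 := (IsTranscendenceBasis.mvPolynomial (Fin s) K).algebraMap_comp (A := B)
  have t2 := t1.algebraMap_comp (A := E)
  have htr := t2.lift_cardinalMk_eq_trdeg
  simp at htr
  have hle := hx.cardinalMk_le_trdeg
  rw [← htr] at hle
  obtain ⟨t, ht⟩ := Cardinal.lt_aleph0.mp (hle.trans_lt (Cardinal.natCast_lt_aleph0))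
  refine ⟨t, ht, ?_⟩
  rw [ht] at hle
  have hts : t ≤ s := by exact_mod_cast hle
  have hs : (s : WithBot ℕ∞) ≤ ringKrullDim B := by
    apply aux_dim_integral (R := MvPolynomial (Fin s) K) hg
    simp [MvPolynomial.ringKrullDim_of_isNoetherianRing]
  have h3 := aux_height_quot q
  rw [MvPolynomial.ringKrullDim_of_isNoetherianRing] at h3
  simp at h3
  have h4 : (q.height : WithBot ℕ∞) + (t : WithBot ℕ∞) ≤ n := by
    refine le_trans ?_ h3
    gcongr
    exact le_trans (by exact_mod_cast hts) hs
  exact_mod_cast h4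

lemma aux_hom_le_edim {B E : Type} [CommRing B] [Field E] [Algebra B E]
    (q : Ideal B) [q.IsPrime] (hq : q = RingHom.ker (algebraMap B E))
    [IsNoetherianRing (Localization.AtPrime q)] :
    Module.Finite E (q →ₗ[B] E) ∧
      Module.finrank E (q →ₗ[B] E) ≤ edim (Localization.AtPrime q) := by
  let L := Localization.AtPrime q
  obtain ⟨s, hs, hspan⟩ := Submodule.FG.exists_span_finset_card_eq_spanFinrank
    (IsNoetherian.noetherian (maximalIdeal L))
  have hmem : ∀ z : s, (z : L) ∈ maximalIdeal L := fun z => by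
    rw [← hspan]; exact Submodule.subset_span z.2
  have hex : ∀ z : s, ∃ g : q, ∃ u : q.primeCompl, (z : L) * algebraMap B L u = algebraMap B L g := by
    intro z
    obtain ⟨⟨a, u⟩, h⟩ := IsLocalization.surj q.primeCompl (z : L)
    refine ⟨⟨a, ?_⟩, u, h⟩
    rw [← IsLocalization.AtPrime.to_map_mem_maximal_iff L q, ← h]
    exact Ideal.mul_mem_right _ _ (hmem z)
  choose g u hgu using hex
  have key : ∀ h : q →ₗ[B] E, (∀ z, h (g z) = 0) → h = 0 := by
    intro h hz
    ext x
    have hx : algebraMap B L x ∈ Ideal.map (algebraMap B L) (Ideal.span (Set.range fun z => (g z : B))) := by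
      have : algebraMap B L x ∈ maximalIdeal L := (IsLocalization.AtPrime.to_map_mem_maximal_iff L q _).mpr x.2
      rw [← hspan] at this
      refine Submodule.span_le.mpr ?_ this
      intro z hzs
      have h1 := hgu ⟨z, hzs⟩
      have h2 : IsUnit (algebraMap B L (u ⟨z, hzs⟩)) := IsLocalization.map_units L (u ⟨z, hzs⟩)
      refine (Ideal.mul_unit_mem_iff_mem _ h2).mp ?_
      rw [h1]
      exact Ideal.mem_map_of_mem _ (Ideal.subset_span ⟨_, rfl⟩)
    rw [IsLocalization.algebraMap_mem_map_algebraMap_iff q.primeCompl] at hx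
    obtain ⟨v, hv, hvx⟩ := hx
    have h3 : ∀ y ∈ Ideal.span (Set.range fun z => (g z : B)), ∀ hy : y ∈ q, h ⟨y, hy⟩ = 0 := by
      have hle : Submodule.span B (Set.range g) ≤ LinearMap.ker h := by
        rw [Submodule.span_le]; rintro _ ⟨z, rfl⟩; exact hz z
      intro y hy hyq
      have : y ∈ (Submodule.span B (Set.range g)).map q.subtype := by
        rw [Submodule.map_span, ← Set.range_comp]; exact hy
      obtain ⟨y', hy', rfl⟩ := this
      exact hle hy'
    have h4 := h3 _ hvx (q.mul_mem_left _ x.2)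
    have h5 : algebraMap B E v * h x = 0 := by
      rw [← Algebra.smul_def, ← map_smul]; exact h4
    rcases mul_eq_zero.mp h5 with h6 | h6
    · exact absurd (by rw [hq]; exact h6) hv
    · exact h6
  let ev : (q →ₗ[B] E) →ₗ[E] (s → E) :=
    { toFun := fun h z => h (g z), map_add' := fun _ _ => rfl, map_smul' := fun _ _ => rfl }
  have hev : Function.Injective ev := by
    rw [injective_iff_map_eq_zero]
    intro h hh
    exact key h fun z => congrFun hh z
  refine ⟨Module.Finite.of_injective ev hev, (LinearMap.finrank_le_finrank_of_injective hev).trans ?_⟩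
  rw [edim, ← spanFinrank_maximalIdeal_eq_finrank_cotangentSpace, ← hs]
  simp

lemma aux_edim_le_hom {B S : Type} [CommRing B] [CommRing S] [IsLocalRing S] [Algebra B S]
    (hS : ∀ x : S, ∃ s a : B, IsUnit (algebraMap B S s) ∧ algebraMap B S s * x = algebraMap B S a)
    (q : Ideal B) (hq : q = RingHom.ker (algebraMap B (ResidueField S)))
    [Module.Finite (ResidueField S) (q →ₗ[B] ResidueField S)] :
    edim S ≤ Module.finrank (ResidueField S) (q →ₗ[B] ResidueField S) := by
  have hmem : ∀ a, algebraMap B S a ∈ maximalIdeal S ↔ a ∈ q := by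
    intro a
    rw [hq, RingHom.mem_ker, IsScalarTower.algebraMap_apply B S (ResidueField S),
      ResidueField.algebraMap_eq, residue_eq_zero_iff]
  let r : q →ₗ[B] maximalIdeal S :=
    { toFun := fun a => ⟨algebraMap B S a, (hmem _).mpr a.2⟩
      map_add' := fun a b => by ext; simp
      map_smul' := fun a b => by ext; simp [Algebra.smul_def] }
  let Φ : Module.Dual (ResidueField S) (CotangentSpace S) →ₗ[ResidueField S] (q →ₗ[B] ResidueField S) :=
    { toFun := fun f =>
        ((f.restrictScalars S).comp (maximalIdeal S).toCotangent).restrictScalars B ∘ₗ r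
      map_add' := fun _ _ => rfl
      map_smul' := fun _ _ => rfl }
  have hΦ : Function.Injective Φ := by
    rw [injective_iff_map_eq_zero]
    intro f hf
    ext y
    obtain ⟨x, rfl⟩ := (maximalIdeal S).toCotangent_surjective y
    obtain ⟨s, a, hs, hsa⟩ := hS x
    have ha : a ∈ q := by rw [← hmem, ← hsa]; exact Ideal.mul_mem_left _ _ x.2
    have h1 : f ((maximalIdeal S).toCotangent (r ⟨a, ha⟩)) = 0 := LinearMap.congr_fun hf ⟨a, ha⟩
    have h2 : r ⟨a, ha⟩ = algebraMap B S s • x := by ext; exact hsa.symm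
    rw [h2, map_smul] at h1
    have h3 : (algebraMap B S s) • f ((maximalIdeal S).toCotangent x) = 0 := by
      rw [← h1]; exact ((f.restrictScalars S).map_smul _ _).symm
    simpa using (hs.smul_eq_zero).mp h3
  have := LinearMap.finrank_le_finrank_of_injective hΦ
  rwa [Subspace.dual_finrank_eq] at this


lemma aux_descend {K P C E : Type} [CommRing K] [CommRing P] [CommRing C] [CommRing E]
    [Algebra K P] [Algebra K C] [Algebra P C] [IsScalarTower K P C]
    [Module K E] [Algebra P E] [Algebra C E] [IsScalarTower P C E]
    (hsurj : Function.Surjective (algebraMap P C)) (D : Derivation K P E)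
    (hD : ∀ x, algebraMap P C x = 0 → D x = 0) :
    ∃ D' : Derivation K C E, ∀ x, D' (algebraMap P C x) = D x := by
  have h0 : ∀ x y, algebraMap P C x = algebraMap P C y → D x = D y := by
    intro x y h
    rw [← sub_eq_zero, ← map_sub]
    exact hD _ (by rw [map_sub, h, sub_self])
  let σ := Function.surjInv hsurj
  have hσ : ∀ c, algebraMap P C (σ c) = c := Function.surjInv_eq hsurj
  let l : C →ₗ[K] E :=
    { toFun := fun c => D (σ c)
      map_add' := fun a b => by
        rw [← map_add]; exact h0 _ _ (by simp [hσ])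
      map_smul' := fun a b => by
        rw [RingHom.id_apply, ← D.map_smul]
        exact h0 _ _ (by rw [hσ, Algebra.smul_def, Algebra.smul_def, map_mul, hσ, ← IsScalarTower.algebraMap_apply]) }
  have hl : ∀ x, l (algebraMap P C x) = D x := fun x => h0 _ _ (hσ _)
  refine ⟨Derivation.mk' l ?_, hl⟩
  intro a b
  obtain ⟨a, rfl⟩ := hsurj a
  obtain ⟨b, rfl⟩ := hsurj b
  rw [← map_mul, hl, hl, hl, D.leibniz, algebraMap_smul, algebraMap_smul]

/-- restriction of a derivation to the kernel -/
noncomputable def auxRes {K B E : Type} [CommRing K] [CommRing B] [Field E]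
    [Algebra K B] [Algebra K E] [Algebra B E] [IsScalarTower K B E]
    (q : Ideal B) (hq : q = RingHom.ker (algebraMap B E)) :
    Derivation K B E →ₗ[E] (q →ₗ[B] E) where
  toFun D :=
    { toFun := fun x => D x
      map_add' := fun x y => by simp
      map_smul' := fun b x => by
        have hx : algebraMap B E x = 0 := RingHom.mem_ker.mp (hq.le x.2)
        have : (x : B) • D b = 0 := by rw [Algebra.smul_def, hx, zero_mul]
        simp [D.leibniz, this] }
  map_add' _ _ := rfl
  map_smul' _ _ := rfl

lemma aux_compare {K P C E : Type} [Field K] [CommRing P] [CommRing C] [Field E]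
    [Algebra K P] [Algebra K C] [Algebra P C] [IsScalarTower K P C] [Algebra K E]
    [Algebra P E] [Algebra C E] [IsScalarTower P C E] [IsScalarTower K C E] [IsScalarTower K P E]
    (hsurj : Function.Surjective (algebraMap P C))
    (q : Ideal P) (hq : q = RingHom.ker (algebraMap P E))
    (q' : Ideal C) (hq' : q' = RingHom.ker (algebraMap C E))
    [Module.Finite E (Derivation K P E)] [Module.Finite E (q →ₗ[P] E)] :
    Module.Finite E (q' →ₗ[C] E) ∧ Module.Finite E (Derivation K C E) ∧
    Module.finrank E (q' →ₗ[C] E) + Module.finrank E (Derivation K P E) ≤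
      Module.finrank E (q →ₗ[P] E) + Module.finrank E (Derivation K C E) := by
  have hmem : ∀ a, algebraMap P C a ∈ q' ↔ a ∈ q := by
    intro a
    rw [hq, hq', RingHom.mem_ker, RingHom.mem_ker, ← IsScalarTower.algebraMap_apply]
  let r : q →ₗ[P] q' :=
    { toFun := fun a => ⟨algebraMap P C a, (hmem _).mpr a.2⟩
      map_add' := fun a b => by ext; simp
      map_smul' := fun a b => by ext; simp [Algebra.smul_def] }
  let Θ : (q' →ₗ[C] E) →ₗ[E] (q →ₗ[P] E) :=
    { toFun := fun h => (h.restrictScalars P).comp r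
      map_add' := fun _ _ => rfl
      map_smul' := fun _ _ => rfl }
  have hΘ : Function.Injective Θ := by
    rw [injective_iff_map_eq_zero]
    intro h hh
    ext ⟨x, hx⟩
    obtain ⟨x, rfl⟩ := hsurj x
    exact LinearMap.congr_fun hh ⟨x, (hmem _).mp hx⟩
  let Ψ : Derivation K C E →ₗ[E] Derivation K P E :=
    { toFun := fun D => D.compAlgebraMap P
      map_add' := fun _ _ => rfl
      map_smul' := fun _ _ => rfl }
  have hΨ : Function.Injective Ψ := by
    rw [injective_iff_map_eq_zero]
    intro D hD
    ext x
    obtain ⟨x, rfl⟩ := hsurj x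
    exact Derivation.congr_fun hD x
  have f1 : Module.Finite E (q' →ₗ[C] E) := Module.Finite.of_injective Θ hΘ
  have f2 : Module.Finite E (Derivation K C E) := Module.Finite.of_injective Ψ hΨ
  refine ⟨f1, f2, ?_⟩
  let ρ := auxRes (K := K) q hq
  let T : ((q' →ₗ[C] E) × Derivation K P E) →ₗ[E] (q →ₗ[P] E) := Θ.coprod (-ρ)
  have hT := T.finrank_range_add_finrank_ker
  rw [Module.finrank_prod] at hT
  have h1 := Submodule.finrank_le (LinearMap.range T)
  let π : LinearMap.ker T →ₗ[E] Derivation K P E :=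
    (LinearMap.snd E _ _).comp (LinearMap.ker T).subtype
  have hker : ∀ z : LinearMap.ker T, Θ z.1.1 = ρ z.1.2 := by
    intro z
    have := z.2
    rw [LinearMap.mem_ker, LinearMap.coprod_apply, LinearMap.neg_apply, ← sub_eq_add_neg,
      sub_eq_zero] at this
    exact this
  have hπ : Function.Injective π := by
    rw [injective_iff_map_eq_zero]
    intro z hz
    have hz2 : z.1.2 = 0 := hz
    have := hker z
    rw [hz2, map_zero] at this
    have hz1 : z.1.1 = 0 := hΘ (by rw [this, map_zero])
    exact Subtype.ext (Prod.ext hz1 hz2)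
  have hrange : LinearMap.range π ≤ LinearMap.range Ψ := by
    rintro _ ⟨z, rfl⟩
    obtain ⟨D', hD'⟩ := aux_descend (K := K) hsurj z.1.2 (by
      intro x hx
      have hxq : x ∈ q := by rw [← hmem, hx]; exact zero_mem _
      have h5 : z.1.2 x = z.1.1 (r ⟨x, hxq⟩) := (LinearMap.congr_fun (hker z) ⟨x, hxq⟩).symm
      have h6 : r ⟨x, hxq⟩ = 0 := Subtype.ext hx
      rw [h5, h6, map_zero])
    exact ⟨D', by ext x; exact hD' x⟩
  have h2 := Submodule.finrank_mono hrange
  rw [LinearMap.finrank_range_of_inj hπ, LinearMap.finrank_range_of_inj hΨ] at h2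
  omega

lemma aux_der_mv {K E : Type} [Field K] [Field E] (n : ℕ) [Algebra K E]
    [Algebra (MvPolynomial (Fin n) K) E] [IsScalarTower K (MvPolynomial (Fin n) K) E] :
    Module.Finite E (Derivation K (MvPolynomial (Fin n) K) E) ∧
    Module.finrank E (Derivation K (MvPolynomial (Fin n) K) E) = n := by
  let ev : Derivation K (MvPolynomial (Fin n) K) E →ₗ[E] (Fin n → E) :=
    { toFun := fun D i => D (MvPolynomial.X i)
      map_add' := fun _ _ => rfl
      map_smul' := fun _ _ => rfl }
  have hev : Function.Bijective ev := by
    constructor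
    · intro D D' h
      exact MvPolynomial.derivation_ext fun i => congrFun h i
    · intro f
      exact ⟨MvPolynomial.mkDerivation K f, funext fun i => MvPolynomial.mkDerivation_X K f i⟩
  refine ⟨Module.Finite.of_injective ev hev.1, ?_⟩
  rw [(LinearEquiv.ofBijective ev hev).finrank_eq]
  simp

lemma aux_der_le {k A E : Type} [Field k] [CommRing A] [Field E] [Algebra k A]
    [Algebra k E] [Algebra A E] [IsScalarTower k A E]
    (m : Ideal A) [m.IsPrime] (hm : m = RingHom.ker (algebraMap A E))
    [Algebra m.ResidueField E] [IsScalarTower A m.ResidueField E]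
    [Module.Finite m.ResidueField (Ω[m.ResidueField⁄k])]
    [Module.Finite E (m →ₗ[A] E)] :
    Module.Finite E (Derivation k A E) ∧
    Module.finrank E (Derivation k A E) ≤ Module.finrank E (m →ₗ[A] E) +
      Module.finrank m.ResidueField (Ω[m.ResidueField⁄k]) := by
  let κ := m.ResidueField
  have : IsScalarTower k κ E := IsScalarTower.of_algebraMap_eq fun r => by
    rw [IsScalarTower.algebraMap_apply k A E, IsScalarTower.algebraMap_apply A κ E,
      ← IsScalarTower.algebraMap_apply k A κ]
  let Ψ : (Ω[κ⁄k] →ₗ[κ] E) →ₗ[E] Derivation k A E :=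
    { toFun := fun f => (f.compDer (KaehlerDifferential.D k κ)).compAlgebraMap A
      map_add' := fun _ _ => rfl
      map_smul' := fun _ _ => rfl }
  let ρ := auxRes (K := k) m hm
  let C := A ⧸ m
  let _ : Algebra C E := ((algebraMap κ E).comp (algebraMap C κ)).toAlgebra
  have : IsScalarTower C κ E := .of_algebraMap_eq fun _ => rfl
  have : IsScalarTower A C E := .of_algebraMap_eq fun a => by
    rw [IsScalarTower.algebraMap_apply C κ E, ← IsScalarTower.algebraMap_apply A C κ,
      ← IsScalarTower.algebraMap_apply A κ E]
  have : IsScalarTower k C E := .of_algebraMap_eq fun a => by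
    rw [IsScalarTower.algebraMap_apply k A C, ← IsScalarTower.algebraMap_apply A C E,
      ← IsScalarTower.algebraMap_apply k A E]
  have hker : LinearMap.ker ρ ≤ LinearMap.range Ψ := by
    intro D hD
    obtain ⟨D', hD'⟩ := aux_descend (K := k) (C := C) Ideal.Quotient.mk_surjective D (by
      intro x hx
      have hx : x ∈ m := Ideal.Quotient.eq_zero_iff_mem.mp hx
      exact LinearMap.congr_fun hD ⟨x, hx⟩)
    have : Algebra.FormallyEtale C κ := Algebra.FormallyEtale.of_isLocalization (nonZeroDivisors C)
    have hb := KaehlerDifferential.isBaseChange_of_formallyEtale k C κ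
    refine ⟨hb.lift D'.liftKaehlerDifferential, ?_⟩
    ext a
    change hb.lift D'.liftKaehlerDifferential (KaehlerDifferential.D k κ (algebraMap A κ a)) = D a
    rw [IsScalarTower.algebraMap_apply A C κ, ← KaehlerDifferential.map_D k k C κ, hb.lift_eq,
      Derivation.liftKaehlerDifferential_comp_D]
    exact hD' a
  have : Module.Finite E (LinearMap.range Ψ) := inferInstance
  have fk : Module.Finite E (LinearMap.ker ρ) := Submodule.finiteDimensional_of_le hker
  have fin : Module.Finite E (Derivation k A E) := by
    have : Module.Finite E (Derivation k A E ⧸ LinearMap.ker ρ) :=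
      Module.Finite.equiv ρ.quotKerEquivRange.symm
    exact Module.Finite.of_submodule_quotient (LinearMap.ker ρ)
  refine ⟨fin, ?_⟩
  have h1 := ρ.finrank_range_add_finrank_ker
  have h2 := Submodule.finrank_le (LinearMap.range ρ)
  have h3 := Submodule.finrank_mono hker
  have h4 := LinearMap.finrank_range_le Ψ
  rw [Module.finrank_linearMap, Module.finrank_self, mul_one] at h4
  have h5 : Module.finrank E (LinearMap.range Ψ) ≤
    Module.finrank m.ResidueField (Ω[m.ResidueField⁄k]) := h4
  clear h4
  omega

lemma aux_der_base {k K A C E : Type} [Field k] [Field K] [CommRing A] [CommRing C] [Field E]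
    [Algebra k K] [Algebra k A] [Algebra K C] [Algebra A C] [Algebra k C] [IsScalarTower k A C]
    [IsScalarTower k K C]
    [Algebra k E] [Algebra K E] [Algebra A E] [Algebra C E]
    [IsScalarTower k K E] [IsScalarTower A C E] [IsScalarTower k A E] [IsScalarTower K C E]
    (hgen : ∀ c : C, c ∈ Submodule.span K (Set.range (algebraMap A C)))
    [Module.Finite E (Derivation k A E)] :
    Module.finrank E (Derivation K C E) ≤ Module.finrank E (Derivation k A E) := by
  let Ψ : Derivation K C E →ₗ[E] Derivation k A E :=
    { toFun := fun D => (D.restrictScalars k).compAlgebraMap A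
      map_add' := fun _ _ => rfl
      map_smul' := fun _ _ => rfl }
  refine LinearMap.finrank_le_finrank_of_injective (f := Ψ) ?_
  rw [injective_iff_map_eq_zero]
  intro D hD
  ext c
  refine Submodule.span_induction (p := fun c _ => D c = 0) ?_ (by simp) ?_ ?_ (hgen c)
  · rintro _ ⟨a, rfl⟩
    exact Derivation.congr_fun hD a
  · intro x y _ _ hx hy
    rw [map_add, hx, hy, add_zero]
  · intro r x _ hx
    rw [D.map_smul, hx, smul_zero]

lemma aux_arith {hq lq t n hq' dC eS hm eR dA om : ℕ} (h1 : hq ≤ lq) (h3 : lq + t ≤ n)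
    (h5 : hq' + n ≤ hq + dC) (h6 : eS ≤ hq') (h7 : hm ≤ eR) (h8 : dA ≤ hm + om) (h9 : dC ≤ dA) :
    eS + t ≤ eR + om := by omega

lemma aux_main {k K A C S : Type} [Field k] [Field K] [CommRing A] [CommRing C] [CommRing S]
    [IsLocalRing S] {n : ℕ}
    [Algebra k K] [Algebra.IsAlgebraic k K] [Algebra k A] [Algebra K C] [Algebra A C] [Algebra k C]
    [IsScalarTower k A C] [IsScalarTower k K C]
    [Algebra k S] [Algebra K S] [Algebra A S] [Algebra C S]
    [IsScalarTower k K S] [IsScalarTower A C S] [IsScalarTower k A S] [IsScalarTower K C S]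
    [Algebra (MvPolynomial (Fin n) K) C] [Algebra (MvPolynomial (Fin n) K) S]
    [IsScalarTower (MvPolynomial (Fin n) K) C S] [IsScalarTower K (MvPolynomial (Fin n) K) S]
    [IsScalarTower K (MvPolynomial (Fin n) K) C]
    (hsurj : Function.Surjective (algebraMap (MvPolynomial (Fin n) K) C))
    (hgen : ∀ c : C, c ∈ Submodule.span K (Set.range (algebraMap A C)))
    (hS : ∀ x : S, ∃ s a : C, IsUnit (algebraMap C S s) ∧ algebraMap C S s * x = algebraMap C S a)
    (m : Ideal A) [m.IsPrime] [IsNoetherianRing (Localization.AtPrime m)]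
    [Algebra m.ResidueField (ResidueField S)] [IsScalarTower A m.ResidueField (ResidueField S)]
    [Module.Finite m.ResidueField (Ω[m.ResidueField⁄k])]
    {ι : Type} (b : ι → m.ResidueField) (hb : AlgebraicIndependent k b) :
    ∃ t : ℕ, Cardinal.mk ι = t ∧ edim S + t ≤ edim (Localization.AtPrime m) +
      Module.finrank m.ResidueField (Ω[m.ResidueField⁄k]) := by
  let P := MvPolynomial (Fin n) K
  let E := ResidueField S
  have htow : IsScalarTower k m.ResidueField E := IsScalarTower.of_algebraMap_eq fun r => by
    rw [IsScalarTower.algebraMap_apply k A E, IsScalarTower.algebraMap_apply A m.ResidueField E,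
      ← IsScalarTower.algebraMap_apply k A m.ResidueField]
  have hm : m = RingHom.ker (algebraMap A E) := by
    rw [IsScalarTower.algebraMap_eq A m.ResidueField E, RingHom.ker_comp_of_injective _
      (algebraMap m.ResidueField E).injective, Ideal.ker_algebraMap_residueField]
  have hbE : AlgebraicIndependent k (fun i => algebraMap m.ResidueField E (b i)) :=
    hb.map' (f := IsScalarTower.toAlgHom k m.ResidueField E) (algebraMap m.ResidueField E).injective
  have hbK := hbE.extendScalars K
  have hES : ∀ x : S, algebraMap S E x = residue S x := fun _ => rfl
  have hE : ∀ e : E, ∃ s a : P, algebraMap P E s ≠ 0 ∧ algebraMap P E s * e = algebraMap P E a := by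
    intro e
    obtain ⟨x, rfl⟩ := residue_surjective e
    obtain ⟨s, a, hs, h⟩ := hS x
    obtain ⟨s, rfl⟩ := hsurj s
    obtain ⟨a, rfl⟩ := hsurj a
    refine ⟨s, a, ?_, ?_⟩
    · rw [IsScalarTower.algebraMap_apply P S E, IsScalarTower.algebraMap_apply P C S]
      exact (hs.map (algebraMap S E)).ne_zero
    · rw [← hES, IsScalarTower.algebraMap_apply P S E, IsScalarTower.algebraMap_apply P S E a,
        IsScalarTower.algebraMap_apply P C S, IsScalarTower.algebraMap_apply P C S, ← map_mul, h]
  let q : Ideal P := RingHom.ker (algebraMap P E)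
  let q' : Ideal C := RingHom.ker (algebraMap C E)
  have : q.IsPrime := RingHom.ker_isPrime _
  obtain ⟨t, ht, hdim⟩ := aux_dim hE q rfl _ hbK
  refine ⟨t, ht, ?_⟩
  have : IsRegularRing P := inferInstanceAs (IsRegularRing (MvPolynomial (Fin n) K))
  obtain ⟨f1, h1⟩ := aux_hom_le_edim (E := E) q rfl
  have hreg : IsRegularLocalRing (Localization.AtPrime q) := inferInstance
  have h2 : (edim (Localization.AtPrime q) : WithBot ℕ∞) = q.height := by
    rw [← IsLocalization.AtPrime.ringKrullDim_eq_height q (Localization.AtPrime q)]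
    exact (IsRegularLocalRing.iff_finrank_cotangentSpace _).mp hreg
  have h3 : edim (Localization.AtPrime q) + t ≤ n := by
    have h2' : (edim (Localization.AtPrime q) : ℕ∞) = q.height := by exact_mod_cast h2
    rw [← h2'] at hdim
    exact_mod_cast hdim
  obtain ⟨f2, h4⟩ := aux_der_mv (K := K) (E := E) n
  obtain ⟨f3, f4, h5⟩ := aux_compare (K := K) (E := E) hsurj q rfl q' rfl
  have h6 := aux_edim_le_hom hS q' rfl
  obtain ⟨f5, h7⟩ := aux_hom_le_edim (E := E) m hm
  obtain ⟨f6, h8⟩ := aux_der_le (k := k) (E := E) m hm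
  have h9 := aux_der_base (k := k) (E := E) hgen
  rw [h4] at h5
  exact aux_arith h1 h3 h5 h6 h7 h8 h9

/-- **Theorem 6.1.** Let `R` be the local ring at a point of a regular variety
over a field `k` of characteristic `p > 0`, with residue field `κ`, and let `k'/k` be purely
inseparable. Then `edim (R ⊗_k k') + trdeg(κ/k) ≤ edim R + pdeg(κ/k)`. -/
theorem edim_tensor_le_edim_add_pdeg_sub_trdeg
    (p : ℕ) [Fact p.Prime]
    (k : Type) [Field k] [CharP k p]
    (A : Type) [CommRing A] [IsDomain A] [Algebra k A] (hA : Algebra.FiniteType k A)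
    (hreg : ∀ (q : Ideal A) (_ : q.IsPrime), IsRegularLocalRing' (Localization.AtPrime q))
    (m : Ideal A) [m.IsPrime]
    (k' : Type) [Field k'] [Algebra k k'] [IsPurelyInseparable k k']
    [IsLocalRing ((Localization.AtPrime m) ⊗[k] k')]
    (ι : Type) (b : ι → ResidueField (Localization.AtPrime m))
    (hb : IsTranscendenceBasis k b) :
    (edim ((Localization.AtPrime m) ⊗[k] k') : Cardinal) + Cardinal.mk ι ≤
      (edim (Localization.AtPrime m) : Cardinal) +
        Module.rank (ResidueField (Localization.AtPrime m))
          (Ω[(ResidueField (Localization.AtPrime m))⁄k]) := by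
  let R := Localization.AtPrime m
  let S := R ⊗[k] k'
  let C := A ⊗[k] k'
  have : IsNoetherianRing R := (hreg m inferInstance).1
  let _ : Algebra k' C := Algebra.TensorProduct.rightAlgebra
  let _ : Algebra k' S := Algebra.TensorProduct.rightAlgebra
  let f : C →ₐ[k] S :=
    Algebra.TensorProduct.map (IsScalarTower.toAlgHom k A R) (AlgHom.id k k')
  have hf : ∀ a x, f (a ⊗ₜ x) = algebraMap A R a ⊗ₜ x := fun _ _ => rfl
  have hfin : Algebra.FiniteType k' C := by
    have : Algebra.FiniteType k' (k' ⊗[k] A) := Algebra.FiniteType.baseChange k'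
    let g : (k' ⊗[k] A) →ₐ[k'] C :=
      { (Algebra.TensorProduct.comm k k' A).toAlgHom with
        commutes' := fun _ => rfl }
    exact Algebra.FiniteType.of_surjective g (Algebra.TensorProduct.comm k k' A).surjective
  obtain ⟨n, g, hg⟩ := Algebra.FiniteType.iff_quotient_mvPolynomial''.mp hfin
  let _ : Algebra C S := f.toRingHom.toAlgebra
  let _ : Algebra (MvPolynomial (Fin n) k') C := g.toRingHom.toAlgebra
  let _ : Algebra (MvPolynomial (Fin n) k') S := (f.toRingHom.comp g.toRingHom).toAlgebra
  have t1 : IsScalarTower k A C := inferInstance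
  have t2 : IsScalarTower k k' C := inferInstance
  have t3 : IsScalarTower k k' S := inferInstance
  have t4 : IsScalarTower k A S := inferInstance
  have t5 : IsScalarTower A C S := .of_algebraMap_eq fun a => rfl
  have t6 : IsScalarTower k' C S := .of_algebraMap_eq fun a => by
    change (1 : R) ⊗ₜ[k] a = f (1 ⊗ₜ a)
    rw [hf, map_one]
  have t7 : IsScalarTower (MvPolynomial (Fin n) k') C S := .of_algebraMap_eq fun a => rfl
  have t8 : IsScalarTower k' (MvPolynomial (Fin n) k') C :=
    .of_algebraMap_eq fun a => (g.commutes a).symm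
  have t9 : IsScalarTower k' (MvPolynomial (Fin n) k') S := .of_algebraMap_eq fun a => by
    rw [IsScalarTower.algebraMap_apply k' C S,
      IsScalarTower.algebraMap_apply k' (MvPolynomial (Fin n) k') C,
      ← IsScalarTower.algebraMap_apply (MvPolynomial (Fin n) k') C S]
  have hgen : ∀ c : C, c ∈ Submodule.span k' (Set.range (algebraMap A C)) := by
    intro c
    induction c using TensorProduct.induction_on with
    | zero => exact zero_mem _
    | add x y hx hy => exact add_mem hx hy
    | tmul a x =>
      have : a ⊗ₜ[k] x = x • algebraMap A C a := by
        rw [Algebra.smul_def]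
        change a ⊗ₜ[k] x = (1 ⊗ₜ x) * (a ⊗ₜ 1)
        rw [Algebra.TensorProduct.tmul_mul_tmul, one_mul, mul_one]
      rw [this]
      exact Submodule.smul_mem _ _ (Submodule.subset_span ⟨a, rfl⟩)
  have hS : ∀ x : S, ∃ s a : C, IsUnit (algebraMap C S s) ∧
      algebraMap C S s * x = algebraMap C S a := by
    have key : ∀ x : S, ∃ s : m.primeCompl, ∃ a : C,
        algebraMap C S (algebraMap A C s) * x = algebraMap C S a := by
      intro x
      induction x using TensorProduct.induction_on with
      | zero => exact ⟨1, 0, by simp⟩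
      | add x y hx hy =>
        obtain ⟨s, a, h⟩ := hx
        obtain ⟨s', a', h'⟩ := hy
        refine ⟨s * s', algebraMap A C s' * a + algebraMap A C s * a', ?_⟩
        rw [map_add, map_mul, map_mul, ← h, ← h', Submonoid.coe_mul, map_mul, map_mul]
        ring
      | tmul r x =>
        obtain ⟨⟨a, s⟩, h⟩ := IsLocalization.surj m.primeCompl r
        refine ⟨s, a ⊗ₜ x, ?_⟩
        change (algebraMap A R s ⊗ₜ[k] (1 : k')) * (r ⊗ₜ x) = algebraMap A R a ⊗ₜ x
        rw [Algebra.TensorProduct.tmul_mul_tmul, one_mul, mul_comm, ← h]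
    intro x
    obtain ⟨s, a, h⟩ := key x
    refine ⟨_, a, ?_, h⟩
    rw [← IsScalarTower.algebraMap_apply A C S, IsScalarTower.algebraMap_apply A R S]
    exact (IsLocalization.map_units R s).map _
  have hloc : IsLocalHom (algebraMap R S) := by
    constructor
    intro r hr
    by_contra hn
    let h : S →ₐ[k] (ResidueField R ⊗[k] k') :=
      Algebra.TensorProduct.map (IsScalarTower.toAlgHom k R (ResidueField R)) (AlgHom.id k k')
    have h0 : h (algebraMap R S r) = 0 := by
      change (residue R r) ⊗ₜ[k] (1 : k') = 0
      rw [(residue_eq_zero_iff r).mpr hn, zero_tmul]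
    have := hr.map h
    rw [h0] at this
    exact not_isUnit_zero this
  have hess : Algebra.EssFiniteType k m.ResidueField := by
    have h1 : Algebra.EssFiniteType k A := inferInstance
    have h2 : Algebra.EssFiniteType A R := Algebra.EssFiniteType.of_isLocalization _ m.primeCompl
    have h3 : Algebra.EssFiniteType k R := Algebra.EssFiniteType.comp k A R
    have h4 : Algebra.EssFiniteType R (ResidueField R) := inferInstance
    exact Algebra.EssFiniteType.comp k R (ResidueField R)
  have hfinΩ : Module.Finite m.ResidueField (Ω[m.ResidueField⁄k]) := inferInstance
  obtain ⟨t, ht, hle⟩ := aux_main (k := k) (K := k') (C := C) (S := S) (n := n) hg hgen hS m b hb.1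
  rw [ht, ← Module.finrank_eq_rank]
  exact_mod_cast hle
end

section
/- Let k be a field, let R be a local Noetherian k-algebra with maximal ideal m and residue field κ := R/m, and let k'/k be a purely inseparable field extension, so that R' := R ⊗_k k' and κ ⊗_k k' are local Noetherian rings. Then edim(R ⊗_k k') ≤ edim(R) + edim(κ ⊗_k k'); that is, the embedding jump ejump_{k'/k}(R) := edim(R ⊗_k k') − edim(R) is bounded above by edim(κ ⊗_k k'). -/
open TensorProduct IsLocalRing

theorem edim_eq_spanFinrank_aux (A : Type) [CommRing A] [IsLocalRing A] [IsNoetherianRing A] :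
    edim A = (maximalIdeal A).spanFinrank :=
  (spanFinrank_maximalIdeal_eq_finrank_cotangentSpace A).symm

theorem spanFinrank_le_aux (A B : Type) [CommRing A] [CommRing B] [IsLocalRing A] [IsLocalRing B]
    [IsNoetherianRing A] [IsNoetherianRing B] (f : A →+* B) (hf : Function.Surjective f) :
    (maximalIdeal A).spanFinrank ≤
      (RingHom.ker f).spanFinrank + (maximalIdeal B).spanFinrank := by
  classical
  obtain ⟨s, hs, hs'⟩ := Submodule.FG.exists_span_finset_card_eq_spanFinrank
    (IsNoetherian.noetherian (RingHom.ker f))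
  obtain ⟨t, ht, ht'⟩ := Submodule.FG.exists_span_finset_card_eq_spanFinrank
    (IsNoetherian.noetherian (maximalIdeal B))
  have hcomap : (maximalIdeal B).comap f = maximalIdeal A :=
    eq_maximalIdeal (Ideal.comap_isMaximal_of_surjective f hf)
  let g := Function.surjInv hf
  have key : maximalIdeal A = Submodule.span A (↑(s ∪ t.image g) : Set A) := by
    have h1 : (Ideal.span (g '' (t : Set B))).map f = maximalIdeal B := by
      rw [Ideal.map_span, ← Set.image_comp]
      have : (f ∘ g) = id := by
        funext x; exact Function.surjInv_eq hf x
      rw [this, Set.image_id]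
      exact ht'
    rw [← hcomap, ← h1, Ideal.comap_map_of_surjective' f hf, ← hs']
    rw [Finset.coe_union, Finset.coe_image, Submodule.span_union, sup_comm]
  rw [key]
  refine (Submodule.spanFinrank_span_le_ncard_of_finite (Finset.finite_toSet _)).trans ?_
  rw [Set.ncard_coe_finset]
  refine (Finset.card_union_le _ _).trans ?_
  rw [← hs, ← ht]
  gcongr
  exact Finset.card_image_le

/-- **Lemma 5.1.** For a local Noetherian `k`-algebra `R` with residue field `κ`
and a purely inseparable field extension `k'/k`, the embedding dimension of `R ⊗_k k'`
is at most `edim R + edim (κ ⊗_k k')`. -/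
theorem edim_tensor_le_of_isPurelyInseparable
    (k k' : Type) [Field k] [Field k'] [Algebra k k'] [IsPurelyInseparable k k']
    (R : Type) [CommRing R] [IsLocalRing R] [IsNoetherianRing R] [Algebra k R]
    [IsLocalRing (R ⊗[k] k')] [IsNoetherianRing (R ⊗[k] k')]
    [IsLocalRing ((ResidueField R) ⊗[k] k')] [IsNoetherianRing ((ResidueField R) ⊗[k] k')] :
    edim (R ⊗[k] k') ≤ edim R + edim ((ResidueField R) ⊗[k] k') := by

  let q : R →ₐ[k] ResidueField R := IsScalarTower.toAlgHom k R (ResidueField R)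
  have hq : Function.Surjective q := residue_surjective
  let f : R ⊗[k] k' →ₐ[k] ResidueField R ⊗[k] k' :=
    Algebra.TensorProduct.map q (AlgHom.id k k')
  have hf : Function.Surjective f :=
    TensorProduct.map_surjective hq Function.surjective_id
  have hker : RingHom.ker f.toRingHom = (maximalIdeal R).map
      (Algebra.TensorProduct.includeLeft : R →ₐ[k] R ⊗[k] k').toRingHom := by
    have h := Algebra.TensorProduct.rTensor_ker (R := k) (C := k') q hq
    have hk : RingHom.ker q = maximalIdeal R := ker_residue
    rw [hk] at h
    exact h
  rw [edim_eq_spanFinrank_aux, edim_eq_spanFinrank_aux, edim_eq_spanFinrank_aux]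
  refine (spanFinrank_le_aux _ _ f.toRingHom hf).trans ?_
  rw [hker]
  gcongr
  exact Ideal.spanFinrank_map_le_of_fg _ (IsNoetherian.noetherian _)
end

section
/- Let k be an imperfect field of characteristic p > 0 with algebraic closure Ω, let t ∈ k \ k^p, and for each n ≥ 0 let k_n := k(t^{1/p^n}) ⊆ Ω be the subfield generated over k by the unique p^n-th root of t in Ω. If R is a Noetherian local k-algebra, then for every n ≥ 1, edim(R ⊗_k k_n) = edim(R ⊗_k k_1); equivalently, the embedding jumps satisfy ejump_{k_n/k}(R) = ejump_{k_1/k}(R). -/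
open TensorProduct IsLocalRing IntermediateField

section Aux
open Polynomial

theorem aux_irr (p : ℕ) [Fact p.Prime] (K E : Type*) [Field K] [Field E] [Algebra K E] [CharP K p]
    (a : K) (ha : ∀ c : K, c ^ p ≠ a) (n : ℕ) (x : E) (hx : x ^ p ^ n = algebraMap K E a) :
    minpoly K x = X ^ p ^ n - C a := by
  have : ExpChar K p := ExpChar.prime Fact.out
  have h1 := (minpoly.natSepDegree_eq_one_iff_pow_mem (F := K) (x := x) p).2 ⟨n, a, hx.symm⟩
  obtain ⟨m, y, hm⟩ := (minpoly.natSepDegree_eq_one_iff_eq_X_pow_sub_C (F := K) (x := x) p).1 h1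
  have hp : p.Prime := Fact.out
  have hint : IsIntegral K x := by
    refine IsIntegral.of_pow (pow_pos hp.pos n) (hx ▸ isIntegral_algebraMap)
  have hy : x ^ p ^ m = algebraMap K E y := by
    have := minpoly.aeval K x
    rw [hm] at this
    simpa [sub_eq_zero] using this
  have hdvd : minpoly K x ∣ X ^ p ^ n - C a := minpoly.dvd _ _ (by simp [hx])
  have hmon : (X ^ p ^ n - C a : K[X]).Monic := monic_X_pow_sub_C _ (pow_pos hp.pos n).ne'
  have hle := natDegree_le_of_dvd hdvd hmon.ne_zero
  rw [hm, natDegree_X_pow_sub_C, natDegree_X_pow_sub_C] at hle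
  have hmn : m ≤ n := (Nat.pow_le_pow_iff_right hp.one_lt).1 hle
  rcases hmn.eq_or_lt with rfl | hlt
  · have : algebraMap K E y = algebraMap K E a := by rw [← hy, hx]
    rw [hm, (algebraMap K E).injective this]
  · exfalso
    obtain ⟨d, rfl⟩ := Nat.exists_eq_add_of_lt hlt
    apply ha (y ^ p ^ d)
    apply (algebraMap K E).injective
    rw [← hx, map_pow, map_pow, ← hy]
    ring

theorem aux_irr' (p : ℕ) [Fact p.Prime] (K : Type*) [Field K] [CharP K p]
    (a : K) (n : ℕ) (ha : n = 0 ∨ ∀ c : K, c ^ p ≠ a) :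
    Irreducible (X ^ p ^ n - C a : K[X]) := by
  have hp : p.Prime := Fact.out
  rcases ha with rfl | ha
  · simpa using irreducible_X_sub_C a
  obtain ⟨x, hx⟩ := IsAlgClosed.exists_pow_nat_eq (algebraMap K (AlgebraicClosure K) a)
    (pow_pos hp.pos n)
  rw [← aux_irr p K _ a ha n x hx]
  exact minpoly.irreducible (Algebra.IsIntegral.isIntegral x)

theorem aux_S {A D : Type} [CommRing A] [CommRing D] (ψ : A →+* D) (hψ : Function.Surjective ψ)
    (P : Ideal A) (Q : Ideal D) (hQ : P.map ψ = Q) (hk : RingHom.ker ψ ≤ P ^ 2) :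
    Module.finrank (A ⧸ P) P.Cotangent = Module.finrank (D ⧸ Q) Q.Cotangent := by
  subst hQ
  algebraize [ψ]
  have hkP : RingHom.ker ψ ≤ P := hk.trans (Ideal.pow_le_self two_ne_zero)
  have hcomap : ∀ I : Ideal A, RingHom.ker ψ ≤ I → (I.map ψ).comap ψ = I := fun I hI => by
    rw [Ideal.comap_map_of_surjective' ψ hψ, sup_eq_left.2 hI]
  have hP := hcomap P hkP
  have eq : (P.map ψ).comap (algebraMap A D) = RingHom.ker (algebraMap A D) ⊔ P := by
    change (P.map ψ).comap ψ = RingHom.ker ψ ⊔ P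
    rw [hP, sup_eq_right.2 hkP]
  let f := Ideal.mapCotangent P (P.map ψ) (Algebra.ofId A D) (le_of_le_of_eq le_sup_right eq.symm)
  have hsurj : Function.Surjective f := Ideal.mapCotangent_surjective_of_comap_eq hψ eq
  have hinj : Function.Injective f := by
    rw [injective_iff_map_eq_zero]
    intro z hz
    obtain ⟨z, rfl⟩ := P.toCotangent_surjective z
    rw [Ideal.mapCotangent_toCotangent, Ideal.toCotangent_eq_zero] at hz
    rw [Ideal.toCotangent_eq_zero, ← hcomap (P ^ 2) hk, Ideal.map_pow]
    exact hz
  let e : (A ⧸ P) ≃+* (D ⧸ P.map ψ) := RingEquiv.ofBijective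
    (Ideal.quotientMap (P.map ψ) ψ Ideal.le_comap_map)
    ⟨Ideal.quotientMap_injective' hP.le, Ideal.quotientMap_surjective hψ⟩
  have := rank_eq_of_equiv_equiv e (AddEquiv.ofBijective f ⟨hinj, hsurj⟩) e.bijective (by
    intro r z
    obtain ⟨r, rfl⟩ := Ideal.Quotient.mk_surjective r
    change f (r • z) = (ψ r) • f z
    rw [map_smul]
    exact (algebraMap_smul D r (f z)).symm)
  unfold Module.finrank
  rw [this]

theorem aux_F {A B : Type} [CommRing A] [CommRing B] (f : A →+* B) (hf : f.Flat)
    (P : Ideal A) (M : Ideal B) [P.IsMaximal] (hM : P.map f = M) (hMt : M ≠ ⊤) :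
    Module.finrank (B ⧸ M) M.Cotangent = Module.finrank (A ⧸ P) P.Cotangent := by
  subst hM
  algebraize [f]
  set M := P.map f
  let : Algebra (A ⧸ P) (B ⧸ M) := (Ideal.quotientMap M f Ideal.le_comap_map).toAlgebra
  have : IsScalarTower A (A ⧸ P) (B ⧸ M) := IsScalarTower.of_algebraMap_eq (fun x => rfl)
  let : Field (A ⧸ P) := Ideal.Quotient.field P
  have : Nontrivial (B ⧸ M) := Ideal.Quotient.nontrivial_iff.2 hMt
  -- flatness
  let g : B ⊗[A] P →ₗ[B] B := LinearMap.liftBaseChange B (Algebra.linearMap A B ∘ₗ P.subtype)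
  have hg : Function.Injective g := by
    have h1 := Module.Flat.lTensor_preserves_injective_linearMap (M := B) P.subtype
      P.injective_subtype
    have h2 : (g : B ⊗[A] P → B) = (TensorProduct.rid A B) ∘ (P.subtype.lTensor B) := by
      funext z
      induction z with
      | zero => simp
      | add a b ha hb => simp_all
      | tmul b x => simp [g, Algebra.smul_def, mul_comm]
    rw [h2]
    exact (TensorProduct.rid A B).injective.comp h1
  have hr : LinearMap.range g = M := by
    rw [LinearMap.range_liftBaseChange]
    change Ideal.span _ = Ideal.span _
    congr 1
    ext z
    simp [RingHom.algebraMap_toAlgebra]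
  let e1 : B ⊗[A] P ≃ₗ[B] M := (LinearEquiv.ofInjective g hg).trans (LinearEquiv.ofEq _ _ hr)
  let e2 : (B ⧸ M) ⊗[B] M ≃ₗ[B] M.Cotangent := TensorProduct.quotTensorEquivQuotSMul M M
  let e2' : (B ⧸ M) ⊗[B] M ≃ₗ[B ⧸ M] M.Cotangent :=
    e2.extendScalarsOfSurjective Ideal.Quotient.mk_surjective
  let e3 : (A ⧸ P) ⊗[A] P ≃ₗ[A] P.Cotangent := TensorProduct.quotTensorEquivQuotSMul P P
  let e3' : (A ⧸ P) ⊗[A] P ≃ₗ[A ⧸ P] P.Cotangent :=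
    e3.extendScalarsOfSurjective Ideal.Quotient.mk_surjective
  rw [← e2'.finrank_eq, ← e3'.finrank_eq]
  rw [← (TensorProduct.AlgebraTensorModule.congr (LinearEquiv.refl (B ⧸ M) (B ⧸ M)) e1).finrank_eq,
    (TensorProduct.AlgebraTensorModule.cancelBaseChange A B (B ⧸ M) (B ⧸ M) P).finrank_eq,
    ← (TensorProduct.AlgebraTensorModule.cancelBaseChange A (A ⧸ P) (B ⧸ M) (B ⧸ M) P).finrank_eq]
  exact Module.finrank_baseChange
theorem aux_max (p : ℕ) [Fact p.Prime] {R B : Type} [CommRing R] [IsLocalRing R]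
    [CommRing B] [IsLocalRing B] [Algebra R B] [Algebra.IsIntegral R B]
    [CharP (ResidueField R) p] [CharP B p]
    (x : B) (hx : Function.Surjective (aeval x : R[X] →ₐ[R] B)) (t s : R) (j d : ℕ)
    (hxt : x ^ p ^ (d + j) = algebraMap R B t) (hs : t - s ^ p ^ j ∈ maximalIdeal R)
    (hd : d = 0 ∨ ∀ c : R, s - c ^ p ∉ maximalIdeal R) :
    (maximalIdeal R).map (algebraMap R B) ⊔ Ideal.span {x ^ p ^ d - algebraMap R B s}
      = maximalIdeal B := by
  have hp : p.Prime := Fact.out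
  set J := (maximalIdeal R).map (algebraMap R B) ⊔ Ideal.span {x ^ p ^ d - algebraMap R B s}
    with hJ
  have hm : (maximalIdeal R).map (algebraMap R B) ≤ maximalIdeal B := by
    rw [Ideal.map_le_iff_le_comap]
    have := Ideal.isMaximal_comap_of_isIntegral_of_isMaximal (R := R) (maximalIdeal B)
    rw [IsLocalRing.eq_maximalIdeal this]
  have hJM : J ≤ maximalIdeal B := by
    refine sup_le hm ?_
    rw [Ideal.span_singleton_le_iff_mem]
    apply (inferInstance : (maximalIdeal B).IsPrime).mem_of_pow_mem (p ^ j)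
    have h1 : (x ^ p ^ d - algebraMap R B s) ^ p ^ j = algebraMap R B (t - s ^ p ^ j) := by
      rw [sub_pow_char_pow, ← pow_mul, ← pow_add, hxt, map_sub, map_pow]
    rw [h1]
    exact hm (Ideal.mem_map_of_mem _ hs)
  have hJt : J ≠ ⊤ := fun h => (inferInstance : (maximalIdeal B).IsPrime).ne_top
    (top_le_iff.1 (h ▸ hJM))
  have : Nontrivial (B ⧸ J) := Ideal.Quotient.nontrivial_iff.2 hJt
  let g0 : ResidueField R →+* B ⧸ J := Ideal.Quotient.lift (maximalIdeal R)
    ((Ideal.Quotient.mk J).comp (algebraMap R B)) (fun a ha => by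
      rw [RingHom.comp_apply, Ideal.Quotient.eq_zero_iff_mem]
      exact le_sup_left (a := (maximalIdeal R).map (algebraMap R B)) (Ideal.mem_map_of_mem _ ha))
  have hg0 : ∀ r : R, g0 (residue R r) = Ideal.Quotient.mk J (algebraMap R B r) := fun r => rfl
  let h : (ResidueField R)[X] := X ^ p ^ d - C (residue R s)
  have hirr : Irreducible h := by
    apply aux_irr'
    refine hd.imp id fun hd c hc => ?_
    obtain ⟨c, rfl⟩ := residue_surjective c
    apply hd c
    rw [← residue_eq_zero_iff, map_sub, map_pow, hc, sub_self]
  have : Fact (Irreducible h) := ⟨hirr⟩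
  let g : AdjoinRoot h →+* B ⧸ J := AdjoinRoot.lift g0 (Ideal.Quotient.mk J x) (by
    simp only [h, eval₂_sub, eval₂_pow, eval₂_X, eval₂_C, hg0]
    rw [← map_pow, ← map_sub, Ideal.Quotient.eq_zero_iff_mem]
    exact Ideal.mem_sup_right (Ideal.mem_span_singleton_self _))
  have hgs : Function.Surjective g := by
    intro z
    obtain ⟨z, rfl⟩ := Ideal.Quotient.mk_surjective z
    obtain ⟨z, rfl⟩ := hx z
    refine ⟨AdjoinRoot.mk h (z.map (residue R)), ?_⟩
    simp only [g, AdjoinRoot.lift_mk]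
    rw [eval₂_map, aeval_def, hom_eval₂]
    rfl
  have hJmax : J.IsMaximal := by
    apply Ideal.Quotient.maximal_of_isField
    exact MulEquiv.isField (Field.toIsField (AdjoinRoot h))
      (RingEquiv.ofBijective g ⟨g.injective, hgs⟩).symm.toMulEquiv
  exact IsLocalRing.eq_maximalIdeal hJmax

theorem aux_D {R A : Type} [CommRing R] [CommRing A] (φ : R[X] →+* A)
    (hφ : Function.Surjective φ) (q : ℕ) (hq : 2 ≤ q) (a : R)
    (hk : RingHom.ker φ = Ideal.span {X ^ q - C a}) (P : Ideal R[X]) (hP : X ∈ P) :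
    Module.finrank (A ⧸ P.map φ) (P.map φ).Cotangent =
    Module.finrank ((R[X] ⧸ (P ^ 2 ⊔ Ideal.span {C a})) ⧸
        P.map (Ideal.Quotient.mk (P ^ 2 ⊔ Ideal.span {C a})))
      (P.map (Ideal.Quotient.mk (P ^ 2 ⊔ Ideal.span {C a}))).Cotangent := by
  set I := P ^ 2 ⊔ Ideal.span {C a} with hI
  have hX : (X : R[X]) ^ q ∈ P ^ 2 := Ideal.pow_le_pow_right hq (Ideal.pow_mem_pow hP q)
  have hker : RingHom.ker φ ≤ RingHom.ker (Ideal.Quotient.mk I) := by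
    rw [hk, Ideal.mk_ker, Ideal.span_singleton_le_iff_mem]
    exact sub_mem (Ideal.mem_sup_left hX) (Ideal.mem_sup_right (Ideal.mem_span_singleton_self _))
  let ψ : A →+* R[X] ⧸ I := φ.liftOfSurjective hφ ⟨Ideal.Quotient.mk I, hker⟩
  have hψ : ψ.comp φ = Ideal.Quotient.mk I := RingHom.liftOfRightInverse_comp φ _ _ _
  apply aux_S ψ
  · intro z
    obtain ⟨z, rfl⟩ := Ideal.Quotient.mk_surjective z
    exact ⟨φ z, by rw [← hψ]; rfl⟩
  · rw [Ideal.map_map, hψ]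
  · intro z hz
    obtain ⟨z, rfl⟩ := hφ z
    have hz' : z ∈ I := by
      rw [← Ideal.Quotient.eq_zero_iff_mem, ← hψ]; exact hz
    have ha : φ (C a) ∈ (P.map φ) ^ 2 := by
      have : φ (X ^ q - C a) = 0 := by
        rw [← RingHom.mem_ker, hk]; exact Ideal.mem_span_singleton_self _
      rw [map_sub, sub_eq_zero] at this
      rw [← this, ← Ideal.map_pow]
      exact Ideal.mem_map_of_mem _ hX
    have : I ≤ ((P.map φ) ^ 2).comap φ := by
      refine sup_le ?_ ?_
      · rw [← Ideal.map_pow]; exact Ideal.le_comap_map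
      · rw [Ideal.span_singleton_le_iff_mem]; exact ha
    exact this hz'

theorem aux_ker {k K : Type} [Field k] [Field K] [Algebra k K] (R : Type) [CommRing R] [Algebra k R]
    (y : K) (hint : IsIntegral k y) :
    Function.Surjective (aeval (1 ⊗ₜ AdjoinSimple.gen k y) :
        R[X] →ₐ[R] R ⊗[k] (adjoin k {y} : IntermediateField k K)) ∧
    RingHom.ker (aeval (1 ⊗ₜ AdjoinSimple.gen k y) :
        R[X] →ₐ[R] R ⊗[k] (adjoin k {y} : IntermediateField k K)) =
      Ideal.span {(minpoly k y).map (algebraMap k R)} := by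
  let g : k[X] →ₐ[k] (adjoin k {y} : IntermediateField k K) := aeval (AdjoinSimple.gen k y)
  have hg : Function.Surjective g := by
    intro z
    obtain ⟨f, hf⟩ := (adjoin.powerBasis hint).exists_eq_aeval' z
    exact ⟨f, by rw [hf]; rfl⟩
  have hgk : RingHom.ker g = Ideal.span {minpoly k y} := by
    ext f
    rw [RingHom.mem_ker, Ideal.mem_span_singleton, ← minpoly_gen, minpoly.dvd_iff]
  let e := polyEquivTensor k R
  let l := Algebra.TensorProduct.lTensor (S := R) R g
  have hl : Function.Surjective l := LinearMap.lTensor_surjective R (g := g.toLinearMap) hg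
  have hlk := Algebra.TensorProduct.lTensor_ker (A := R) g hg
  have hcomp' : ∀ z, aeval (R := R) (1 ⊗ₜ[k] AdjoinSimple.gen k y) (e.symm z) = l z := by
    intro z
    induction z with
    | zero => simp
    | add a b ha hb => rw [map_add, map_add, map_add, ha, hb]
    | tmul a f =>
      have h1 : aeval (R := k) ((1 : R) ⊗ₜ[k] AdjoinSimple.gen k y) f = 1 ⊗ₜ g f :=
        aeval_algHom_apply (Algebra.TensorProduct.includeRight :
          (adjoin k {y} : IntermediateField k K) →ₐ[k] R ⊗[k] _) (AdjoinSimple.gen k y) f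
      rw [polyEquivTensor_symm_apply_tmul_eq_smul, map_smul, aeval_map_algebraMap, h1]
      simp [l, TensorProduct.smul_tmul']
  have hcomp : ∀ f : R[X], aeval (R := R) (1 ⊗ₜ[k] AdjoinSimple.gen k y) f = l (e f) := by
    intro f
    rw [← hcomp', e.symm_apply_apply]
  refine ⟨fun z => ?_, ?_⟩
  · obtain ⟨z, rfl⟩ := hl z
    exact ⟨e.symm z, hcomp' z⟩
  · have h2 : RingHom.ker l = Ideal.span {(1 : R) ⊗ₜ[k] minpoly k y} := by
      refine (Eq.trans ?_ hlk).trans ?_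
      · rfl
      · rw [hgk, Ideal.map_span, Set.image_singleton]; rfl
    ext f
    have h3 : e ((minpoly k y).map (algebraMap k R)) = 1 ⊗ₜ[k] minpoly k y := by
      rw [← e.symm_apply_eq.trans eq_comm, polyEquivTensor_symm_apply_tmul_eq_smul, one_smul]
    rw [RingHom.mem_ker, hcomp, ← RingHom.mem_ker, h2, Ideal.mem_span_singleton,
      Ideal.mem_span_singleton, ← h3, map_dvd_iff]

/-- dimension of the cotangent space of the ideal generated by `m` and `y - s` -/
noncomputable def cdimAux {R : Type} (A : Type) [CommRing R] [CommRing A] [Algebra R A]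
    (m : Ideal R) (y : A) (s : R) : ℕ :=
  Module.finrank (A ⧸ (m.map (algebraMap R A) ⊔ Ideal.span {y - algebraMap R A s}))
    (m.map (algebraMap R A) ⊔ Ideal.span {y - algebraMap R A s}).Cotangent

/-- the shifted version -/
theorem aux_shift (p : ℕ) [Fact p.Prime] {R A : Type} [CommRing R] [CharP R p] [CommRing A]
    [Algebra R A] (y : A) (hs : Function.Surjective (aeval y : R[X] →ₐ[R] A)) (t s : R) (j : ℕ)
    (hj : 1 ≤ j) (hk : RingHom.ker (aeval y : R[X] →ₐ[R] A) = Ideal.span {X ^ p ^ j - C t})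
    (m : Ideal R) (a : R) (ha : a = t - s ^ p ^ j) (P : Ideal R[X])
    (hP : P = m.map C ⊔ Ideal.span {X}) :
    cdimAux A m y s =
    Module.finrank ((R[X] ⧸ (P ^ 2 ⊔ Ideal.span {C a})) ⧸
        P.map (Ideal.Quotient.mk (P ^ 2 ⊔ Ideal.span {C a})))
      (P.map (Ideal.Quotient.mk (P ^ 2 ⊔ Ideal.span {C a}))).Cotangent := by
  unfold cdimAux
  set Q := m.map (algebraMap R A) ⊔ Ideal.span {y - algebraMap R A s} with hQ
  have hp : p.Prime := Fact.out
  let σ := algEquivAevalXAddC (-s)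
  let φ : R[X] →+* A := ((aeval y : R[X] →ₐ[R] A) : R[X] →+* A).comp (σ : R[X] →+* R[X])
  have hφ : Function.Surjective φ := hs.comp σ.surjective
  have hφX : φ X = y - algebraMap R A s := by
    simp [φ, σ, sub_eq_add_neg]
  have hφC : φ.comp C = algebraMap R A := by
    ext r
    simp [φ, σ]
  have hσ : σ (X ^ p ^ j - C a) = X ^ p ^ j - C t := by
    have : σ X = X - C s := by simp [σ, sub_eq_add_neg]
    have h2 : ∀ r, σ (C r) = C r := fun r => by simp [σ]
    rw [map_sub, map_pow, this, h2, sub_pow_char_pow, ha, map_sub, map_pow]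
    ring
  have hφk : RingHom.ker φ = Ideal.span {X ^ p ^ j - C a} := by
    ext f
    have : f ∈ RingHom.ker φ ↔ σ f ∈ RingHom.ker (aeval y : R[X] →ₐ[R] A) := Iff.rfl
    rw [this, hk, Ideal.mem_span_singleton, Ideal.mem_span_singleton, ← hσ, map_dvd_iff]
  have hq : 2 ≤ p ^ j := hp.two_le.trans (Nat.le_self_pow (by omega) p)
  have hPQ : P.map φ = Q := by
    rw [hP, Ideal.map_sup, Ideal.map_map, hφC, Ideal.map_span, Set.image_singleton, hφX, hQ]
  rw [← hPQ]
  exact aux_D φ hφ (p ^ j) hq a hφk P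
    (hP ▸ Ideal.mem_sup_right (Ideal.mem_span_singleton_self _))

theorem aux_core_s4 (p : ℕ) [Fact p.Prime] {R A B : Type} [CommRing R] [IsLocalRing R]
    [CommRing A] [Algebra R A] [CommRing B] [IsLocalRing B] [Algebra R B] [Algebra.IsIntegral R B]
    [CharP (ResidueField R) p] [CharP B p] (f : A →ₐ[R] B) (hf : f.toRingHom.Flat)
    (x : B) (hB : Function.Surjective (aeval x : R[X] →ₐ[R] B))
    (y : A) (hA : Function.Surjective (aeval y : R[X] →ₐ[R] A)) (t s : R) (j d : ℕ)
    (hfy : f y = x ^ p ^ d)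
    (hxB : x ^ p ^ (d + j) = algebraMap R B t) (hs : t - s ^ p ^ j ∈ maximalIdeal R)
    (hd : d = 0 ∨ ∀ c : R, s - c ^ p ∉ maximalIdeal R) :
    edim B = cdimAux A (maximalIdeal R) y s := by
  unfold cdimAux
  set Q := (maximalIdeal R).map (algebraMap R A) ⊔ Ideal.span {y - algebraMap R A s} with hQ
  have hmax := aux_max p (B := B) _ hB t s j d hxB hs hd
  have hmap : Q.map f.toRingHom = maximalIdeal B := by
    rw [← hmax, hQ, Ideal.map_sup, Ideal.map_map, Ideal.map_span, Set.image_singleton]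
    congr 2
    · exact f.comp_algebraMap
    · congr 1
      change f _ = _
      rw [map_sub, hfy, f.commutes]
  have hQt : Q ≠ ⊤ := by
    rintro h
    rw [h, Ideal.map_top] at hmap
    exact (inferInstance : (maximalIdeal B).IsPrime).ne_top hmap.symm
  have hQmax : Q.IsMaximal := by
    have : Nontrivial (A ⧸ Q) := Ideal.Quotient.nontrivial_iff.2 hQt
    apply Ideal.Quotient.maximal_of_isField
    let g0 : ResidueField R →+* A ⧸ Q := Ideal.Quotient.lift (maximalIdeal R)
      ((Ideal.Quotient.mk Q).comp (algebraMap R A)) (fun a ha => by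
        rw [RingHom.comp_apply, Ideal.Quotient.eq_zero_iff_mem, hQ]
        exact Ideal.mem_sup_left (Ideal.mem_map_of_mem _ ha))
    have hg0 : Function.Surjective g0 := by
      intro z
      obtain ⟨z, rfl⟩ := Ideal.Quotient.mk_surjective z
      obtain ⟨z, rfl⟩ := hA z
      refine ⟨residue R (z.eval s), ?_⟩
      change Ideal.Quotient.mk Q (algebraMap R A (z.eval s)) = _
      have h1 : Ideal.Quotient.mk Q y =
          Ideal.Quotient.mk Q (algebraMap R A s) := by
        rw [Ideal.Quotient.eq, hQ]
        exact Ideal.mem_sup_right (Ideal.mem_span_singleton_self _)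
      rw [aeval_def, hom_eval₂, h1, ← hom_eval₂, eval₂_at_apply]
    exact MulEquiv.isField (Field.toIsField (ResidueField R))
      (RingEquiv.ofBijective g0 ⟨g0.injective, hg0⟩).symm.toMulEquiv
  exact aux_F f.toRingHom hf Q (maximalIdeal B) hmap
    (inferInstance : (maximalIdeal B).IsPrime).ne_top

theorem aux_main_s4 (p : ℕ) [Fact p.Prime]
    (k Ω : Type) [Field k] [Field Ω] [CharP k p] [Algebra k Ω]
    (t : k) (R : Type) [CommRing R] [IsLocalRing R] [Algebra k R]
    (x y : Ω) (d j : ℕ) (hy : y = x ^ p ^ d) (hyt : y ^ p ^ j = algebraMap k Ω t)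
    [IsLocalRing (R ⊗[k] (adjoin k {x} : IntermediateField k Ω))] (s : R)
    (hs : algebraMap k R t - s ^ p ^ j ∈ maximalIdeal R)
    (hd : d = 0 ∨ ∀ c : R, s - c ^ p ∉ maximalIdeal R) :
    edim (R ⊗[k] (adjoin k {x} : IntermediateField k Ω)) =
      cdimAux (R ⊗[k] (adjoin k {y} : IntermediateField k Ω)) (maximalIdeal R)
        (1 ⊗ₜ AdjoinSimple.gen k y) s := by
  have hp : p.Prime := Fact.out
  have hxt : x ^ p ^ (d + j) = algebraMap k Ω t := by
    rw [← hyt, hy, ← pow_mul, ← pow_add]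
  have hxint : IsIntegral k x :=
    IsIntegral.of_pow (pow_pos hp.pos (d + j)) (hxt ▸ isIntegral_algebraMap)
  have hyint : IsIntegral k y :=
    IsIntegral.of_pow (pow_pos hp.pos j) (hyt ▸ isIntegral_algebraMap)
  have hle : (adjoin k {y} : IntermediateField k Ω) ≤ adjoin k {x} := by
    rw [adjoin_simple_le_iff, hy]
    exact pow_mem (mem_adjoin_simple_self k x) _
  have hA := aux_ker R y hyint
  have hB := aux_ker R x hxint
  have : CharP (ResidueField R) p :=
    charP_of_injective_ringHom (algebraMap k (ResidueField R)).injective p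
  have : CharP (R ⊗[k] (adjoin k {x} : IntermediateField k Ω)) p := charP_of_injective_ringHom (algebraMap k (R ⊗[k] (adjoin k {x} : IntermediateField k Ω))).injective p
  have : Algebra.IsIntegral k (adjoin k {x} : IntermediateField k Ω) := by
    have := adjoin.finiteDimensional hxint
    infer_instance
  have : Algebra.IsIntegral R (R ⊗[k] (adjoin k {x} : IntermediateField k Ω)) := inferInstance
  let ι := inclusion hle
  let f : (R ⊗[k] (adjoin k {y} : IntermediateField k Ω)) →ₐ[R] (R ⊗[k] (adjoin k {x} : IntermediateField k Ω)) := Algebra.TensorProduct.lTensor R ι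
  have hι : ι.toRingHom.Flat := by
    algebraize [ι.toRingHom]
    change Module.Flat _ _
    infer_instance
  have hf := RingHom.Flat.lTensor (S := R) R hι
  have hfy : f ((1 : R) ⊗ₜ AdjoinSimple.gen k y) = ((1 : R) ⊗ₜ AdjoinSimple.gen k x) ^ p ^ d := by
    have h1 : ι (AdjoinSimple.gen k y) = AdjoinSimple.gen k x ^ p ^ d := by
      apply Subtype.ext
      simp [ι, hy]
    rw [Algebra.TensorProduct.tmul_pow, one_pow, ← h1]
    rfl
  have hxB : ((1 : R) ⊗ₜ AdjoinSimple.gen k x : (R ⊗[k] (adjoin k {x} : IntermediateField k Ω))) ^ p ^ (d + j)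
      = (algebraMap k R t) ⊗ₜ[k] 1 := by
    rw [Algebra.TensorProduct.tmul_pow, one_pow]
    have : (AdjoinSimple.gen k x) ^ p ^ (d + j) = algebraMap k (adjoin k {x}) t := by
      apply Subtype.ext
      simp [hxt]
    rw [this]
    rw [Algebra.algebraMap_eq_smul_one, Algebra.algebraMap_eq_smul_one, TensorProduct.smul_tmul]
  have q1 := aux_core_s4 (A := R ⊗[k] (adjoin k {y} : IntermediateField k Ω))
    (B := R ⊗[k] (adjoin k {x} : IntermediateField k Ω)) (R := R) p
  have q2 := q1 f
  have q3 := q2 hf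
  have q4 := q3 _ hB.1
  have q5 := q4 _ hA.1
  have q6 := q5 (algebraMap k R t) s j d hfy
  have q7 := q6 hxB
  exact q7 hs hd

theorem aux_ex (p : ℕ) [Fact p.Prime] (R : Type) [CommRing R] [CharP R p] (m : Ideal R) (t : R)
    (n : ℕ) : ∀ (d j : ℕ) (s : R), d + j = n → t - s ^ p ^ j ∈ m → (j = 0 → s = t) →
    ∃ (d j : ℕ) (s : R), d + j = n ∧ t - s ^ p ^ j ∈ m ∧ (j = 0 → s = t) ∧
      (d = 0 ∨ ∀ c : R, s - c ^ p ∉ m) := by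
  intro d
  induction d with
  | zero => exact fun j s h1 h2 h3 => ⟨0, j, s, h1, h2, h3, Or.inl rfl⟩
  | succ d ih =>
    intro j s h1 h2 h3
    by_cases hc : ∃ c : R, s - c ^ p ∈ m
    · obtain ⟨c, hc⟩ := hc
      refine ih (j + 1) c (by omega) ?_ (by simp)
      have h4 : (s - c ^ p) ^ p ^ j ∈ m :=
        Ideal.pow_mem_of_mem _ hc _ (pow_pos (Fact.out : p.Prime).pos _)
      rw [sub_pow_char_pow, ← pow_mul, ← pow_succ'] at h4
      have := add_mem h2 h4
      simpa using this
    · push Not at hc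
      exact ⟨d + 1, j, s, h1, h2, h3, Or.inr hc⟩

theorem aux_second (p : ℕ) [Fact p.Prime]
    (k Ω : Type) [Field k] [Field Ω] [CharP k p] [Algebra k Ω]
    (t : k) (ht : ∀ c : k, c ^ p ≠ t) (R : Type) [CommRing R] [IsLocalRing R] [Algebra k R]
    (x : Ω) (d j : ℕ) (hj : 1 ≤ j) (hxt : x ^ p ^ (d + j) = algebraMap k Ω t)
    [IsLocalRing (R ⊗[k] (adjoin k {x} : IntermediateField k Ω))] (s : R)
    (hs : algebraMap k R t - s ^ p ^ j ∈ maximalIdeal R)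
    (hd : d = 0 ∨ ∀ c : R, s - c ^ p ∉ maximalIdeal R)
    (a : R) (ha : a = algebraMap k R t - s ^ p ^ j) (P : Ideal R[X])
    (hP : P = (maximalIdeal R).map C ⊔ Ideal.span {X}) :
    edim (R ⊗[k] (adjoin k {x} : IntermediateField k Ω)) =
    Module.finrank ((R[X] ⧸ (P ^ 2 ⊔ Ideal.span {C a})) ⧸
        P.map (Ideal.Quotient.mk (P ^ 2 ⊔ Ideal.span {C a})))
      (P.map (Ideal.Quotient.mk (P ^ 2 ⊔ Ideal.span {C a}))).Cotangent := by
  have hp : p.Prime := Fact.out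
  have hyt : (x ^ p ^ d) ^ p ^ j = algebraMap k Ω t := by rw [← hxt, ← pow_mul, ← pow_add]
  have : CharP R p := charP_of_injective_ringHom (algebraMap k R).injective p
  obtain ⟨y, hy⟩ : ∃ y, y = x ^ p ^ d := ⟨_, rfl⟩
  rw [← hy] at hyt
  have hint : IsIntegral k y := by
    refine IsIntegral.of_pow (pow_pos hp.pos j) ?_
    rw [hyt]
    exact isIntegral_algebraMap
  have hker := aux_ker R y hint
  have h2 : (minpoly k y).map (algebraMap k R) = X ^ p ^ j - C (algebraMap k R t) := by
    rw [aux_irr p k Ω t ht j _ hyt]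
    simp
  have h3 := hker.2
  rw [h2] at h3
  rw [aux_main_s4 p k Ω t R x y d j hy hyt s hs hd]
  have q1 := aux_shift (A := R ⊗[k] (adjoin k {y} : IntermediateField k Ω)) (R := R) p
  have q2 := q1 _ hker.1
  have q3 := q2 (algebraMap k R t) s j hj h3
  exact q3 (maximalIdeal R) a ha P hP

end Aux

/-- **Proposition 8.3.** Let `k` be an imperfect field of characteristic `p` with
algebraic closure `Ω`, `t ∈ k \ kᵖ`, and `kₙ := k(t^{1/pⁿ}) ⊆ Ω`.  For any Noetherian local
`k`-algebra `R` and any `n ≥ 1`, `edim (R ⊗_k kₙ) = edim (R ⊗_k k₁)`. -/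
theorem edim_tensor_adjoin_pow_root_eq
    (p : ℕ) [Fact p.Prime]
    (k Ω : Type) [Field k] [Field Ω] [CharP k p] [Algebra k Ω] [IsAlgClosure k Ω]
    (t : k) (ht : ∀ c : k, c ^ p ≠ t)
    (R : Type) [CommRing R] [IsLocalRing R] [IsNoetherianRing R] [Algebra k R]
    (n : ℕ) (hn : 1 ≤ n)
    (x₁ xₙ : Ω) (hx₁ : x₁ ^ p = algebraMap k Ω t) (hxₙ : xₙ ^ p ^ n = algebraMap k Ω t)
    [IsLocalRing (R ⊗[k] (adjoin k {x₁} : IntermediateField k Ω))]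
    [IsLocalRing (R ⊗[k] (adjoin k {xₙ} : IntermediateField k Ω))] :
    edim (R ⊗[k] (adjoin k {xₙ} : IntermediateField k Ω)) =
      edim (R ⊗[k] (adjoin k {x₁} : IntermediateField k Ω)) := by
  have hp : p.Prime := Fact.out
  have : CharP R p := charP_of_injective_ringHom (algebraMap k R).injective p
  obtain ⟨d, j, s, hdj, hs, hst, hd⟩ := aux_ex p R (maximalIdeal R) (algebraMap k R t) n n 0
    (algebraMap k R t) rfl (by simp) (fun _ => rfl)
  rcases Nat.eq_zero_or_pos j with rfl | hj
  · obtain rfl := hst rfl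
    obtain rfl : d = n := hdj
    have hd' := hd.resolve_left (by omega)
    rw [aux_main_s4 p k Ω t R xₙ (algebraMap k Ω t) d 0 hxₙ.symm (by simp) _ hs hd,
      aux_main_s4 p k Ω t R x₁ (algebraMap k Ω t) 1 0 (by simp [hx₁]) (by simp) _ hs (Or.inr hd')]
  · subst hdj
    have hpow : (s ^ p ^ (j - 1)) ^ p ^ 1 = s ^ p ^ j := by
      rw [← pow_mul, ← pow_add, Nat.sub_add_cancel hj]
    rw [aux_second p k Ω t ht R xₙ d j hj hxₙ s hs hd _ rfl _ rfl,
      aux_second p k Ω t ht R x₁ 0 1 le_rfl (by simpa using hx₁) (s ^ p ^ (j - 1))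
        (by rw [hpow]; exact hs) (Or.inl rfl) (algebraMap k R t - s ^ p ^ j) (by rw [hpow]) _ rfl]
end

section
/- Let k be a field of characteristic p > 0 with algebraic closure Ω, and set k^{1/p} := {x ∈ Ω : x^p ∈ k} and k^{1/p^∞} := {x ∈ Ω : x^{p^n} ∈ k for some n ≥ 0} (the perfect closure of k in Ω). Let A be a finite-type k-algebra that is an integral domain, let x be a prime of A, and set R := A_x (the local ring of a k-variety at a point). Then edim(R ⊗_k k^{1/p}) = edim(R ⊗_k k^{1/p^∞}). -/
open TensorProduct IsLocalRing

/-- one step of the extension of a coefficient subfield -/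
lemma coeff_step (p : ℕ) [hp : Fact p.Prime] {C κ : Type*} [CommRing C] [Field κ] [CharP κ p]
    (π : C →+* κ) (E : Subring C)
    (hF : IsField E) (β : C) (hβ : β ^ p ∈ E) (hb : ∀ e ∈ E, π e ≠ π β) :
    ∀ e ∈ (Polynomial.eval₂RingHom E.subtype β).range, π e = 0 → e = 0 := by
  let _ : Field E := hF.toField
  rintro _ ⟨f, rfl⟩ h
  have hirr : Irreducible (Polynomial.X ^ p - Polynomial.C (⟨β ^ p, hβ⟩ : E)) := by
    refine X_pow_sub_C_irreducible_of_prime hp.out ?_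
    intro e he
    apply hb e e.2
    have h2 : (e : C) ^ p = β ^ p := congrArg Subtype.val he
    have h3 : (π e) ^ p = (π β) ^ p := by rw [← map_pow, h2, map_pow]
    exact frobenius_inj κ p h3
  by_cases hd : (Polynomial.X ^ p - Polynomial.C (⟨β ^ p, hβ⟩ : E)) ∣ f
  · obtain ⟨g, rfl⟩ := hd
    rw [map_mul]
    simp
  · obtain ⟨u, v, huv⟩ := (hirr.coprime_iff_not_dvd).2 hd
    have := congrArg (fun t => π (Polynomial.eval₂RingHom E.subtype β t)) huv
    simp only [map_add, map_mul, h] at this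
    simp at this

lemma exists_coeff_section (p : ℕ) [hp : Fact p.Prime] {C κ : Type*} [CommRing C] [Field κ]
    [CharP C p] [CharP κ p]
    (π : C →+* κ) (hπ : Function.Surjective π) (h0 : ∀ a b, π a = 0 → π b = 0 → a * b = 0) :
    ∃ g : κ →+* C, ∀ x, π (g x) = x := by
  have hpow : ∀ a, π a = 0 → a ^ p = 0 := by
    intro a ha
    obtain ⟨m, rfl⟩ := Nat.exists_eq_add_of_le hp.out.two_le
    rw [pow_add, pow_two, h0 a a ha ha, zero_mul]
  let P : Set (Subring C) := {E | (frobenius C p).range ≤ E ∧ ∀ e ∈ E, π e = 0 → e = 0}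
  have hP0 : (frobenius C p).range ∈ P := by
    refine ⟨le_rfl, ?_⟩
    rintro _ ⟨c, rfl⟩ h
    simp only [frobenius_def, map_pow] at h ⊢
    exact hpow c (pow_eq_zero_iff hp.out.ne_zero |>.1 h)
  obtain ⟨E, -, hmax⟩ := zorn_le_nonempty₀ P (fun c hcP hc y hy => by
    refine ⟨sSup c, ⟨?_, ?_⟩, fun z hz => le_sSup hz⟩
    · exact (hcP hy).1.trans (le_sSup hy)
    · intro e he h
      rw [Subring.mem_sSup_of_directedOn ⟨y, hy⟩ hc.directedOn] at he
      obtain ⟨s, hs, hes⟩ := he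
      exact (hcP hs).2 e hes h) _ hP0
  have hEP := hmax.prop
  have hF : IsField E := by
    refine ⟨⟨0, 1, ?_⟩, mul_comm, ?_⟩
    · intro h
      have : (0 : C) = 1 := congrArg Subtype.val h
      have := congrArg π this
      simp at this
    · intro e he
      have he' : π e ≠ 0 := fun h => he (Subtype.ext (hEP.2 e e.2 h))
      obtain ⟨c, hc⟩ := hπ (π e)⁻¹
      refine ⟨e ^ (p - 1) * ⟨c ^ p, hEP.1 ⟨c, rfl⟩⟩, Subtype.ext ?_⟩
      have h1 : ((e : C) * c) ^ p = 1 := by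
        have : (e * c - 1) ^ p = 0 := hpow _ (by simp [hc, he'])
        rw [sub_pow_char] at this
        simpa [sub_eq_zero] using this
      rw [mul_pow] at h1
      simp only [Subring.coe_mul, Subring.coe_pow, Subring.coe_one]
      rw [← mul_assoc, mul_pow_sub_one hp.out.ne_zero, h1]
  have hsurj : ∀ b, ∃ e ∈ E, π e = b := by
    intro b
    by_contra! hcon
    obtain ⟨β, rfl⟩ := hπ b
    have hle : E ≤ (Polynomial.eval₂RingHom E.subtype β).range := fun e he =>
      ⟨Polynomial.C ⟨e, he⟩, by simp⟩
    have := hmax.le_of_ge (y := (Polynomial.eval₂RingHom E.subtype β).range)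
      ⟨hEP.1.trans hle, coeff_step p π E hF β (hEP.1 ⟨β, rfl⟩) hcon⟩ hle
    exact hcon β (this ⟨Polynomial.X, by simp⟩) rfl
  let e : E ≃+* κ := RingEquiv.ofBijective (π.comp E.subtype) ⟨by
    rw [injective_iff_map_eq_zero]
    intro a ha
    exact Subtype.ext (hEP.2 a a.2 ha), fun b => by
    obtain ⟨e, he, h⟩ := hsurj b
    exact ⟨⟨e, he⟩, h⟩⟩
  exact ⟨E.subtype.comp e.symm, fun x => e.apply_symm_apply x⟩

/-- The universal-type derivation: a retraction of the cotangent space. -/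
lemma exists_derivation_cotangent (p : ℕ) [hp : Fact p.Prime] (S : Type*) [CommRing S]
    [IsLocalRing S] [CharP S p] :
    ∃ δ : S → CotangentSpace S, (∀ a b, δ (a + b) = δ a + δ b) ∧
      (∀ a b, δ (a * b) = a • δ b + b • δ a) ∧
      ∀ w : maximalIdeal S, δ w = (maximalIdeal S).toCotangent w := by
  let m := maximalIdeal S
  let C := S ⧸ m ^ 2
  have hm2 : m ^ 2 ≠ ⊤ := fun h => (maximalIdeal.isMaximal S).ne_top
    (top_le_iff.1 (h ▸ Ideal.pow_le_self two_ne_zero))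
  have : Nontrivial C := Ideal.Quotient.nontrivial_iff.2 hm2
  have : CharP C p := (CharP.charP_iff_prime_eq_zero hp.out).2 (by
    rw [← map_natCast (Ideal.Quotient.mk (m ^ 2)), CharP.cast_eq_zero, map_zero])
  have : CharP (ResidueField S) p := (CharP.charP_iff_prime_eq_zero hp.out).2 (by
    rw [← map_natCast (residue S), CharP.cast_eq_zero, map_zero])
  let π : C →+* ResidueField S := Ideal.Quotient.lift (m ^ 2) (residue S) (fun a ha =>
    (residue_eq_zero_iff a).2 (Ideal.pow_le_self two_ne_zero ha))
  have hπ : Function.Surjective π := fun x => by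
    obtain ⟨s, rfl⟩ := residue_surjective x
    exact ⟨Ideal.Quotient.mk _ s, rfl⟩
  obtain ⟨g, hg⟩ := exists_coeff_section p π hπ (fun a b ha hb => by
    obtain ⟨a, rfl⟩ := Ideal.Quotient.mk_surjective a
    obtain ⟨b, rfl⟩ := Ideal.Quotient.mk_surjective b
    have ha' : a ∈ m := (residue_eq_zero_iff a).1 ha
    have hb' : b ∈ m := (residue_eq_zero_iff b).1 hb
    rw [← map_mul, Ideal.Quotient.eq_zero_iff_mem, pow_two]
    exact Ideal.mul_mem_mul ha' hb')
  choose σ hσ using fun s : S => Ideal.Quotient.mk_surjective (I := m ^ 2) (g (residue S s))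
  have hmem : ∀ s, s - σ s ∈ m := fun s => by
    have h1 : residue S (σ s) = residue S s := by
      have := congrArg π (hσ s)
      rw [hg] at this
      exact this
    rw [← residue_eq_zero_iff, map_sub, h1, sub_self]
  refine ⟨fun s => m.toCotangent ⟨s - σ s, hmem s⟩, ?_, ?_, ?_⟩
  · intro a b
    rw [← map_add, Ideal.toCotangent_eq, ← Ideal.Quotient.eq_zero_iff_mem]
    simp only [map_sub, map_add, hσ, AddMemClass.mk_add_mk]
    ring
  · intro a b
    have key : ∀ s, Ideal.Quotient.mk (m ^ 2) (s - σ s) =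
        Ideal.Quotient.mk (m ^ 2) s - g (residue S s) := fun s => by rw [map_sub, hσ]
    rw [← map_smul, ← map_smul, ← map_add, Ideal.toCotangent_eq,
      ← Ideal.Quotient.eq_zero_iff_mem]
    have h1 : Ideal.Quotient.mk (m ^ 2) ((a - σ a) * (b - σ b)) = 0 := by
      rw [Ideal.Quotient.eq_zero_iff_mem, pow_two]
      exact Ideal.mul_mem_mul (hmem a) (hmem b)
    rw [map_mul, key, key] at h1
    simp only [map_sub, map_add, map_mul, hσ, AddMemClass.mk_add_mk, SetLike.mk_smul_mk,
      smul_eq_mul]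
    linear_combination -h1
  · intro w
    rw [Ideal.toCotangent_eq, ← Ideal.Quotient.eq_zero_iff_mem]
    have h1 : residue S w = 0 := (residue_eq_zero_iff _).2 w.2
    simp [hσ, h1]
lemma finrank_span_map_eq {K K' σ : Type*} [Field K] [Field K'] [Algebra K K'] [Finite σ]
    (s : Set (σ → K)) :
    Module.finrank K' (Submodule.span K' ((fun v : σ → K => algebraMap K K' ∘ v) '' s)) =
      Module.finrank K (Submodule.span K s) := by
  obtain ⟨t, hts, hspan, hli⟩ := exists_linearIndependent K s
  have hli' : LinearIndependent K' (fun i : t => algebraMap K K' ∘ (i : σ → K)) :=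
    linearIndependent_algebraMap_comp_iff.2 hli
  have : Finite t := hli.finite
  have : Fintype t := Fintype.ofFinite t
  have h1 := finrank_span_eq_card hli
  have h2 := finrank_span_eq_card hli'
  rw [Subtype.range_coe, hspan] at h1
  rw [h1, ← h2]
  have key : ∀ v ∈ Submodule.span K t, algebraMap K K' ∘ v ∈
      Submodule.span K' (Set.range fun i : t => algebraMap K K' ∘ (i : σ → K)) := by
    intro v hv
    induction hv using Submodule.span_induction with
    | mem x h => exact Submodule.subset_span ⟨⟨x, h⟩, rfl⟩
    | zero =>
      have : (algebraMap K K' ∘ (0 : σ → K)) = 0 := by ext; simp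
      rw [this]
      exact Submodule.zero_mem _
    | add x y _ _ hx hy =>
      have : (algebraMap K K' ∘ (x + y)) = algebraMap K K' ∘ x + algebraMap K K' ∘ y := by
        ext; simp
      rw [this]
      exact Submodule.add_mem _ hx hy
    | smul a x _ hx =>
      have : (algebraMap K K' ∘ (a • x)) = algebraMap K K' a • (algebraMap K K' ∘ x) := by
        ext; simp
      rw [this]
      exact Submodule.smul_mem _ _ hx
  have : Submodule.span K' ((fun v : σ → K => algebraMap K K' ∘ v) '' s) =
      Submodule.span K' (Set.range fun i : t => algebraMap K K' ∘ (i : σ → K)) := by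
    apply le_antisymm
    · rw [Submodule.span_le]
      rintro _ ⟨v, hv, rfl⟩
      exact key v (hspan ▸ Submodule.subset_span hv)
    · apply Submodule.span_mono
      rintro _ ⟨⟨x, h⟩, rfl⟩
      exact ⟨x, hts h, rfl⟩
  rw [this]

lemma edim_quotient {S B : Type} [CommRing S] [IsLocalRing S] [IsNoetherianRing S] [CommRing B]
    [IsLocalRing B] (f : S →+* B) (hf : Function.Surjective f) :
    edim B + Module.finrank (ResidueField S) (Submodule.span (ResidueField S)
      {c : CotangentSpace S | ∃ w : maximalIdeal S, f w = 0 ∧ (maximalIdeal S).toCotangent w = c})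
      = edim S := by
  have : IsLocalHom f := .of_surjective f hf
  set W := Submodule.span (ResidueField S)
      {c : CotangentSpace S | ∃ w : maximalIdeal S, f w = 0 ∧ (maximalIdeal S).toCotangent w = c}
    with hW
  let _ : Algebra S B := f.toAlgebra
  have hcomap : (maximalIdeal B).comap f = maximalIdeal S := by
    rw [maximalIdeal_comap]
  let M := Ideal.mapCotangent (maximalIdeal S) (maximalIdeal B) (Algebra.ofId S B) hcomap.ge
  have hM : ∀ w, M ((maximalIdeal S).toCotangent w) =
    (maximalIdeal B).toCotangent ⟨f w, hcomap.ge w.2⟩ := fun w => 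
      Ideal.mapCotangent_toCotangent _ _ (Algebra.ofId S B) hcomap.ge w
  have hMsurj : Function.Surjective M := by
    intro y
    obtain ⟨⟨y, hy⟩, rfl⟩ := Ideal.toCotangent_surjective _ y
    obtain ⟨s, rfl⟩ := hf y
    exact ⟨(maximalIdeal S).toCotangent ⟨s, hcomap.le hy⟩, hM _⟩
  have hker : LinearMap.ker M = W.restrictScalars S := by
    apply le_antisymm
    · intro y hy
      obtain ⟨y, rfl⟩ := Ideal.toCotangent_surjective _ y
      rw [LinearMap.mem_ker, hM, Ideal.toCotangent_eq_zero] at hy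
      have hmap : maximalIdeal B ^ 2 = (maximalIdeal S ^ 2).map f := by
        rw [Ideal.map_pow, ← hcomap, Ideal.map_comap_of_surjective f hf]
      rw [hmap] at hy
      obtain ⟨z, hz, hzy⟩ := (Ideal.mem_map_iff_of_surjective f hf).1 hy
      have hzm : z ∈ maximalIdeal S := Ideal.pow_le_self two_ne_zero hz
      apply Submodule.subset_span
      refine ⟨y - ⟨z, hzm⟩, ?_, ?_⟩
      · simp [hzy]
      · rw [Ideal.toCotangent_eq]
        simpa using hz
    · have : ∀ y ∈ W, M y = 0 := by
        intro y hy
        induction hy using Submodule.span_induction with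
        | mem x h => 
          obtain ⟨w, hw, rfl⟩ := h
          rw [hM, Ideal.toCotangent_eq_zero]
          simp [hw]
        | zero => exact map_zero _
        | add x y _ _ hx hy => rw [map_add, hx, hy, add_zero]
        | smul a x _ hx =>
          obtain ⟨s, rfl⟩ := residue_surjective a
          rw [← ResidueField.algebraMap_eq, algebraMap_smul, map_smul, hx, smul_zero]
      exact fun y hy => this y hy
  let e1 : (CotangentSpace S ⧸ W) ≃+ CotangentSpace B := 
    (Submodule.Quotient.restrictScalarsEquiv S W).symm.toAddEquiv.trans
     ((Submodule.quotEquivOfEq _ _ hker.symm).trans (M.quotKerEquivOfSurjective hMsurj)).toAddEquiv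
  have he1 : ∀ c, e1 (Submodule.Quotient.mk c) = M c := fun c => rfl
  have hbij : Function.Bijective (ResidueField.map f) := by
    refine ⟨RingHom.injective _, fun y => ?_⟩
    obtain ⟨y, rfl⟩ := residue_surjective y
    obtain ⟨s, rfl⟩ := hf y
    exact ⟨residue S s, rfl⟩
  have hrank := rank_eq_of_equiv_equiv (ResidueField.map f) e1 hbij (by
    intro r c
    obtain ⟨c, rfl⟩ := Submodule.Quotient.mk_surjective _ c
    obtain ⟨s, rfl⟩ := residue_surjective r
    rw [← Submodule.Quotient.mk_smul, he1, he1, ← ResidueField.algebraMap_eq, algebraMap_smul,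
      map_smul]
    change _ = algebraMap B (ResidueField B) (f s) • M c
    rw [algebraMap_smul]
    change s • M c = algebraMap S B s • M c
    rw [algebraMap_smul])
  have hfin : edim B = Module.finrank (ResidueField S) (CotangentSpace S ⧸ W) := by
    rw [edim, Module.finrank, Module.finrank, hrank]
  rw [hfin, Submodule.finrank_quotient_add_finrank, edim]

lemma derivation_poly (p : ℕ) {S k σ : Type} [CommRing S] [IsLocalRing S]
    [CharP S p] [Field k] [Fintype σ] (δ : Derivation ℤ S (CotangentSpace S))
    (ψ : MvPolynomial σ k →+* S) (hψ : ∀ c, ∃ y, ψ (MvPolynomial.C c) = y ^ p)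
    (f : MvPolynomial σ k) :
    δ (ψ f) = ∑ i, ψ (MvPolynomial.pderiv i f) • δ (ψ (MvPolynomial.X i)) := by
  classical
  induction f using MvPolynomial.induction_on with
  | C a =>
    obtain ⟨y, hy⟩ := hψ a
    rw [hy, Derivation.leibniz_pow]
    have : (p : ℕ) • (y ^ (p - 1) • δ y) = (p : S) • (y ^ (p - 1) • δ y) := by
      rw [Nat.cast_smul_eq_nsmul]
    rw [this]
    simp
  | add f g hf hg => simp [hf, hg, add_smul, Finset.sum_add_distrib]
  | mul_X f n hf =>
    rw [map_mul, Derivation.leibniz, hf, Finset.smul_sum]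
    simp only [Derivation.leibniz, map_add, smul_eq_mul, map_mul, add_smul, Finset.sum_add_distrib,
      MvPolynomial.pderiv_X, mul_smul]
    congr 1
    rw [Finset.sum_eq_single n]
    · simp
    · intro b _ hb
      simp [hb.symm]
    · simp

lemma exists_expansion (p : ℕ) [Fact p.Prime] {S k σ : Type} [CommRing S] [IsLocalRing S]
    [CharP S p] [Field k] [Fintype σ]
    (ψ : MvPolynomial σ k →+* S) (hψ : ∀ c, ∃ y, ψ (MvPolynomial.C c) = y ^ p) :
    ∃ e : σ → CotangentSpace S, ∀ f, ∀ h : ψ f ∈ maximalIdeal S,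
      (maximalIdeal S).toCotangent ⟨ψ f, h⟩ = ∑ i, ψ (MvPolynomial.pderiv i f) • e i := by
  obtain ⟨δ0, hadd, hmul, hδ0⟩ := exists_derivation_cotangent p S
  let δ : Derivation ℤ S (CotangentSpace S) :=
    Derivation.mk' (AddMonoidHom.mk' δ0 hadd).toIntLinearMap hmul
  refine ⟨fun i => δ (ψ (MvPolynomial.X i)), fun f h => ?_⟩
  rw [← derivation_poly p δ ψ hψ f]
  exact (hδ0 ⟨ψ f, h⟩).symm

lemma exists_J {F σ : Type} [Field F] [Finite σ] (Q : Ideal (MvPolynomial σ F)) [Q.IsPrime] :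
    ∃ J : Derivation F (Localization.AtPrime Q) (σ → Q.ResidueField), ∀ t i,
      J (algebraMap (MvPolynomial σ F) (Localization.AtPrime Q) t) i =
        algebraMap (MvPolynomial σ F) Q.ResidueField (MvPolynomial.pderiv i t) := by
  let T := MvPolynomial σ F
  let S := Localization.AtPrime Q
  let d0 : Derivation F T (σ → Q.ResidueField) := Derivation.mk'
    (LinearMap.pi fun i => (((Algebra.linearMap T Q.ResidueField).restrictScalars F) ∘ₗ
      (MvPolynomial.pderiv (R := F) i).toLinearMap)) (by
      intro a b
      ext i
      simp [Algebra.smul_def])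
  have : Algebra.FormallyEtale T S := .of_isLocalization Q.primeCompl
  let e := KaehlerDifferential.tensorKaehlerEquivOfFormallyEtale F T S
  let L := (LinearMap.liftBaseChange S d0.liftKaehlerDifferential) ∘ₗ e.symm.toLinearMap
  refine ⟨L.compDer (KaehlerDifferential.D F S), fun t i => ?_⟩
  have : L.compDer (KaehlerDifferential.D F S) (algebraMap T S t) = d0 t := by
    simp [L, e, KaehlerDifferential.tensorKaehlerEquivOfFormallyEtale_symm_D_algebraMap]
  rw [this]
  rfl

lemma edim_core (p : ℕ) [hp : Fact p.Prime] {k F σ : Type} [Field k] [Field F] [Algebra k F]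
    [CharP F p] [Finite σ] (hroot : ∀ c : k, ∃ y : F, algebraMap k F c = y ^ p)
    (Q : Ideal (MvPolynomial σ F)) [Q.IsPrime] {B : Type} [CommRing B] [IsLocalRing B]
    (φ : Localization.AtPrime Q →+* B) (hφ : Function.Surjective φ) (I : Set (MvPolynomial σ k))
    (hker : RingHom.ker φ = Ideal.span ((fun f => algebraMap (MvPolynomial σ F)
      (Localization.AtPrime Q) (MvPolynomial.map (algebraMap k F) f)) '' I)) :
    edim B + Module.finrank Q.ResidueField (Submodule.span Q.ResidueField
      ((fun f i => algebraMap (MvPolynomial σ F) Q.ResidueField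
        (MvPolynomial.map (algebraMap k F) (MvPolynomial.pderiv i f))) '' I)) =
    edim (Localization.AtPrime Q) := by
  have := Fintype.ofFinite σ
  classical
  rw [← edim_quotient φ hφ]
  congr 1
  obtain ⟨J, hJ⟩ := exists_J Q
  set S := Localization.AtPrime Q with hS
  have : CharP S p := (CharP.charP_iff_prime_eq_zero hp.out).2 (by
    rw [← map_natCast (algebraMap F S), CharP.cast_eq_zero, map_zero])
  let ψ : MvPolynomial σ k →+* S := (algebraMap (MvPolynomial σ F) S).comp
    (MvPolynomial.map (algebraMap k F))
  have hψ : ∀ c, ∃ y, ψ (MvPolynomial.C c) = y ^ p := fun c => by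
    obtain ⟨y, hy⟩ := hroot c
    exact ⟨algebraMap (MvPolynomial σ F) S (MvPolynomial.C y), by simp [ψ, hy]⟩
  obtain ⟨e, he⟩ := exists_expansion p ψ hψ
  -- generators lie in the maximal ideal
  have hIm : ∀ f ∈ I, ψ f ∈ maximalIdeal S := fun f hf => by
    have h0 : φ (ψ f) = 0 := by
      rw [← RingHom.mem_ker, hker]
      exact Ideal.subset_span ⟨f, hf, rfl⟩
    intro hu
    have := hu.map φ
    rw [h0] at this
    exact not_isUnit_zero this
  let v : MvPolynomial σ k → (σ → Q.ResidueField) := fun f i => residue S (ψ (MvPolynomial.pderiv i f))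
  let E : (σ → Q.ResidueField) →ₗ[Q.ResidueField] CotangentSpace S :=
    Fintype.linearCombination Q.ResidueField e
  have hE : ∀ f (hf : f ∈ I), E (v f) = (maximalIdeal S).toCotangent ⟨ψ f, hIm f hf⟩ := by
    intro f hf
    rw [he, Fintype.linearCombination_apply]
    refine Finset.sum_congr rfl fun i _ => ?_
    exact algebraMap_smul (R := S) (ResidueField S) _ _
  have h1 : ∀ c ∈ maximalIdeal S, ∀ u : σ → Q.ResidueField, c • u = 0 := by
    intro c hc u
    rw [← algebraMap_smul (ResidueField S) c u, ResidueField.algebraMap_eq,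
      (residue_eq_zero_iff c).2 hc, zero_smul]
  have hker0 : ∀ a ∈ maximalIdeal S ^ 2, J a = 0 := by
    intro a ha
    rw [pow_two] at ha
    induction ha using Submodule.mul_induction_on' with
    | mem_mul_mem a ha b hb => rw [Derivation.leibniz, h1 a ha, h1 b hb, add_zero]
    | add x _ y _ hx hy => rw [map_add, hx, hy, add_zero]
  let V := Submodule.span Q.ResidueField (v '' I)
  have hW : Submodule.span (ResidueField S) {c : CotangentSpace S | ∃ w : maximalIdeal S,
      φ w = 0 ∧ (maximalIdeal S).toCotangent w = c} = V.map E := by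
    apply le_antisymm
    · rw [Submodule.span_le]
      rintro _ ⟨w, hw, rfl⟩
      have key : ∀ w ∈ Ideal.span (ψ '' I), ∃ h : w ∈ maximalIdeal S,
          (maximalIdeal S).toCotangent ⟨w, h⟩ ∈ V.map E := by
        intro w hw
        induction hw using Submodule.span_induction with
        | mem x h =>
          obtain ⟨f, hf, rfl⟩ := h
          exact ⟨hIm f hf, hE f hf ▸ Submodule.mem_map_of_mem (Submodule.subset_span ⟨f, hf, rfl⟩)⟩
        | zero => 
          refine ⟨zero_mem _, ?_⟩
          have : (maximalIdeal S).toCotangent ⟨0, zero_mem _⟩ = 0 := map_zero _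
          rw [this]
          exact zero_mem _
        | add x y _ _ hx hy =>
          obtain ⟨hx, hx'⟩ := hx
          obtain ⟨hy, hy'⟩ := hy
          refine ⟨add_mem hx hy, ?_⟩
          have : (maximalIdeal S).toCotangent ⟨x + y, add_mem hx hy⟩ =
            (maximalIdeal S).toCotangent ⟨x, hx⟩ + (maximalIdeal S).toCotangent ⟨y, hy⟩ :=
              map_add (maximalIdeal S).toCotangent ⟨x, hx⟩ ⟨y, hy⟩
          rw [this]
          exact add_mem hx' hy'
        | smul a x _ hx =>
          obtain ⟨hx, hx'⟩ := hx
          refine ⟨Ideal.mul_mem_left _ a hx, ?_⟩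
          have : (maximalIdeal S).toCotangent ⟨a • x, Ideal.mul_mem_left _ a hx⟩ =
            residue S a • (maximalIdeal S).toCotangent ⟨x, hx⟩ := by
              rw [← ResidueField.algebraMap_eq, algebraMap_smul, ← map_smul]
              rfl
          rw [this]
          exact Submodule.smul_mem _ _ hx'
      obtain ⟨_, h⟩ := key w (by
        have : (w : S) ∈ RingHom.ker φ := hw
        rwa [hker] at this)
      exact h
    · rw [Submodule.map_span, Submodule.span_le]
      rintro _ ⟨_, ⟨f, hf, rfl⟩, rfl⟩
      rw [hE f hf]
      refine Submodule.subset_span ⟨_, ?_, rfl⟩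
      rw [← RingHom.mem_ker, hker]
      exact Ideal.subset_span ⟨f, hf, rfl⟩
  have hlift : ∀ u ∈ V, ∃ w : maximalIdeal S, (maximalIdeal S).toCotangent w = E u ∧ J w = u := by
    intro u hu
    induction hu using Submodule.span_induction with
    | mem x h =>
      obtain ⟨f, hf, rfl⟩ := h
      refine ⟨⟨ψ f, hIm f hf⟩, (hE f hf).symm, ?_⟩
      ext i
      simp only [ψ, RingHom.comp_apply]
      rw [hJ, MvPolynomial.pderiv_map]
      rfl
    | zero => exact ⟨0, by simp, by simp⟩
    | add x y _ _ hx hy =>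
      obtain ⟨a, ha, ha'⟩ := hx
      obtain ⟨b, hb, hb'⟩ := hy
      exact ⟨a + b, by rw [map_add, map_add, ha, hb],
        by rw [Submodule.coe_add, map_add, ha', hb']⟩
    | smul c x _ hx =>
      obtain ⟨a, ha, ha'⟩ := hx
      obtain ⟨s, rfl⟩ := residue_surjective c
      refine ⟨s • a, ?_, ?_⟩
      · rw [map_smul, map_smul, ha]
        exact (algebraMap_smul (R := S) (ResidueField S) s _).symm
      · rw [Submodule.coe_smul, smul_eq_mul, Derivation.leibniz, h1 a a.2, add_zero, ha']
        exact (algebraMap_smul (R := S) (ResidueField S) s _).symm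
  have hinj : Function.Injective (E.domRestrict V) := by
    rw [injective_iff_map_eq_zero]
    rintro ⟨u, hu⟩ h0
    obtain ⟨w, hw, hw'⟩ := hlift u hu
    have h0' : E u = 0 := h0
    rw [h0', Ideal.toCotangent_eq_zero] at hw
    rw [hker0 _ hw] at hw'
    exact Subtype.ext hw'.symm
  have hfin := LinearMap.finrank_range_of_inj hinj
  rw [LinearMap.range_domRestrict] at hfin
  rw [hW]
  exact hfin.symm

lemma height_comap_of_pow {P T : Type*} [CommRing P] [CommRing T] (f : P →+* T)
    (hinj : Function.Injective f) (H : ∀ t : T, ∃ n > 0, t ^ n ∈ f.range)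
    (Q : Ideal T) [Q.IsPrime] : (Q.comap f).height = Q.height := by
  have hh := PrimeSpectrum.isHomeomorph_comap f H (by
    rw [(RingHom.injective_iff_ker_eq_bot f).1 hinj]; exact bot_le)
  let e : PrimeSpectrum T ≃o PrimeSpectrum P :=
    { Equiv.ofBijective _ hh.bijective with
      map_rel_iff' := by
        intro a b
        refine ⟨fun h x hx => ?_, fun h x hx => h hx⟩
        obtain ⟨n, hn, y, hy⟩ := H x
        have h1 : f y ∈ a.asIdeal := hy ▸ Ideal.pow_mem_of_mem _ hx n hn
        have h2 : f y ∈ b.asIdeal := h h1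
        rw [hy] at h2
        exact b.2.mem_of_pow_mem n h2 }
  have h1 := PrimeSpectrum.height_eq_orderHeight (⟨Q, ‹_›⟩ : PrimeSpectrum T)
  have h2 := PrimeSpectrum.height_eq_orderHeight (e ⟨Q, ‹_›⟩)
  rw [Order.height_orderIso e ⟨Q, ‹_›⟩, ← h1] at h2
  exact h2

lemma exists_presentation {k F A : Type} [Field k] [Field F] [Algebra k F]
    [CommRing A] [Algebra k A] {n : ℕ}
    (φ : MvPolynomial (Fin n) k →ₐ[k] A) (hφ : Function.Surjective φ) :
    ∃ Θ : MvPolynomial (Fin n) F →+* A ⊗[k] F, Function.Surjective Θ ∧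
      (∀ f, Θ (MvPolynomial.map (algebraMap k F) f) = φ f ⊗ₜ 1) ∧
      RingHom.ker Θ = (RingHom.ker φ).map (MvPolynomial.map (algebraMap k F)) := by
  let ε : (MvPolynomial (Fin n) k) ⊗[k] F ≃ₐ[k] MvPolynomial (Fin n) F :=
    (Algebra.TensorProduct.comm k _ F).trans
      ((MvPolynomial.algebraTensorAlgEquiv k F).restrictScalars k)
  have hε : ∀ f, ε (f ⊗ₜ 1) = MvPolynomial.map (algebraMap k F) f := fun f => by
    simp [ε, MvPolynomial.algebraTensorAlgEquiv_tmul]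
  let m := Algebra.TensorProduct.map φ (AlgHom.id k F)
  have hm : Function.Surjective m :=
    TensorProduct.map_surjective hφ Function.surjective_id
  refine ⟨m.toRingHom.comp ε.symm.toRingEquiv.toRingHom, hm.comp ε.symm.surjective, fun f => ?_, ?_⟩
  · have : ε.symm (MvPolynomial.map (algebraMap k F) f) = f ⊗ₜ 1 := by
      rw [← hε, ε.symm_apply_apply]
    change m (ε.symm _) = _
    rw [this]
    simp [m]
  · have hk := Algebra.TensorProduct.rTensor_ker (R := k) (C := F) φ hφ
    apply le_antisymm
    · intro t ht
      have ht' : ε.symm t ∈ RingHom.ker m := ht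
      rw [hk] at ht'
      have hle : Ideal.map (Algebra.TensorProduct.includeLeft : _ →ₐ[k] _ ⊗[k] F) (RingHom.ker φ) ≤
          Ideal.comap ε ((RingHom.ker φ).map (MvPolynomial.map (algebraMap k F))) := by
        rw [Ideal.map_le_iff_le_comap]
        intro f hf
        change ε (f ⊗ₜ 1) ∈ ((RingHom.ker φ).map (MvPolynomial.map (algebraMap k F)))
        rw [hε]
        exact Ideal.mem_map_of_mem _ hf
      have h2 : ε (ε.symm t) ∈ ((RingHom.ker φ).map (MvPolynomial.map (algebraMap k F))) := hle ht'
      rwa [ε.apply_symm_apply] at h2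
    · rw [Ideal.map_le_iff_le_comap]
      intro f hf
      change m (ε.symm _) = 0
      rw [← hε, ε.symm_apply_apply]
      have : φ f = 0 := hf
      simp [m, this]

lemma exists_poly_localization {k F A : Type} [Field k] [Field F] [Algebra k F] 
    [IsPurelyInseparable k F] [CommRing A] [Algebra k A] {n : ℕ}
    (φ : MvPolynomial (Fin n) k →ₐ[k] A) (hφ : Function.Surjective φ) (x : Ideal A) [x.IsPrime]
    [IsLocalRing ((Localization.AtPrime x) ⊗[k] F)] :
    ∃ (Q : Ideal (MvPolynomial (Fin n) F)) (_ : Q.IsPrime)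
      (Φ : Localization.AtPrime Q →+* (Localization.AtPrime x) ⊗[k] F),
      Function.Surjective Φ ∧ x.comap φ = Q.comap (MvPolynomial.map (algebraMap k F)) ∧
      RingHom.ker Φ = Ideal.span ((fun f => algebraMap (MvPolynomial (Fin n) F)
      (Localization.AtPrime Q) (MvPolynomial.map (algebraMap k F) f)) '' (RingHom.ker φ)) := by
  obtain ⟨Θ, hΘ, hΘ1, hΘk⟩ := exists_presentation (F := F) φ hφ
  let B := (Localization.AtPrime x) ⊗[k] F
  let Λ : A ⊗[k] F →ₐ[k] B := Algebra.TensorProduct.map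
    (IsScalarTower.toAlgHom k A (Localization.AtPrime x)) (AlgHom.id k F)
  let _ : Algebra (A ⊗[k] F) B := Λ.toRingHom.toAlgebra
  have : IsScalarTower A (A ⊗[k] F) B := .of_algebraMap_eq' (by
    ext a
    rfl)
  have hloc : IsLocalization (Algebra.algebraMapSubmonoid (A ⊗[k] F) x.primeCompl) B :=
    IsLocalization.tensorProduct_tensorProduct k F x.primeCompl (Localization.AtPrime x) (by
      ext a
      change algebraMap A (Localization.AtPrime x) 1 ⊗ₜ a = 1 ⊗ₜ a
      rw [map_one])
  let G := Λ.toRingHom.comp Θ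
  let Q := (maximalIdeal B).comap G
  have hunit : ∀ t : Q.primeCompl, IsUnit (G t) := fun t => by
    by_contra h
    exact t.2 h
  let Φ : Localization.AtPrime Q →+* B := IsLocalization.lift (M := Q.primeCompl) hunit
  have hΦ : ∀ t, Φ (algebraMap _ _ t) = G t := fun t => IsLocalization.lift_eq hunit t
  let ι := MvPolynomial.map (σ := Fin n) (algebraMap k F)
  have hs : ∀ f, φ f ∉ x → ι f ∈ Q.primeCompl := fun f hf => by
    intro h
    have hu : IsUnit (Λ (φ f ⊗ₜ 1)) :=
      IsLocalization.map_units B (⟨_, ⟨φ f, hf, rfl⟩⟩ : Algebra.algebraMapSubmonoid (A ⊗[k] F) x.primeCompl)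
    have h' : ¬ IsUnit (Λ (Θ (ι f))) := h
    rw [hΘ1] at h'
    exact h' hu
  refine ⟨Q, inferInstance, Φ, ?_, ?_, ?_⟩
  · intro b
    obtain ⟨⟨a, ⟨_, s, hsx, rfl⟩⟩, h⟩ := IsLocalization.surj
      (Algebra.algebraMapSubmonoid (A ⊗[k] F) x.primeCompl) b
    obtain ⟨t, rfl⟩ := hΘ a
    obtain ⟨s, rfl⟩ := hφ s
    refine ⟨IsLocalization.mk' _ t (⟨ι s, hs s hsx⟩ : Q.primeCompl), ?_⟩
    rw [IsLocalization.lift_mk'_spec, mul_comm]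
    change G t = b * Λ (Θ (ι s))
    rw [hΘ1]
    exact h.symm
  · apply le_antisymm
    · intro f hf
      change ¬ IsUnit (Λ (Θ (ι f)))
      rw [hΘ1]
      intro hu
      have hu' : IsUnit (algebraMap (Localization.AtPrime x) B
          (algebraMap A (Localization.AtPrime x) (φ f))) := by
        exact hu
      have : IsLocalHom (algebraMap (Localization.AtPrime x) B) := by
        refine ⟨fun a ha => ?_⟩
        obtain ⟨b, hb⟩ := ha.exists_right_inv
        obtain ⟨n, hn, c, hc⟩ :=
          IsPurelyInseparable.exists_pow_mem_range_tensorProduct (k := k) (K := F)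
            (R := Localization.AtPrime x) b
        have hinj : Function.Injective (algebraMap (Localization.AtPrime x)
            ((Localization.AtPrime x) ⊗[k] F)) :=
          Algebra.TensorProduct.includeLeft_injective (S := Localization.AtPrime x)
            (algebraMap k F).injective
        have h1 : a ^ n * c = 1 := by
          apply hinj
          rw [map_mul, map_pow, hc, ← mul_pow, map_one]
          exact (congrArg (· ^ n) hb).trans (one_pow n)
        exact (isUnit_pow_iff hn.ne').1 (IsUnit.of_mul_eq_one _ h1)
      have h2 := isUnit_of_map_unit _ _ hu'
      rw [IsLocalization.AtPrime.isUnit_to_map_iff _ x] at h2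
      exact h2 hf
    · intro f hf
      by_contra h
      exact hs f h hf
  · apply le_antisymm
    · intro y hy
      obtain ⟨t, u, rfl⟩ := IsLocalization.exists_mk'_eq Q.primeCompl y
      have h0 : algebraMap (A ⊗[k] F) B (Θ t) = 0 := by
        have := (IsLocalization.lift_mk'_spec (hg := hunit) t 0 u).1 hy
        have h' : G t = 0 := by simpa using this
        exact h'
      obtain ⟨⟨_, s, hsx, rfl⟩, h⟩ := (IsLocalization.map_eq_zero_iff
        (Algebra.algebraMapSubmonoid (A ⊗[k] F) x.primeCompl) B _).1 h0
      obtain ⟨s, rfl⟩ := hφ s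
      have h1 : ι s * t ∈ RingHom.ker Θ := by
        rw [RingHom.mem_ker, map_mul, hΘ1]
        exact h
      rw [hΘk] at h1
      have h2 := Ideal.mem_map_of_mem (algebraMap _ (Localization.AtPrime Q)) h1
      rw [Ideal.map_map, map_mul] at h2
      have h3 : algebraMap _ (Localization.AtPrime Q) t ∈ Ideal.map ((algebraMap _ (Localization.AtPrime Q)).comp ι) (RingHom.ker φ) :=
        (Ideal.unit_mul_mem_iff_mem _ (IsLocalization.map_units _ (⟨ι s, hs s hsx⟩ : Q.primeCompl))).1 h2
      have h4 := IsLocalization.mk'_spec (Localization.AtPrime Q) t u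
      rw [← h4] at h3
      exact (Ideal.mul_unit_mem_iff_mem _ (IsLocalization.map_units _ u)).1 h3
    · rw [Ideal.span_le]
      rintro _ ⟨f, hf, rfl⟩
      change Φ _ = 0
      rw [hΦ]
      change Λ (Θ (ι f)) = 0
      have : φ f = 0 := hf
      rw [hΘ1, this]
      simp

lemma map_pow_mem {k F : Type} [Field k] [Field F] [Algebra k F] [IsPurelyInseparable k F] {n : ℕ}
    (t : MvPolynomial (Fin n) F) :
    ∃ m > 0, t ^ m ∈ (MvPolynomial.map (σ := Fin n) (algebraMap k F)).range := by
  let ε : (MvPolynomial (Fin n) k) ⊗[k] F ≃ₐ[k] MvPolynomial (Fin n) F :=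
    (Algebra.TensorProduct.comm k _ F).trans
      ((MvPolynomial.algebraTensorAlgEquiv k F).restrictScalars k)
  have hε : ∀ f, ε (f ⊗ₜ 1) = MvPolynomial.map (algebraMap k F) f := fun f => by
    simp [ε, MvPolynomial.algebraTensorAlgEquiv_tmul]
  obtain ⟨m, hm, y, hy⟩ := IsPurelyInseparable.exists_pow_mem_range_tensorProduct (k := k) (K := F)
            (R := MvPolynomial (Fin n) k) (ε.symm t)
  refine ⟨m, hm, y, ?_⟩
  rw [← hε]
  have h2 : y ⊗ₜ[k] (1 : F) = ε.symm t ^ m := hy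
  rw [h2, map_pow, ε.apply_symm_apply]

lemma edim_add_eq_height (p : ℕ) [Fact p.Prime] {k F A : Type} [Field k] [Field F] [Algebra k F]
    [IsPurelyInseparable k F] [CharP F p] (hroot : ∀ c : k, ∃ y : F, algebraMap k F c = y ^ p)
    [CommRing A] [Algebra k A] {n : ℕ}
    (φ : MvPolynomial (Fin n) k →ₐ[k] A) (hφ : Function.Surjective φ) (x : Ideal A) [x.IsPrime]
    [IsLocalRing ((Localization.AtPrime x) ⊗[k] F)] (q : Ideal (MvPolynomial (Fin n) k))
    [q.IsPrime] (hq : q = x.comap φ) :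
    ((edim ((Localization.AtPrime x) ⊗[k] F) + Module.finrank q.ResidueField
      (Submodule.span q.ResidueField ((fun f i => algebraMap (MvPolynomial (Fin n) k)
        q.ResidueField (MvPolynomial.pderiv i f)) '' (RingHom.ker φ : Set _))) : ℕ) : WithBot ℕ∞)
      = q.height := by
  obtain ⟨Q, hQ, Φ, hΦ, hcomap, hker⟩ := exists_poly_localization (F := F) φ hφ x
  have hc := edim_core p hroot Q Φ hΦ (RingHom.ker φ) hker
  rw [← hq] at hcomap
  let g : q.ResidueField →+* Q.ResidueField :=
    Ideal.ResidueField.map q Q (MvPolynomial.map (algebraMap k F)) hcomap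
  let _ : Algebra q.ResidueField Q.ResidueField := g.toAlgebra
  have hf := finrank_span_map_eq (K := q.ResidueField) (K' := Q.ResidueField)
    ((fun f i => algebraMap (MvPolynomial (Fin n) k)
        q.ResidueField (MvPolynomial.pderiv i f)) '' (RingHom.ker φ : Set _))
  rw [Set.image_image] at hf
  have he : (fun f => algebraMap q.ResidueField Q.ResidueField ∘ fun i : Fin n =>
      algebraMap (MvPolynomial (Fin n) k) q.ResidueField (MvPolynomial.pderiv i f)) =
      fun f i => algebraMap (MvPolynomial (Fin n) F) Q.ResidueField
        (MvPolynomial.map (algebraMap k F) (MvPolynomial.pderiv i f)) := by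
    funext f i
    exact Ideal.ResidueField.map_algebraMap ..
  rw [he] at hf
  rw [← hf, hc]
  have hreg : IsRegularLocalRing (Localization.AtPrime Q) := inferInstance
  have h1 := (IsRegularLocalRing.iff_finrank_cotangentSpace (Localization.AtPrime Q)).1 hreg
  have h2 := IsLocalization.AtPrime.ringKrullDim_eq_height Q (Localization.AtPrime Q)
  have h3 := height_comap_of_pow (MvPolynomial.map (σ := Fin n) (algebraMap k F))
    (MvPolynomial.map_injective _ (algebraMap k F).injective) map_pow_mem Q
  rw [hcomap, h3, ← h2, ← h1]
  rfl

/-- **Proposition 1.5.** Let `R` be the local ring of a `k`-variety at a point,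
where `char k = p > 0`.  Then the embedding dimension of `R ⊗_k k^{1/p}` equals that of
`R ⊗_k k^{1/p^∞}`, where `k^{1/p}` and `k^{1/p^∞}` are taken inside an algebraic closure `Ω`
of `k`. -/
theorem edim_tensor_pth_roots_eq_edim_tensor_perfectClosure
    (p : ℕ) [Fact p.Prime]
    (k Ω : Type) [Field k] [Field Ω] [CharP k p] [Algebra k Ω] [IsAlgClosure k Ω]
    (kp kpinf : IntermediateField k Ω)
    (hkp : ∀ x : Ω, x ∈ kp ↔ x ^ p ∈ Set.range (algebraMap k Ω))
    (hkpinf : ∀ x : Ω, x ∈ kpinf ↔ ∃ n : ℕ, x ^ p ^ n ∈ Set.range (algebraMap k Ω))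
    (A : Type) [CommRing A] [IsDomain A] [Algebra k A] (hA : Algebra.FiniteType k A)
    (x : Ideal A) [x.IsPrime]
    [IsLocalRing ((Localization.AtPrime x) ⊗[k] kp)]
    [IsLocalRing ((Localization.AtPrime x) ⊗[k] kpinf)] :
    edim ((Localization.AtPrime x) ⊗[k] kp) = edim ((Localization.AtPrime x) ⊗[k] kpinf) := by
  have : Fact p.Prime := inferInstance
  have hp : p.Prime := Fact.out
  have : ExpChar k p := ExpChar.prime hp
  have : IsAlgClosed Ω := IsAlgClosure.isAlgClosed k
  have hpi1 : IsPurelyInseparable k kp := by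
    rw [isPurelyInseparable_iff_pow_mem k p]
    intro y
    obtain ⟨c, hc⟩ := (hkp y).1 y.2
    exact ⟨1, c, Subtype.ext (by simpa using hc)⟩
  have hpi2 : IsPurelyInseparable k kpinf := by
    rw [isPurelyInseparable_iff_pow_mem k p]
    intro y
    obtain ⟨n, c, hc⟩ := (hkpinf y).1 y.2
    exact ⟨n, c, Subtype.ext (by simpa using hc)⟩
  have hr1 : ∀ c : k, ∃ y : kp, algebraMap k kp c = y ^ p := fun c => by
    obtain ⟨z, hz⟩ := IsAlgClosed.exists_pow_nat_eq (algebraMap k Ω c) hp.pos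
    exact ⟨⟨z, (hkp z).2 ⟨c, hz.symm⟩⟩, Subtype.ext (by simpa using hz.symm)⟩
  have hr2 : ∀ c : k, ∃ y : kpinf, algebraMap k kpinf c = y ^ p := fun c => by
    obtain ⟨z, hz⟩ := IsAlgClosed.exists_pow_nat_eq (algebraMap k Ω c) hp.pos
    exact ⟨⟨z, (hkpinf z).2 ⟨1, c, by simpa using hz.symm⟩⟩, Subtype.ext (by simpa using hz.symm)⟩
  have : CharP kp p := charP_of_injective_algebraMap (algebraMap k kp).injective p
  have : CharP kpinf p := charP_of_injective_algebraMap (algebraMap k kpinf).injective p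
  obtain ⟨n, φ, hφ⟩ := Algebra.FiniteType.iff_quotient_mvPolynomial''.1 hA
  have h1 := edim_add_eq_height p hr1 φ hφ x (x.comap φ) rfl
  have h2 := edim_add_eq_height p hr2 φ hφ x (x.comap φ) rfl
  have h3 := h1.trans h2.symm
  have h4 := Nat.cast_injective (R := WithBot ℕ∞) h3
  exact Nat.add_right_cancel h4
end

section
/- Let k be a field of characteristic p > 0 with algebraic closure k̄, and set k^{1/p} := {x ∈ k̄ : x^p ∈ k}. Let A be a finite-type k-algebra such that the localization A_q is a regular local ring for every prime q of A. Then the localization of A ⊗_k k̄ at every prime is a regular local ring if and only if the localization of A ⊗_k k^{1/p} at every prime is a regular local ring. (Equivalently: a regular variety X over k is smooth over k if and only if X ×_k k^{1/p} is regular.) -/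
open TensorProduct IsLocalRing

/-- A Noetherian local ring is regular if its Krull dimension equals its embedding dimension. -/
def IsRegularLocalRingDef (R : Type) [CommRing R] [IsLocalRing R] : Prop :=
  IsNoetherianRing R ∧ ringKrullDim R = (edim R : WithBot ℕ∞)


theorem aux_edim_quot {R : Type*} [CommRing R] [IsLocalRing R] [IsNoetherianRing R]
    (I : Ideal R) (hI : I ≤ maximalIdeal R) [IsLocalRing (R ⧸ I)]
    (V : Submodule (ResidueField R) (CotangentSpace R))
    (hV : V = Submodule.span (ResidueField R)
      {c | ∃ x : maximalIdeal R, (x : R) ∈ I ∧ (maximalIdeal R).toCotangent x = c}) :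
    (maximalIdeal (R ⧸ I)).spanFinrank + Module.finrank (ResidueField R) V =
      (maximalIdeal R).spanFinrank := by
  have hloc : IsLocalHom (Ideal.Quotient.mk I) := .of_surjective _ Ideal.Quotient.mk_surjective
  have hcm : (maximalIdeal (R ⧸ I)).comap (Ideal.Quotient.mk I) = maximalIdeal R :=
    ((IsLocalRing.local_hom_TFAE (Ideal.Quotient.mk I)).out 0 4).mp hloc
  have hmm : (maximalIdeal R).map (Ideal.Quotient.mk I) = maximalIdeal (R ⧸ I) := by
    rw [← hcm, Ideal.map_comap_of_surjective _ Ideal.Quotient.mk_surjective]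
  have hmem : ∀ x : maximalIdeal R, (maximalIdeal R).toCotangent x ∈ V ↔
      (x : R) ∈ I ⊔ maximalIdeal R ^ 2 := by
    intro x
    have h1 : V.restrictScalars R = Submodule.map (maximalIdeal R).toCotangent
        (Submodule.comap (Submodule.subtype (maximalIdeal R)) I) := by
      rw [hV, Submodule.restrictScalars_span _ _ (by exact residue_surjective)]
      have h2 : {c | ∃ x : maximalIdeal R, (x : R) ∈ I ∧ (maximalIdeal R).toCotangent x = c} =
          (Submodule.map (maximalIdeal R).toCotangent
            (Submodule.comap (Submodule.subtype (maximalIdeal R)) I) :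
              Set (maximalIdeal R).Cotangent) := by
        ext c
        simp
      exact (congrArg (Submodule.span R) h2).trans (Submodule.span_eq _)
    rw [← Submodule.restrictScalars_mem R, h1, Submodule.mem_sup]
    constructor
    · rintro ⟨y, hy, hxy⟩
      refine ⟨y, hy, x - y, (Ideal.toCotangent_eq _).mp hxy.symm, by ring⟩
    · rintro ⟨y, hy, z, hz, hyz⟩
      refine ⟨⟨y, hI hy⟩, hy, ?_⟩
      rw [Ideal.toCotangent_eq]
      have : y - x = - z := by rw [← hyz]; ring
      rw [this]
      exact neg_mem hz
  let g := Ideal.mapCotangent (maximalIdeal R) (maximalIdeal (R ⧸ I)) (Ideal.Quotient.mkₐ R I)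
    hcm.ge
  have hg : ∀ x : maximalIdeal R, g ((maximalIdeal R).toCotangent x) =
      (maximalIdeal (R ⧸ I)).toCotangent ⟨Ideal.Quotient.mk I x, hcm.ge x.2⟩ := fun x => by
    exact Ideal.mapCotangent_toCotangent _ _ _ _ x
  have hgs : Function.Surjective g := by
    intro y
    obtain ⟨⟨y, hy⟩, rfl⟩ := Ideal.toCotangent_surjective _ y
    obtain ⟨x, rfl⟩ := Ideal.Quotient.mk_surjective y
    exact ⟨(maximalIdeal R).toCotangent ⟨x, hcm.le hy⟩, hg _⟩
  have hker : ∀ c, g c = 0 ↔ c ∈ V := by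
    intro c
    obtain ⟨x, rfl⟩ := Ideal.toCotangent_surjective _ c
    rw [hmem, hg, Ideal.toCotangent_eq_zero]
    change (Ideal.Quotient.mk I) x ∈ _ ↔ _
    rw [← hmm, ← Ideal.map_pow]
    rw [← Ideal.mem_comap, Ideal.comap_map_of_surjective _ Ideal.Quotient.mk_surjective,
      ← RingHom.ker_eq_comap_bot, Ideal.mk_ker, sup_comm]
  let j0 : (CotangentSpace R ⧸ V) →+ CotangentSpace (R ⧸ I) :=
    QuotientAddGroup.lift V.toAddSubgroup g.toAddMonoidHom (fun c hc => (hker c).mpr hc)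
  have hj0 : ∀ c, j0 (Submodule.Quotient.mk c) = g c := fun c => rfl
  have hj0b : Function.Bijective j0 := by
    constructor
    · rw [injective_iff_map_eq_zero]
      intro c hc
      obtain ⟨c, rfl⟩ := Submodule.Quotient.mk_surjective _ c
      rw [hj0, hker] at hc
      simpa using hc
    · intro y
      obtain ⟨x, hx⟩ := hgs y
      exact ⟨Submodule.Quotient.mk x, hx⟩
  let i : ResidueField R →+* ResidueField (R ⧸ I) := ResidueField.map (Ideal.Quotient.mk I)
  have hi : Function.Bijective i := by
    refine ⟨i.injective, ?_⟩
    intro y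
    obtain ⟨y, rfl⟩ := residue_surjective y
    obtain ⟨x, rfl⟩ := Ideal.Quotient.mk_surjective y
    exact ⟨residue R x, ResidueField.map_residue _ _⟩
  have hr : Module.finrank (ResidueField R) (CotangentSpace R ⧸ V) =
      Module.finrank (ResidueField (R ⧸ I)) (CotangentSpace (R ⧸ I)) := by
    have := lift_rank_eq_of_equiv_equiv (i : ResidueField R → ResidueField (R ⧸ I))
      (AddEquiv.ofBijective j0 hj0b) hi (by
        intro r m
        obtain ⟨r, rfl⟩ := residue_surjective r
        obtain ⟨c, rfl⟩ := Submodule.Quotient.mk_surjective _ m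
        change g (r • c) = (Ideal.Quotient.mk I r) • g c
        rw [map_smul]
        rfl)
    simpa [Module.finrank] using congrArg Cardinal.toNat this
  rw [spanFinrank_maximalIdeal_eq_finrank_cotangentSpace,
    spanFinrank_maximalIdeal_eq_finrank_cotangentSpace, ← hr]
  exact Submodule.finrank_quotient_add_finrank V


theorem aux_quot_local {R : Type*} [CommRing R] [IsLocalRing R] (I : Ideal R)
    (hI : I ≤ maximalIdeal R) : IsLocalRing (R ⧸ I) := by
  have : Nontrivial (R ⧸ I) := Ideal.Quotient.nontrivial_iff.mpr
    (fun h => (maximalIdeal.isMaximal R).ne_top (top_le_iff.mp (h ▸ hI)))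
  exact .of_surjective' (Ideal.Quotient.mk I) Ideal.Quotient.mk_surjective

/-- Cutting by one element outside the square. -/
theorem aux_edim_cut {R : Type*} [CommRing R] [IsLocalRing R] [IsNoetherianRing R]
    (x : R) (hx : x ∈ maximalIdeal R) (hx2 : x ∉ maximalIdeal R ^ 2)
    [IsLocalRing (R ⧸ Ideal.span {x})] :
    (maximalIdeal (R ⧸ Ideal.span {x})).spanFinrank + 1 = (maximalIdeal R).spanFinrank := by
  rw [← aux_edim_quot (Ideal.span {x}) ((Ideal.span_singleton_le_iff_mem _).mpr hx)
    (Submodule.span (ResidueField R) {(maximalIdeal R).toCotangent ⟨x, hx⟩}) ?_]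
  · congr 1
    refine (finrank_span_singleton ?_).symm
    rwa [Ne, Ideal.toCotangent_eq_zero]
  · apply le_antisymm
    · apply Submodule.span_mono
      rintro _ rfl
      exact ⟨⟨x, hx⟩, Ideal.mem_span_singleton_self x, rfl⟩
    · rw [Submodule.span_le]
      rintro _ ⟨⟨y, hy⟩, hyI, rfl⟩
      obtain ⟨a, rfl⟩ := Ideal.mem_span_singleton'.mp hyI
      have : (maximalIdeal R).toCotangent ⟨a * x, hy⟩ =
          a • (maximalIdeal R).toCotangent ⟨x, hx⟩ := by
        rw [← map_smul]; rfl
      rw [this]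
      exact Submodule.smul_of_tower_mem _ a (Submodule.mem_span_singleton_self _)

theorem aux_edim_sq {R : Type*} [CommRing R] [IsLocalRing R] [IsNoetherianRing R]
    (J : Ideal R) (hJ : J ≤ maximalIdeal R ^ 2) [IsLocalRing (R ⧸ J)] :
    (maximalIdeal (R ⧸ J)).spanFinrank = (maximalIdeal R).spanFinrank := by
  rw [← aux_edim_quot J (hJ.trans (Ideal.pow_le_self two_ne_zero)) ⊥ ?_]
  · simp
  · symm
    rw [Submodule.span_eq_bot]
    rintro _ ⟨y, hyI, rfl⟩
    rw [Ideal.toCotangent_eq_zero]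
    exact hJ hyI

theorem aux_dim_nat (R : Type*) [CommRing R] [IsLocalRing R] [IsNoetherianRing R] :
    ∃ d : ℕ, ringKrullDim R = d := by
  have h1 := ringKrullDim_le_spanFinrank_maximalIdeal R
  have h2 := ringKrullDim_nonneg_of_nontrivial (R := R)
  obtain ⟨a, ha⟩ := WithBot.ne_bot_iff_exists.mp
    (show ringKrullDim R ≠ ⊥ from fun h => by simp [h] at h2)
  rw [← ha] at h1 ⊢
  have h3 : a ≤ ((maximalIdeal R).spanFinrank : ℕ∞) := by exact_mod_cast h1
  obtain ⟨n, hn⟩ := ENat.ne_top_iff_exists.mp (ne_top_of_le_ne_top (ENat.coe_ne_top _) h3)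
  exact ⟨n, by rw [← hn]; rfl⟩

open Pointwise in
theorem aux_reg_cut {R : Type*} [CommRing R] [IsRegularLocalRing R]
    (x : R) (hx : x ∈ maximalIdeal R) (hx2 : x ∉ maximalIdeal R ^ 2) :
    IsRegularLocalRing (R ⧸ Ideal.span {x}) ∧
      (∀ n : ℕ, (maximalIdeal R).spanFinrank = n + 1 → ∀ [IsLocalRing (R ⧸ Ideal.span {x})],
        (maximalIdeal (R ⧸ Ideal.span {x})).spanFinrank = n) := by
  have := aux_quot_local (Ideal.span {x}) ((Ideal.span_singleton_le_iff_mem _).mpr hx)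
  have h := aux_edim_cut x hx hx2
  constructor
  · apply IsRegularLocalRing.of_spanFinrank_maximalIdeal_le
    have h1 := (isRegularLocalRing_iff R).mp ‹_›
    have h2 := ringKrullDim_le_ringKrullDim_quotSMulTop_succ hx
    have h3 : Ideal.span {x} = x • (⊤ : Ideal R) := by
      simp [← Submodule.ideal_span_singleton_smul]
    rw [← h3, ← h1, ← h] at h2
    push_cast at h2
    obtain ⟨d, hd⟩ := aux_dim_nat (R ⧸ Ideal.span {x})
    rw [hd] at h2 ⊢
    norm_cast at h2 ⊢
    omega
  · intro n hn _
    have := aux_edim_cut x hx hx2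
    omega

theorem aux_reg_domain (n : ℕ) : ∀ (R : Type*) [CommRing R] [IsRegularLocalRing R],
    (maximalIdeal R).spanFinrank = n → IsDomain R := by
  induction n with
  | zero =>
    intro R _ _ h
    have : maximalIdeal R = ⊥ := (Submodule.spanFinrank_eq_zero_iff_eq_bot
      (maximalIdeal R).fg_of_isNoetherianRing).mp h
    exact (isField_iff_maximalIdeal_eq.mpr this).isDomain
  | succ n ih =>
    intro R _ _ h
    have hfin : (minimalPrimes R).Finite := minimalPrimes.finite_of_isNoetherianRing R
    have hdim := (isRegularLocalRing_iff R).mp ‹_›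
    have hex : ∃ x ∈ maximalIdeal R, x ∉ maximalIdeal R ^ 2 ∧ ∀ p ∈ minimalPrimes R, x ∉ p := by
      by_contra! hcon
      have := (Ideal.subset_union_prime (s := insert (maximalIdeal R ^ 2) hfin.toFinset)
        (f := id) (maximalIdeal R ^ 2) (maximalIdeal R ^ 2) (by
          intro i hi h1 _
          simp only [Finset.mem_insert, h1, Set.Finite.mem_toFinset, false_or] at hi
          exact hi.1.1) (I := maximalIdeal R)).mp (by
          intro x hx
          by_cases h2 : x ∈ maximalIdeal R ^ 2
          · simp [h2]
          · obtain ⟨p, hp, hxp⟩ := hcon x hx h2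
            simp only [Set.mem_iUnion]
            exact ⟨p, by simp [hp], hxp⟩)
      obtain ⟨i, hi, hle⟩ := this
      simp only [Finset.mem_insert, Set.Finite.mem_toFinset] at hi
      rcases hi with rfl | hi
      · have : maximalIdeal R = ⊥ := by
          apply Submodule.eq_bot_of_le_smul_of_le_jacobson_bot (maximalIdeal R) _
            (maximalIdeal R).fg_of_isNoetherianRing
          · simpa [pow_two] using hle
          · exact maximalIdeal_le_jacobson _
        rw [this] at h
        simp at h
      · have hi' : i.IsPrime := hi.1.1
        have hm : i = maximalIdeal R := le_antisymm (le_maximalIdeal hi'.ne_top) hle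
        have h0 : i.height = 0 := Ideal.height_eq_zero_iff.mpr hi
        have := maximalIdeal_height_eq_ringKrullDim (R := R)
        rw [← hm, h0, ← hdim, h] at this
        norm_cast at this
    obtain ⟨x, hx, hx2, hxp⟩ := hex
    obtain ⟨hreg, he⟩ := aux_reg_cut x hx hx2
    have hdom := ih (R ⧸ Ideal.span {x}) (he n h)
    have hprime : (Ideal.span {x}).IsPrime := (Ideal.Quotient.isDomain_iff_prime _).mp hdom
    obtain ⟨p, hp, hpx⟩ := Ideal.exists_minimalPrimes_le (bot_le : ⊥ ≤ Ideal.span {x})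
    have hpp : p.IsPrime := hp.1.1
    have hxnp : x ∉ p := hxp p hp
    have : p = ⊥ := by
      apply Submodule.eq_bot_of_le_smul_of_le_jacobson_bot (maximalIdeal R) _
        p.fg_of_isNoetherianRing
      · intro y hy
        obtain ⟨a, rfl⟩ := Ideal.mem_span_singleton'.mp (hpx hy)
        have ha : a ∈ p := (hpp.mem_or_mem hy).resolve_right hxnp
        rw [mul_comm]
        exact Submodule.smul_mem_smul hx ha
      · exact maximalIdeal_le_jacobson _
    subst this
    exact IsDomain.of_bot_isPrime R

open RingTheory.Sequence in
open Pointwise in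
theorem aux_reg_seq (n : ℕ) : ∀ (R : Type*) [CommRing R] [IsRegularLocalRing R] (J : Ideal R)
    [IsRegularLocalRing (R ⧸ J)], (maximalIdeal R).spanFinrank = n →
    ∃ rs : List R, IsWeaklyRegular R rs ∧ Ideal.ofList rs = J := by
  induction n with
  | zero =>
    intro R _ _ J _ h
    have hm : maximalIdeal R = ⊥ := (Submodule.spanFinrank_eq_zero_iff_eq_bot
      (maximalIdeal R).fg_of_isNoetherianRing).mp h
    have hJ : J ≤ maximalIdeal R :=
      le_maximalIdeal (Ideal.Quotient.nontrivial_iff.mp inferInstance)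
    rw [hm, le_bot_iff] at hJ
    exact ⟨[], IsWeaklyRegular.nil R R, by simp [hJ]⟩
  | succ n ih =>
    intro R _ _ J _ h
    have hJ : J ≤ maximalIdeal R :=
      le_maximalIdeal (Ideal.Quotient.nontrivial_iff.mp inferInstance)
    have hdom := aux_reg_domain _ R h
    by_cases hJ0 : J = ⊥
    · exact ⟨[], IsWeaklyRegular.nil R R, by simp [hJ0]⟩
    have hex : ∃ x ∈ J, x ∉ maximalIdeal R ^ 2 := by
      by_contra! hcon
      have h1 := aux_edim_sq J hcon
      have h2 := (isRegularLocalRing_iff R).mp ‹_›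
      have h3 := (isRegularLocalRing_iff (R ⧸ J)).mp ‹_›
      obtain ⟨a, haJ, ha⟩ := Submodule.exists_mem_ne_zero_of_ne_bot hJ0
      have h4 := ringKrullDim_succ_le_of_surjective (Ideal.Quotient.mk J)
        Ideal.Quotient.mk_surjective (r := a) (mem_nonZeroDivisors_of_ne_zero ha)
        (by simpa [Ideal.Quotient.eq_zero_iff_mem] using haJ)
      rw [← h2, ← h3, h1] at h4
      norm_cast at h4
      omega
    obtain ⟨x, hxJ, hx2⟩ := hex
    have hx := hJ hxJ
    have hx0 : x ≠ 0 := fun h0 => hx2 (h0 ▸ zero_mem _)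
    obtain ⟨hreg, he⟩ := aux_reg_cut x hx hx2
    have hle : Ideal.span {x} ≤ J := (Ideal.span_singleton_le_iff_mem _).mpr hxJ
    have : IsRegularLocalRing ((R ⧸ Ideal.span {x}) ⧸ J.map (Ideal.Quotient.mk (Ideal.span {x}))) :=
      IsRegularLocalRing.of_ringEquiv (DoubleQuot.quotQuotEquivQuotOfLE hle).symm
    obtain ⟨rs, hrs, hrsJ⟩ := ih (R ⧸ Ideal.span {x})
      (J.map (Ideal.Quotient.mk (Ideal.span {x}))) (he n h)
    obtain ⟨ts, rfl⟩ : ∃ ts : List R, ts.map (Ideal.Quotient.mk (Ideal.span {x})) = rs :=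
      (List.map_surjective_iff.mpr Ideal.Quotient.mk_surjective) rs
    refine ⟨x :: ts, ?_, ?_⟩
    · rw [isWeaklyRegular_cons_iff]
      refine ⟨Module.Flat.isSMulRegular_of_nonZeroDivisors (mem_nonZeroDivisors_of_ne_zero hx0), ?_⟩
      have h1 : IsWeaklyRegular (R ⧸ Ideal.span {x}) ts :=
        (isWeaklyRegular_map_algebraMap_iff (R ⧸ Ideal.span {x}) (R ⧸ Ideal.span {x}) ts).mp hrs
      have h3 : Ideal.span {x} = x • (⊤ : Ideal R) := by
        simp [← Submodule.ideal_span_singleton_smul]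
      exact ((Submodule.quotEquivOfEq _ _ h3).isWeaklyRegular_congr ts).mp h1
    · rw [← Ideal.map_ofList] at hrsJ
      have := congrArg (Ideal.comap (Ideal.Quotient.mk (Ideal.span {x}))) hrsJ
      rw [Ideal.comap_map_of_surjective _ Ideal.Quotient.mk_surjective,
        Ideal.comap_map_of_surjective _ Ideal.Quotient.mk_surjective,
        ← RingHom.ker_eq_comap_bot, Ideal.mk_ker, sup_eq_left.mpr hle] at this
      rw [Ideal.ofList_cons, sup_comm, this]

open RingTheory.Sequence in
/-- Dimension drop along a flat local homomorphism. -/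
theorem aux_dim_drop {R R' : Type*} [CommRing R] [CommRing R'] [IsRegularLocalRing R]
    [IsLocalRing R'] [IsNoetherianRing R'] [Algebra R R'] [Module.Flat R R']
    [IsLocalHom (algebraMap R R')] (J : Ideal R) [IsRegularLocalRing (R ⧸ J)] :
    ringKrullDim (R' ⧸ J.map (algebraMap R R')) + J.spanFinrank ≤ ringKrullDim R' := by
  obtain ⟨rs, hrs, rfl⟩ := aux_reg_seq _ R J rfl
  have hJ : Ideal.ofList rs ≤ maximalIdeal R :=
    le_maximalIdeal (Ideal.Quotient.nontrivial_iff.mp inferInstance)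
  have h1 := hrs.of_flat (S := R')
  have h2 : IsRegular R' (rs.map (algebraMap R R')) := by
    refine (IsLocalRing.isRegular_iff_isWeaklyRegular_of_subset_maximalIdeal ?_).mpr h1
    intro r hr
    obtain ⟨t, ht, rfl⟩ := List.mem_map.mp hr
    have : t ∈ maximalIdeal R := hJ (Ideal.subset_span ht)
    exact map_nonunit _ _ this
  rw [← ringKrullDim_add_length_eq_ringKrullDim_of_isRegular _ h2, Ideal.map_ofList]
  gcongr
  rw [List.length_map]
  refine (Submodule.spanFinrank_span_le_ncard_of_finite (List.finite_toSet rs)).trans ?_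
  classical
  rw [← List.coe_toFinset, Set.ncard_coe_finset]
  exact List.toFinset_card_le rs

theorem aux_h1 (K L : Type) [Field K] [Field L] [Algebra K L] :
    Algebra.FormallySmooth K L ↔ ∀ f : MvPolynomial L K, MvPolynomial.aeval (id : L → L) f = 0 →
      (∀ i, MvPolynomial.aeval (id : L → L) (MvPolynomial.pderiv i f) = 0) →
      f ∈ (RingHom.ker (MvPolynomial.aeval (R := K) (id : L → L))) ^ 2 := by
  rw [Algebra.formallySmooth_iff]
  let G := Algebra.Generators.self K L
  have h0 : Subsingleton (Algebra.H1Cotangent K L) ↔ Function.Injective G.toExtension.cotangentComplex :=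
    G.toExtension.subsingleton_h1Cotangent
  have hk : G.toExtension.ker = RingHom.ker (MvPolynomial.aeval (R := K) (id : L → L)) := rfl
  have : Module.Projective L Ω[L⁄K] := inferInstance
  rw [and_iff_right this, h0, injective_iff_map_eq_zero]
  constructor
  · intro H f hf hd
    have := H (Algebra.Extension.Cotangent.mk ⟨f, hf⟩) ?_
    · rwa [Algebra.Extension.Cotangent.mk_eq_zero_iff] at this
    · rw [Algebra.Extension.cotangentComplex_mk]
      apply G.cotangentSpaceBasis.repr.injective
      ext i
      erw [Algebra.Generators.cotangentSpaceBasis_repr_one_tmul]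
      exact hd i
  · intro H x hx
    obtain ⟨⟨f, hf⟩, rfl⟩ := Algebra.Extension.Cotangent.mk_surjective x
    rw [Algebra.Extension.Cotangent.mk_eq_zero_iff]
    refine H f hf fun i => ?_
    rw [Algebra.Extension.cotangentComplex_mk] at hx
    have h2 := congrArg (fun z => G.cotangentSpaceBasis.repr z i) hx
    simp only [map_zero] at h2
    erw [Algebra.Generators.cotangentSpaceBasis_repr_one_tmul] at h2
    exact h2

theorem aux_fs (K L : Type) [Field K] [Field L] [Algebra K L] [PerfectField K] :
    Algebra.FormallySmooth K L := by
  rw [aux_h1]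
  intro f hf hd
  let L0 : IntermediateField K L := IntermediateField.adjoin K (f.vars : Set L)
  have : Algebra.EssFiniteType K L0 := 
    IntermediateField.essFiniteType_iff.mpr ⟨f.vars, rfl⟩
  have h0 : Algebra.FormallySmooth K L0 := inferInstance
  rw [aux_h1] at h0
  obtain ⟨g, hg⟩ := MvPolynomial.exists_rename_eq_of_vars_subset_range f (Subtype.val : L0 → L)
    Subtype.val_injective (by
      intro x hx
      exact ⟨⟨x, IntermediateField.subset_adjoin _ _ hx⟩, rfl⟩)
  have key : ∀ h : MvPolynomial L0 K, MvPolynomial.aeval (id : L → L) (MvPolynomial.rename Subtype.val h)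
      = ((MvPolynomial.aeval (id : L0 → L0) h : L0) : L) := by
    intro h
    rw [MvPolynomial.aeval_rename]
    have := MvPolynomial.aeval_algebraMap_apply L (id : L0 → L0) h
    exact this
  have h1 := h0 g (by
      have := key g
      rw [hg, hf] at this
      exact_mod_cast this.symm) (by
      intro i
      have := key (MvPolynomial.pderiv i g)
      rw [← MvPolynomial.pderiv_rename Subtype.val_injective, hg, hd] at this
      exact_mod_cast this.symm)
  rw [← hg]
  have h2 := Ideal.mem_map_of_mem (MvPolynomial.rename (R := K) (Subtype.val : L0 → L)) h1
  rw [Ideal.map_pow] at h2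
  refine Ideal.pow_right_mono ?_ 2 h2
  rw [Ideal.map_le_iff_le_comap]
  intro h hh
  rw [Ideal.mem_comap, RingHom.mem_ker, key, hh]
  rfl
theorem aux_der (p : ℕ) [Fact p.Prime] (R : Type) [CommRing R] [IsLocalRing R] [CharP R p] :
    ∃ D : Derivation ℤ R (CotangentSpace R), ∀ x : maximalIdeal R,
      D x = (maximalIdeal R).toCotangent x := by
  let _ : Algebra (ZMod p) R := ZMod.algebra R p
  have : Algebra.FormallySmooth (ZMod p) (ResidueField R) := aux_fs _ _
  let m := maximalIdeal R
  let g : R ⧸ m ^ 2 →ₐ[ZMod p] R ⧸ m := Ideal.Quotient.factorₐ _ (Ideal.pow_le_self two_ne_zero)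
  have hgm : ∀ x, g (Ideal.Quotient.mk _ x) = residue R x := fun x => rfl
  have hg : Function.Surjective g := Ideal.Quotient.factor_surjective (Ideal.pow_le_self two_ne_zero)
  have hker : ∀ y, g y = 0 → ∃ c : CotangentSpace R, m.cotangentToQuotientSquare c = y := by
    intro y hy
    obtain ⟨x, rfl⟩ := Ideal.Quotient.mk_surjective y
    rw [hgm] at hy
    exact ⟨m.toCotangent ⟨x, (residue_eq_zero_iff x).mp hy⟩, rfl⟩
  have hprod : ∀ y (c : CotangentSpace R), g y = 0 → y * m.cotangentToQuotientSquare c = 0 := by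
    intro y c hy
    obtain ⟨x, rfl⟩ := Ideal.Quotient.mk_surjective y
    obtain ⟨z, rfl⟩ := m.toCotangent_surjective c
    change Ideal.Quotient.mk _ x * Ideal.Quotient.mk _ (z : R) = 0
    rw [← map_mul, Ideal.Quotient.eq_zero_iff_mem, pow_two]
    exact Ideal.mul_mem_mul ((residue_eq_zero_iff x).mp hy) z.2
  have hnil : IsNilpotent (RingHom.ker g) := by
    refine ⟨2, ?_⟩
    rw [Ideal.zero_eq_bot, eq_bot_iff, pow_two (RingHom.ker g), Ideal.mul_le]
    intro a ha b hb
    obtain ⟨c, rfl⟩ := hker b hb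
    exact hprod _ _ ha
  let f : ResidueField R →ₐ[ZMod p] R ⧸ m := AlgHom.id _ _
  let s := Algebra.FormallySmooth.liftOfSurjective f g hg hnil
  have hs : ∀ x, g (s x) = x := Algebra.FormallySmooth.liftOfSurjective_apply f g hg hnil
  have hex : ∀ x : R, ∃ c : CotangentSpace R,
      m.cotangentToQuotientSquare c = Ideal.Quotient.mk _ x - s (residue R x) := by
    intro x
    apply hker
    exact (map_sub g _ _).trans (by rw [hs, hgm]; exact sub_self (residue R _))
  choose d hd using hex
  have hinj := m.cotangentToQuotientSquare_injective
  let d' : R →+ CotangentSpace R := AddMonoidHom.mk' d (by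
    intro a b
    apply hinj
    rw [map_add]
    simp only [hd, map_add]
    ring)
  refine ⟨Derivation.mk' d'.toIntLinearMap ?_, ?_⟩
  · intro a b
    change d (a * b) = a • d b + b • d a
    apply hinj
    rw [map_add, map_smul, map_smul]
    have h1 := hprod (Ideal.Quotient.mk _ b - s (residue R b)) (d a) (by
      exact (map_sub g _ _).trans (by rw [hs, hgm]; exact sub_self (residue R _)))
    rw [Algebra.smul_def, Algebra.smul_def]
    change _ = Ideal.Quotient.mk _ a * _ + Ideal.Quotient.mk _ b * _
    rw [hd] at h1
    simp only [hd, map_mul]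
    linear_combination -h1
  · intro x
    change d x = _
    apply hinj
    rw [hd]
    have : residue R (x : R) = 0 := (residue_eq_zero_iff _).mpr x.2
    rw [this, map_zero, sub_zero]
    rfl

theorem aux_der' (p : ℕ) [Fact p.Prime] (k R R' : Type) [Field k] [CommRing R] [CommRing R']
    [IsLocalRing R'] [CharP R' p] [Algebra k R] [Algebra R R'] [Algebra k R'] [IsScalarTower k R R']
    (hp : ∀ a : k, ∃ b : R', b ^ p = algebraMap k R' a) :
    ∃ D : Derivation k R (CotangentSpace R'),
      ∀ (x : R) (hx : algebraMap R R' x ∈ maximalIdeal R'),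
        D x = (maximalIdeal R').toCotangent ⟨algebraMap R R' x, hx⟩ := by
  obtain ⟨D, hD⟩ := aux_der p R'
  have hk : ∀ a : k, D (algebraMap k R' a) = 0 := by
    intro a
    obtain ⟨b, hb⟩ := hp a
    rw [← hb, Derivation.leibniz_pow, ← Nat.cast_smul_eq_nsmul R', CharP.cast_eq_zero, zero_smul]
  refine ⟨Derivation.mk' { toFun := fun x => D (algebraMap R R' x), map_add' := by simp, map_smul' := ?_ } ?_, ?_⟩
  · intro a x
    rw [Algebra.smul_def, map_mul, Derivation.leibniz, ← IsScalarTower.algebraMap_apply, hk,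
      smul_zero, add_zero, algebraMap_smul]
    rfl
  · intro a b
    simp
  · intro x hx
    exact hD ⟨_, hx⟩

theorem aux_tower (R R' : Type) [CommRing R] [CommRing R'] [IsLocalRing R'] [Algebra R R'] :
    IsScalarTower R (ResidueField R') (CotangentSpace R') := by
  refine ⟨fun r x y => ?_⟩
  rw [← algebraMap_smul R' r x, smul_assoc, algebraMap_smul]

theorem aux_theta {R R' : Type} [CommRing R] [CommRing R'] [IsLocalRing R']
    [IsNoetherianRing R'] [Algebra R R'] (J : Ideal R)
    (hJ : J.map (algebraMap R R') ≤ maximalIdeal R') [IsLocalRing (R' ⧸ J.map (algebraMap R R'))] :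
    ∃ θ : ResidueField R' ⊗[R] J →ₗ[ResidueField R'] CotangentSpace R',
      (∀ a (x : J), θ (a ⊗ₜ x) = a • (maximalIdeal R').toCotangent
        ⟨algebraMap R R' x, hJ (Ideal.mem_map_of_mem _ x.2)⟩) ∧
      (maximalIdeal (R' ⧸ J.map (algebraMap R R'))).spanFinrank +
        Module.finrank (ResidueField R') (LinearMap.range θ) = (maximalIdeal R').spanFinrank := by
  have := aux_tower R R'
  let l : J →ₗ[R] CotangentSpace R' :=
    { toFun := fun x => (maximalIdeal R').toCotangent
        ⟨algebraMap R R' x, hJ (Ideal.mem_map_of_mem _ x.2)⟩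
      map_add' := by
        intro x y
        rw [← map_add]
        congr 1
        ext
        simp
      map_smul' := by
        intro r x
        rw [RingHom.id_apply, ← algebraMap_smul R' r
          ((maximalIdeal R').toCotangent ⟨algebraMap R R' x, _⟩), ← map_smul]
        congr 1
        ext
        simp only [SetLike.mk_smul_mk, smul_eq_mul, SetLike.val_smul, map_mul] }
  refine ⟨LinearMap.liftBaseChange _ l, fun a x => LinearMap.liftBaseChange_tmul _ _ _ _, ?_⟩
  apply aux_edim_quot _ hJ
  rw [LinearMap.range_liftBaseChange]
  apply le_antisymm
  · apply Submodule.span_mono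
    rintro _ ⟨x, rfl⟩
    exact ⟨_, Ideal.mem_map_of_mem _ x.2, rfl⟩
  · rw [Submodule.span_le]
    rintro _ ⟨⟨x, hx⟩, hxJ, rfl⟩
    simp only at hxJ
    change _ ∈ Submodule.span _ _
    have hxJ2 := hxJ
    rw [Ideal.map] at hxJ2
    induction hxJ2 using Submodule.span_induction with
    | mem x h =>
      obtain ⟨y, hy, rfl⟩ := h
      exact Submodule.subset_span ⟨⟨y, hy⟩, rfl⟩
    | zero => 
      convert Submodule.zero_mem _
      exact map_zero _
    | add x y hx' hy' h1 h2 =>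
      have := Submodule.add_mem _ (h1 (hJ hx') hx') (h2 (hJ hy') hy')
      rw [← map_add] at this
      exact this
    | smul a x hx' h1 =>
      have := Submodule.smul_mem _ (residue R' a) (h1 (hJ hx') hx')
      have h3 : (residue R' a) • ((maximalIdeal R').toCotangent ⟨x, hJ hx'⟩) = 
         (maximalIdeal R').toCotangent (a • ⟨x, hJ hx'⟩) := by
        rw [map_smul]
        exact algebraMap_smul (ResidueField R') a _
      rw [h3] at this
      exact this

theorem aux_theta_inj {R κ M : Type} [CommRing R] [Field κ] [Algebra R κ] [AddCommGroup M]
    [Module κ M] (J : Ideal R) (hJ : J.FG) (θ : κ ⊗[R] J →ₗ[κ] M)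
    (h : J.spanFinrank ≤ Module.finrank κ (LinearMap.range θ)) : Function.Injective θ := by
  have : Module.Finite R J := Module.Finite.iff_fg.mpr hJ
  have h1 : Module.finrank κ (κ ⊗[R] J) ≤ J.spanFinrank := by
    rw [Module.finrank_eq_spanFinrank_of_free]
    exact TensorProduct.spanFinrank_top_le_of_fg J hJ
  have h2 := LinearMap.finrank_range_add_finrank_ker θ
  rw [← LinearMap.ker_eq_bot]
  apply Submodule.finrank_eq_zero.mp
  omega

theorem aux_local8 (p : ℕ) [Fact p.Prime] (k R R' S : Type) [Field k] [CommRing R] [CommRing R']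
    [CommRing S] [IsRegularLocalRing R] [IsLocalRing R'] [IsNoetherianRing R']
    [IsRegularLocalRing S] [CharP R' p] [Algebra k R] [Algebra R R'] [Algebra k R']
    [IsScalarTower k R R'] [Algebra k S] [Algebra R S] [IsScalarTower k R S]
    [Module.Flat R R'] [IsLocalHom (algebraMap R R')]
    [Algebra.FormallySmooth k R] [Module.Free R Ω[R⁄k]] [Module.Finite R Ω[R⁄k]]
    (hsurj : Function.Surjective (algebraMap R S))
    [IsRegularLocalRing (R' ⧸ (RingHom.ker (algebraMap R S)).map (algebraMap R R'))]
    (hp : ∀ a : k, ∃ b : R', b ^ p = algebraMap k R' a) : Algebra.FormallySmooth k S := by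
  set J := RingHom.ker (algebraMap R S) with hJdef
  have hJm : J ≤ maximalIdeal R := le_maximalIdeal (RingHom.ker_ne_top _)
  have hJ : J.map (algebraMap R R') ≤ maximalIdeal R' := by
    rw [Ideal.map_le_iff_le_comap]
    intro x hx
    have := hJm hx
    rw [Ideal.mem_comap, mem_maximalIdeal, mem_nonunits_iff]
    intro hu
    exact this (isUnit_of_map_unit (algebraMap R R') x hu)
  have : IsRegularLocalRing (R ⧸ J) :=
    IsRegularLocalRing.of_ringEquiv (RingHom.quotientKerEquivOfSurjective hsurj).symm
  have hdrop := aux_dim_drop (R' := R') J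
  obtain ⟨θ, hθ, hrank⟩ := aux_theta (R' := R') J hJ
  have hfg : J.FG := IsNoetherian.noetherian J
  have hθi : Function.Injective θ := by
    apply aux_theta_inj J hfg
    have h1 := ringKrullDim_le_spanFinrank_maximalIdeal R'
    have h2 := IsRegularLocalRing.spanFinrank_maximalIdeal (R := R' ⧸ J.map (algebraMap R R'))
    rw [← h2] at hdrop
    have h3 := hdrop.trans h1
    have h4 : (maximalIdeal (R' ⧸ J.map (algebraMap R R'))).spanFinrank + J.spanFinrank ≤
      (maximalIdeal R').spanFinrank := by exact_mod_cast h3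
    omega
  obtain ⟨D, hD⟩ := aux_der' p k R R' hp
  have := aux_tower R R'
  let φ : S →+* ResidueField R' := RingHom.liftOfSurjective (algebraMap R S) hsurj
    ⟨algebraMap R (ResidueField R'), by
      intro x hx
      rw [RingHom.mem_ker, IsScalarTower.algebraMap_apply R R' (ResidueField R')]
      exact (residue_eq_zero_iff _).mpr (hJ (Ideal.mem_map_of_mem _ hx))⟩
  have hφ : ∀ x, φ (algebraMap R S x) = algebraMap R (ResidueField R') x := by
    intro x
    exact RingHom.liftOfRightInverse_comp_apply _ _ _ _ _
  let _ : Algebra S (ResidueField R') := φ.toAlgebra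
  have : IsScalarTower R S (ResidueField R') := IsScalarTower.of_algebraMap_eq (fun x => (hφ x).symm)
  rw [Algebra.FormallySmooth.iff_injective_cotangentComplexBaseChange R (ResidueField R') hsurj hfg]
  · let L : ResidueField R' ⊗[R] Ω[R⁄k] →ₗ[ResidueField R'] CotangentSpace R' :=
      LinearMap.liftBaseChange _ D.liftKaehlerDifferential
    have hcomp : L ∘ₗ KaehlerDifferential.cotangentComplexBaseChange k S R (ResidueField R') = θ := by
      ext x
      simp only [L, AlgebraTensorModule.curry_apply, curry_apply, LinearMap.coe_restrictScalars,
        LinearMap.comp_apply, hθ]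
      rw [KaehlerDifferential.cotangentComplexBaseChange_tmul, KaehlerDifferential.kerToTensor_apply,
        one_smul, one_smul, LinearMap.liftBaseChange_tmul, Derivation.liftKaehlerDifferential_comp_D,
        one_smul, hD]
    apply Function.Injective.of_comp (f := L)
    rw [← LinearMap.coe_comp, hcomp]
    exact hθi
  · intro x hx
    obtain ⟨y, rfl⟩ := hsurj x
    rw [RingHom.mem_ker]
    change φ _ = 0
    rw [hφ, IsScalarTower.algebraMap_apply R R' (ResidueField R')]
    refine (residue_eq_zero_iff _).mpr ?_
    rw [mem_maximalIdeal, mem_nonunits_iff]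
    intro hu
    exact hx ((isUnit_of_map_unit (algebraMap R R') y hu).map _)

theorem aux_local7 (k R S : Type) [Field k] [CommRing R]
    [CommRing S] [IsRegularLocalRing R] [IsLocalRing S]
    [Algebra k R] [Algebra k S] [Algebra R S] [IsScalarTower k R S]
    [Algebra.FormallySmooth k R] [Module.Free R Ω[R⁄k]] [Module.Finite R Ω[R⁄k]]
    (hsurj : Function.Surjective (algebraMap R S)) [Algebra.FormallySmooth k S] :
    IsRegularLocalRing S := by
  set J := RingHom.ker (algebraMap R S) with hJdef
  have hJm : J ≤ maximalIdeal R := le_maximalIdeal (RingHom.ker_ne_top _)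
  have hJJ : J.map (algebraMap R R) = J := Ideal.map_id J
  have hJ : J.map (algebraMap R R) ≤ maximalIdeal R := by rwa [hJJ]
  have hloc : IsLocalRing (R ⧸ J.map (algebraMap R R)) := aux_quot_local _ hJ
  obtain ⟨θ, hθ, hrank⟩ := aux_theta (R' := R) J hJ
  have hfg : J.FG := IsNoetherian.noetherian J
  have : Module.Finite R J := Module.Finite.iff_fg.mpr hfg
  let φ : S →+* ResidueField R := RingHom.liftOfSurjective (algebraMap R S) hsurj
    ⟨algebraMap R (ResidueField R), by
      intro x hx
      rw [RingHom.mem_ker]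
      exact (residue_eq_zero_iff _).mpr (hJm hx)⟩
  have hφ : ∀ x, φ (algebraMap R S x) = algebraMap R (ResidueField R) x := by
    intro x
    exact RingHom.liftOfRightInverse_comp_apply _ _ _ _ _
  let _ : Algebra S (ResidueField R) := φ.toAlgebra
  have : IsScalarTower R S (ResidueField R) := IsScalarTower.of_algebraMap_eq (fun x => (hφ x).symm)
  have hinj := (Algebra.FormallySmooth.iff_injective_cotangentComplexBaseChange (R := k) (S := S) R
    (ResidueField R) hsurj hfg (by
      intro x hx
      obtain ⟨y, rfl⟩ := hsurj x
      rw [RingHom.mem_ker]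
      change φ _ = 0
      rw [hφ]
      refine (residue_eq_zero_iff _).mpr ?_
      rw [mem_maximalIdeal, mem_nonunits_iff]
      intro hu
      exact hx (hu.map _))).mp inferInstance
  have hsm : ∀ (a : R) (ω : Ω[R⁄k]), a ∈ maximalIdeal R → (1 : ResidueField R) ⊗ₜ[R] (a • ω) = 0 := by
    intro a ω ha
    rw [← TensorProduct.smul_tmul, Algebra.smul_def, mul_one]
    have : algebraMap R (ResidueField R) a = 0 := (residue_eq_zero_iff _).mpr ha
    rw [this, TensorProduct.zero_tmul]
  have hsq : ∀ x ∈ maximalIdeal R ^ 2, (1 : ResidueField R) ⊗ₜ[R] (KaehlerDifferential.D k R x) = 0 := by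
    intro x hx
    rw [pow_two] at hx
    induction hx using Submodule.mul_induction_on' with
    | mem_mul_mem a ha b hb =>
      rw [Derivation.leibniz, TensorProduct.tmul_add, hsm _ _ ha, hsm _ _ hb, add_zero]
    | add x _ y _ h1 h2 => rw [map_add, TensorProduct.tmul_add, h1, h2, add_zero]
  have hθi : Function.Injective θ := by
    rw [injective_iff_map_eq_zero]
    intro z hz
    obtain ⟨x, rfl⟩ := TensorProduct.mk_surjective R J (ResidueField R) (residue_surjective) z
    simp only [TensorProduct.mk_apply] at hz ⊢
    rw [hθ, one_smul, Ideal.toCotangent_eq_zero] at hz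
    apply hinj
    rw [map_zero, KaehlerDifferential.cotangentComplexBaseChange_tmul,
      KaehlerDifferential.kerToTensor_apply, one_smul]
    exact hsq _ hz
  have h1 : Module.finrank (ResidueField R) (LinearMap.range θ) = J.spanFinrank := by
    rw [LinearMap.finrank_range_of_inj hθi, Module.finrank_eq_spanFinrank_of_free]
    exact TensorProduct.spanFinrank_top_eq_of_residueField J hfg
  have h2 := ringKrullDim_le_ringKrullDim_add_spanFinrank (R := R)
    (I := J.map (algebraMap R R)) (ne_top_of_le_ne_top (maximalIdeal.isMaximal R).ne_top hJ)
  have h2' : (J.map (algebraMap R R)).spanFinrank = J.spanFinrank := by rw [hJJ]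
  rw [h2'] at h2
  have h3 := IsRegularLocalRing.spanFinrank_maximalIdeal (R := R)
  have : IsRegularLocalRing (R ⧸ J.map (algebraMap R R)) := by
    apply IsRegularLocalRing.of_spanFinrank_maximalIdeal_le
    obtain ⟨d, hd⟩ := aux_dim_nat (R ⧸ J.map (algebraMap R R))
    rw [hd] at h2 ⊢
    rw [← h3] at h2
    have h4 : (maximalIdeal R).spanFinrank ≤ d + J.spanFinrank := by exact_mod_cast h2
    have h5 : (maximalIdeal (R ⧸ J.map (algebraMap R R))).spanFinrank ≤ d := by omega
    exact_mod_cast h5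
  exact IsRegularLocalRing.of_ringEquiv
    ((Ideal.quotEquivOfEq hJJ).trans (RingHom.quotientKerEquivOfSurjective hsurj))

theorem aux_G {P A : Type} [CommRing P] [CommRing A] (f : P →+* A) (hf : Function.Surjective f)
    (q : Ideal A) [q.IsPrime] :
    Function.Surjective (Localization.localRingHom (q.comap f) q f rfl) ∧
    RingHom.ker (Localization.localRingHom (q.comap f) q f rfl) =
      (RingHom.ker f).map (algebraMap P (Localization.AtPrime (q.comap f))) := by
  refine ⟨RingHom.surjective_localRingHom_of_surjective f hf q, ?_⟩
  refine IsLocalization.ker_map (M := (q.comap f).primeCompl) (T := q.primeCompl) _ f ?_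
  ext x
  constructor
  · rintro ⟨y, hy, rfl⟩
    exact hy
  · intro hx
    obtain ⟨y, rfl⟩ := hf x
    exact ⟨y, hx, rfl⟩

theorem aux_R (K : Type) [Field K] (n : ℕ) (q : Ideal (MvPolynomial (Fin n) K)) [q.IsPrime] :
    IsRegularLocalRing (Localization.AtPrime q) ∧ 
    Algebra.FormallySmooth K (Localization.AtPrime q) ∧
    Module.Free (Localization.AtPrime q) Ω[Localization.AtPrime q⁄K] ∧
    Module.Finite (Localization.AtPrime q) Ω[Localization.AtPrime q⁄K] := by
  have h0 : Algebra.FormallySmooth K (Localization.AtPrime q) :=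
    have : Algebra.FormallySmooth (MvPolynomial (Fin n) K) (Localization.AtPrime q) :=
      Algebra.FormallySmooth.of_isLocalization q.primeCompl
    Algebra.FormallySmooth.comp K (MvPolynomial (Fin n) K) _
  have h1 : Algebra.EssFiniteType K (Localization.AtPrime q) :=
    have : Algebra.EssFiniteType (MvPolynomial (Fin n) K) (Localization.AtPrime q) :=
      Algebra.EssFiniteType.of_isLocalization _ q.primeCompl
    Algebra.EssFiniteType.comp K (MvPolynomial (Fin n) K) _
  have h2 : Module.Finite (Localization.AtPrime q) Ω[Localization.AtPrime q⁄K] := inferInstance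
  have h3 : Module.Projective (Localization.AtPrime q) Ω[Localization.AtPrime q⁄K] := inferInstance
  refine ⟨inferInstance, h0, Module.free_of_flat_of_isLocalRing, h2⟩

theorem aux7 (K A : Type) [Field K] [CommRing A] [Algebra K A] [Algebra.Smooth K A] :
    IsRegularRing A := by
  have hft : Algebra.FiniteType K A := inferInstance
  have : IsNoetherianRing A := Algebra.FiniteType.isNoetherianRing K A
  obtain ⟨n, f, hf⟩ := Algebra.FiniteType.iff_quotient_mvPolynomial''.mp hft
  rw [isRegularRing_iff]
  intro q hq
  obtain ⟨h1, h2, h3, h4⟩ := aux_R K n (q.comap (f : MvPolynomial (Fin n) K →+* A))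
  have hG := aux_G (f : MvPolynomial (Fin n) K →+* A) hf q
  have h0 : Algebra.FormallySmooth K (Localization.AtPrime q) :=
    have : Algebra.FormallySmooth A (Localization.AtPrime q) :=
      Algebra.FormallySmooth.of_isLocalization q.primeCompl
    Algebra.FormallySmooth.comp K A _
  let R := Localization.AtPrime (q.comap (f : MvPolynomial (Fin n) K →+* A))
  let S := Localization.AtPrime q
  let _ : Algebra R S := (Localization.localRingHom
    (q.comap (f : MvPolynomial (Fin n) K →+* A)) q (f : MvPolynomial (Fin n) K →+* A) rfl).toAlgebra
  have : IsScalarTower K R S := IsScalarTower.of_algebraMap_eq fun x => by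
    rw [IsScalarTower.algebraMap_apply K (MvPolynomial (Fin n) K) R, RingHom.algebraMap_toAlgebra,
      Localization.localRingHom_to_map, IsScalarTower.algebraMap_apply K A S]
    congr 1
    exact (f.commutes x).symm
  exact aux_local7 K R S hG.1


theorem aux8a (p : ℕ) [Fact p.Prime] (k : Type) [Field k] [CharP k p] (n : ℕ) (P' A B : Type)
    [CommRing P'] [CommRing A] [CommRing B] [Algebra k A] [Algebra k P'] [IsNoetherianRing P']
    (f : MvPolynomial (Fin n) k →ₐ[k] A) (i : MvPolynomial (Fin n) k →ₐ[k] P')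
    (j : A →+* B) (g : P' →+* B) (hf : Function.Surjective f) (hg : Function.Surjective g)
    (hi : (i : MvPolynomial (Fin n) k →+* P').Flat)
    (hcomm : g.comp (i : MvPolynomial (Fin n) k →+* P') =
      j.comp (f : MvPolynomial (Fin n) k →+* A))
    (hker : RingHom.ker g = (RingHom.ker (f : MvPolynomial (Fin n) k →+* A)).map
      (i : MvPolynomial (Fin n) k →+* P'))
    (hp : ∀ a : k, ∃ b : P', b ^ p = algebraMap k P' a)
    [IsRegularRing A] [IsRegularRing B] (q : Ideal A) [q.IsPrime] (Q : Ideal B) [Q.IsPrime]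
    (hq : q = Q.comap j) : Algebra.FormallySmooth k (Localization.AtPrime q) := by
  set f' : MvPolynomial (Fin n) k →+* A := (f : MvPolynomial (Fin n) k →+* A) with hf'
  set i' : MvPolynomial (Fin n) k →+* P' := (i : MvPolynomial (Fin n) k →+* P') with hi'
  obtain ⟨h1, h2, h3, h4⟩ := aux_R k n (q.comap f')
  obtain ⟨hG1, hG2⟩ := aux_G f' hf q
  obtain ⟨hH1, hH2⟩ := aux_G g hg Q
  have hqq : q.comap f' = (Q.comap g).comap i' := by
    rw [hq, Ideal.comap_comap, Ideal.comap_comap, hcomm]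
  let R := Localization.AtPrime (q.comap f')
  let S := Localization.AtPrime q
  let R' := Localization.AtPrime (Q.comap g)
  let _ : Algebra R S := (Localization.localRingHom (q.comap f') q f' rfl).toAlgebra
  let _ : Algebra R R' := (Localization.localRingHom (q.comap f') (Q.comap g) i' hqq).toAlgebra
  have : IsScalarTower k R S := IsScalarTower.of_algebraMap_eq fun x => by
    rw [IsScalarTower.algebraMap_apply k (MvPolynomial (Fin n) k) R, RingHom.algebraMap_toAlgebra,
      Localization.localRingHom_to_map, IsScalarTower.algebraMap_apply k A S]
    congr 1
    exact (f.commutes x).symm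
  have : IsScalarTower k R R' := IsScalarTower.of_algebraMap_eq fun x => by
    rw [IsScalarTower.algebraMap_apply k (MvPolynomial (Fin n) k) R, RingHom.algebraMap_toAlgebra,
      Localization.localRingHom_to_map, IsScalarTower.algebraMap_apply k P' R']
    congr 1
    exact (i.commutes x).symm
  have : Module.Flat R R' := hi.localRingHom (Q.comap g) (q.comap f') hqq
  have : IsLocalHom (algebraMap R R') := Localization.isLocalHom_localRingHom _ _ _ hqq
  have : CharP R' p := charP_of_injective_algebraMap (algebraMap k R').injective p
  have : IsNoetherianRing R' := IsLocalization.isNoetherianRing (Q.comap g).primeCompl R' inferInstance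
  have hJ : (RingHom.ker (algebraMap R S)).map (algebraMap R R') =
      RingHom.ker (Localization.localRingHom (Q.comap g) Q g rfl) := by
    rw [hH2, hker]
    have : RingHom.ker (algebraMap R S) = _ := hG2
    rw [this, Ideal.map_map, Ideal.map_map]
    congr 1
    refine RingHom.ext fun x => ?_
    exact Localization.localRingHom_to_map _ _ _ hqq x
  have : IsRegularLocalRing (R' ⧸ (RingHom.ker (algebraMap R S)).map (algebraMap R R')) := by
    rw [hJ]
    exact IsRegularLocalRing.of_ringEquiv (RingHom.quotientKerEquivOfSurjective hH1).symm
  refine aux_local8 p k R R' S hG1 ?_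
  intro a
  obtain ⟨b, hb⟩ := hp a
  exact ⟨algebraMap P' R' b, by rw [← map_pow, hb, ← IsScalarTower.algebraMap_apply]⟩

theorem aux8 (p : ℕ) [Fact p.Prime] (k k' A : Type) [Field k] [CharP k p] [Field k'] [Algebra k k']
    [CommRing A] [Algebra k A] (hft : Algebra.FiniteType k A) [IsRegularRing A]
    [IsRegularRing (k' ⊗[k] A)] (hp : ∀ a : k, ∃ b : k', b ^ p = algebraMap k k' a) :
    Algebra.Smooth k A := by
  obtain ⟨n, f, hf⟩ := Algebra.FiniteType.iff_quotient_mvPolynomial''.mp hft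
  have hfp : Algebra.FinitePresentation k A := Algebra.FinitePresentation.of_finiteType.mp hft
  refine ⟨?_, hfp⟩
  rw [← Algebra.smoothLocus_eq_univ_iff, Set.eq_univ_iff_forall]
  intro q
  change Algebra.FormallySmooth k (Localization.AtPrime q.asIdeal)
  have hN : IsNoetherianRing (k' ⊗[k] MvPolynomial (Fin n) k) :=
    Algebra.FiniteType.isNoetherianRing k' _
  have hff : Module.FaithfullyFlat A (A ⊗[k] k') := inferInstance
  obtain ⟨Q0, hQ0⟩ := PrimeSpectrum.comap_surjective_of_faithfullyFlat (A := A) (B := A ⊗[k] k') q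
  let e : k' ⊗[k] A ≃ₐ[k] A ⊗[k] k' := Algebra.TensorProduct.comm k k' A
  let Q := Q0.asIdeal.comap (e : k' ⊗[k] A →+* A ⊗[k] k')
  have hQ : Q.IsPrime := inferInstance
  refine aux8a p k n (k' ⊗[k] MvPolynomial (Fin n) k) A (k' ⊗[k] A) f
    Algebra.TensorProduct.includeRight
    (Algebra.TensorProduct.includeRight : A →ₐ[k] k' ⊗[k] A).toRingHom
    (Algebra.TensorProduct.map (AlgHom.id k k') f).toRingHom hf ?_ ?_ ?_ ?_ ?_ q.asIdeal Q ?_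
  · exact LinearMap.lTensor_surjective k' hf
  · have h1 : (algebraMap (MvPolynomial (Fin n) k) (MvPolynomial (Fin n) k ⊗[k] k')).Flat :=
      RingHom.flat_algebraMap_iff.mpr inferInstance
    have h2 : ((Algebra.TensorProduct.comm k (MvPolynomial (Fin n) k) k' :
        MvPolynomial (Fin n) k ⊗[k] k' ≃ₐ[k] k' ⊗[k] MvPolynomial (Fin n) k) :
        MvPolynomial (Fin n) k ⊗[k] k' →+* k' ⊗[k] MvPolynomial (Fin n) k).Flat :=
      RingHom.Flat.of_bijective (AlgEquiv.bijective _)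
    have h3 := h1.comp h2
    convert h3 using 1
    refine RingHom.ext fun x => ?_
    simp
  · refine RingHom.ext fun x => ?_
    simp
  · exact Algebra.TensorProduct.lTensor_ker f hf
  · intro a
    obtain ⟨b, hb⟩ := hp a
    refine ⟨b ⊗ₜ 1, ?_⟩
    rw [Algebra.TensorProduct.tmul_pow, hb, one_pow]
    rfl
  · rw [← hQ0]
    ext x
    rfl

theorem aux_bridge0 (R : Type) [CommRing R] [IsLocalRing R] :
    IsRegularLocalRingDef R ↔ IsRegularLocalRing R := by
  constructor
  · rintro ⟨h1, h2⟩
    rw [IsRegularLocalRing.iff_finrank_cotangentSpace]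
    exact h2.symm
  · intro h
    exact ⟨inferInstance, ((IsRegularLocalRing.iff_finrank_cotangentSpace R).mp h).symm⟩

theorem aux_bridge (A : Type) [CommRing A] (hN : IsNoetherianRing A) :
    (∀ (q : Ideal A) (_ : q.IsPrime), IsRegularLocalRingDef (Localization.AtPrime q)) ↔
      IsRegularRing A := by
  rw [isRegularRing_iff]
  constructor
  · intro h
    exact fun q hq => (aux_bridge0 _).mp (h q hq)
  · intro h q hq
    exact (aux_bridge0 _).mpr (h q)

theorem aux_bridge' (k K A : Type) [Field k] [Field K] [Algebra k K] [CommRing A] [Algebra k A]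
    (hA : Algebra.FiniteType k A) :
    (∀ (q : Ideal (A ⊗[k] K)) (_ : q.IsPrime), IsRegularLocalRingDef (Localization.AtPrime q)) ↔
      IsRegularRing (K ⊗[k] A) := by
  have hN : IsNoetherianRing (K ⊗[k] A) := Algebra.FiniteType.isNoetherianRing K _
  let e := (Algebra.TensorProduct.comm k K A).toRingEquiv
  have hN' : IsNoetherianRing (A ⊗[k] K) := isNoetherianRing_of_ringEquiv _ e
  rw [aux_bridge _ hN']
  exact ⟨fun h => IsRegularRing.of_ringEquiv e.symm, fun h => IsRegularRing.of_ringEquiv e⟩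

/-- **EGA IV.0.22.5.8.** A regular variety `X = Spec A` over a field `k` of
characteristic `p > 0` is smooth over `k` (i.e. `A ⊗_k k̄` is regular) if and only if
`A ⊗_k k^{1/p}` is regular. -/
theorem regular_basechange_algebraicClosure_iff_pth_roots
    (p : ℕ) [Fact p.Prime]
    (k : Type) [Field k] [CharP k p]
    (kp : IntermediateField k (AlgebraicClosure k))
    (hkp : ∀ x : AlgebraicClosure k, x ∈ kp ↔
      x ^ p ∈ Set.range (algebraMap k (AlgebraicClosure k)))
    (A : Type) [CommRing A] [Algebra k A] (hA : Algebra.FiniteType k A)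
    (hreg : ∀ (q : Ideal A) (_ : q.IsPrime), IsRegularLocalRingDef (Localization.AtPrime q)) :
    (∀ (Q : Ideal (A ⊗[k] (AlgebraicClosure k))) (_ : Q.IsPrime),
        IsRegularLocalRingDef (Localization.AtPrime Q)) ↔
      (∀ (Q : @Ideal (A ⊗[k] kp) CommRing.toCommSemiring.toSemiring) (_ : Q.IsPrime),
        IsRegularLocalRingDef (Localization.AtPrime Q)) := by
  have hA' : IsRegularRing A := aux_bridge A (Algebra.FiniteType.isNoetherianRing k A) |>.mp hreg
  rw [aux_bridge' k (AlgebraicClosure k) A hA, aux_bridge' k kp A hA]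
  constructor
  · intro h
    have hs : Algebra.Smooth (AlgebraicClosure k) (AlgebraicClosure k ⊗[k] A) := by
      have : CharP (AlgebraicClosure k) p :=
        charP_of_injective_algebraMap (algebraMap k (AlgebraicClosure k)).injective p
      have : IsRegularRing (AlgebraicClosure k ⊗[AlgebraicClosure k]
          (AlgebraicClosure k ⊗[k] A)) :=
        IsRegularRing.of_ringEquiv (Algebra.TensorProduct.lid (AlgebraicClosure k)
          (AlgebraicClosure k ⊗[k] A)).toRingEquiv.symm
      refine aux8 p (AlgebraicClosure k) (AlgebraicClosure k) (AlgebraicClosure k ⊗[k] A)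
        inferInstance ?_
      intro a
      exact IsAlgClosed.exists_pow_nat_eq a (Fact.out : p.Prime).pos
    have hs' : Algebra.Smooth k A :=
      Algebra.Smooth.of_smooth_tensorProduct_of_faithfullyFlat (AlgebraicClosure k)
    exact aux7 kp (kp ⊗[k] A)
  · intro h
    have hs : Algebra.Smooth k A := by
      refine aux8 p k kp A hA ?_
      intro a
      obtain ⟨b, hb⟩ := IsAlgClosed.exists_pow_nat_eq (algebraMap k (AlgebraicClosure k) a)
        (Fact.out : p.Prime).pos
      exact ⟨⟨b, (hkp b).mpr ⟨a, hb.symm⟩⟩, Subtype.ext hb⟩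
    exact aux7 (AlgebraicClosure k) (AlgebraicClosure k ⊗[k] A)
end
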